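/- Let m, d > 1 be integers with d > (m−1)². There is a constant c > 0 such that for all sufficiently large X, the number of isomorphism classes of number fields k of degree [k:ℚ] = d with |Disc(k)| < X and rank_m Cl(k) ≥ ⌈⌊(d+1)/2⌋ + d/(m−1) − m⌉ is at least c·X^(1/((m+1)d−1))/log X. -/

import Mathlib

open NumberField

/-- A homomorphism out of `ℤ^T` that kills `m ℤ^T` and whose kernel becomes, modulo `m`,
generated by `u` elements has image of `m`-rank at least `T - u`. -/
theorem exists_injective_zmod_of_ker_generated {m T u R : ℕ} (hm : 1 < m) (hR : R + u ≤ T)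
    {C : Type*} [AddCommGroup C] (Ψ : (Fin T → ℤ) →+ C)
    (hΨ : ∀ e, Ψ ((m : ℤ) • e) = 0) (w : Fin u → (Fin T → ℤ))
    (hker : ∀ e, Ψ e = 0 → ∃ (c : Fin u → ℤ) (y : Fin T → ℤ),
      e = ∑ i, c i • w i + (m : ℤ) • y) :
    ∃ f : (Fin R → ZMod m) →+ C, Function.Injective f := by
  classical
  have : NeZero m := ⟨by omega⟩
  let V : Submodule ℤ (Fin T → ℤ) := Submodule.span ℤ (Set.range w)
  obtain ⟨k, S⟩ := Submodule.smithNormalForm (Pi.basisFun ℤ (Fin T)) V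
  have hk : k ≤ u := by
    have h1 : Module.finrank ℤ V = k := by
      rw [Module.finrank_eq_card_basis S.bN, Fintype.card_fin]
    have h2 := finrank_range_le_card (R := ℤ) w
    rw [Fintype.card_fin] at h2
    rw [← h1]; exact h2
  -- indices outside the image of `S.f`
  have hcard : R ≤ Fintype.card {i : Fin T // i ∉ Set.range S.f} := by
    have h1 : Fintype.card {i : Fin T // i ∈ Set.range S.f} ≤ k := by
      have := Fintype.card_range S.f
      simp only [Fintype.card_fin] at this
      exact this.le
    have h2 := Fintype.card_subtype_compl (fun i : Fin T => i ∈ Set.range S.f)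
    rw [h2, Fintype.card_fin]; omega
  obtain ⟨j⟩ : Nonempty (Fin R ↪ {i : Fin T // i ∉ Set.range S.f}) :=
    Function.Embedding.nonempty_of_card_le (by simpa using hcard)
  have hVrepr : ∀ x ∈ V, ∀ i : Fin R, S.bM.repr x (j i) = 0 := by
    intro x hx i
    exact S.repr_eq_zero_of_notMem_range ⟨x, hx⟩ (j i).2
  let L : (Fin R → ℤ) →+ C :=
    { toFun := fun e => Ψ (∑ i, e i • S.bM (j i))
      map_zero' := by simp
      map_add' := fun a b => by simp [add_smul, Finset.sum_add_distrib] }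
  have hL : ∀ e : Fin R → ℤ, L e = 0 ↔ ∀ i, (m : ℤ) ∣ e i := by
    intro e
    constructor
    · intro h i
      obtain ⟨c, y, hcy⟩ := hker _ h
      have h1 : S.bM.repr (∑ i, e i • S.bM (j i)) (j i) = e i := by
        simp only [map_sum, map_smul, Module.Basis.repr_self, Finsupp.coe_finsetSum,
          Finset.sum_apply, Finsupp.coe_smul, Pi.smul_apply, smul_eq_mul]
        rw [Finset.sum_eq_single i]
        · simp
        · intro b _ hb
          rw [Finsupp.single_apply, if_neg, mul_zero]
          intro hh; exact hb (j.injective (Subtype.ext hh))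
        · simp
      have h2 : ∑ i, c i • w i ∈ V :=
        Submodule.sum_mem _ fun i _ => Submodule.smul_mem _ _
          (Submodule.subset_span (Set.mem_range_self i))
      rw [hcy, map_add, Finsupp.add_apply, hVrepr _ h2, zero_add, map_smul,
        Finsupp.smul_apply, smul_eq_mul] at h1
      exact ⟨_, h1.symm⟩
    · intro h
      choose y hy using h
      have : ∑ i, e i • S.bM (j i) = (m : ℤ) • ∑ i, y i • S.bM (j i) := by
        rw [Finset.smul_sum]
        refine Finset.sum_congr rfl fun i _ => ?_
        rw [hy i, mul_smul]
      change Ψ _ = 0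
      rw [this, hΨ]
  let q : (Fin R → ℤ) →+ (Fin R → ZMod m) :=
    { toFun := fun e i => (e i : ZMod m)
      map_zero' := by ext; simp
      map_add' := fun a b => by ext; simp }
  have hq : Function.Surjective q := by
    intro z
    refine ⟨fun i => (z i).val, ?_⟩
    ext i
    simp [q]
  have hqL : ∀ e, q e = 0 ↔ L e = 0 := by
    intro e
    rw [hL, funext_iff]
    simp only [q, AddMonoidHom.coe_mk, ZeroHom.coe_mk, Pi.zero_apply]
    exact forall_congr' fun i => ZMod.intCast_zmod_eq_zero_iff_dvd (e i) m
  refine ⟨(AddMonoidHom.liftOfSurjective q hq) ⟨L, fun e he => (hqL e).1 he⟩, ?_⟩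
  rw [injective_iff_map_eq_zero]
  intro z hz
  obtain ⟨e, rfl⟩ := hq z
  have h3 : (AddMonoidHom.liftOfSurjective q hq) ⟨L, fun e he => (hqL e).1 he⟩ (q e) = L e :=
    AddMonoidHom.liftOfRightInverse_comp_apply _ _ _ ⟨L, _⟩ e
  rw [h3] at hz
  exact (hqL e).2 hz

/-- If the classes in `Ψ` vanish only up to a `u`-generated group of units, and the elements are
independent modulo `m`-th powers, then the image of `Ψ` has `m`-rank at least `T - u`. -/
theorem exists_injective_zmod_of_units {m T u R : ℕ} (hm : 1 < m) (hR : R + u ≤ T)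
    {A C : Type*} [AddCommGroup A] [AddCommGroup C] (φ : (Fin T → ℤ) →+ A)
    (π : (Fin u → ℤ) →+ A) (Ψ : (Fin T → ℤ) →+ C) (hΨ : ∀ e, Ψ ((m : ℤ) • e) = 0)
    (hker : ∀ e, Ψ e = 0 → ∃ x β, φ e = π x + (m : ℤ) • β)
    (hind : ∀ e β, φ e = (m : ℤ) • β → ∀ k, (m : ℤ) ∣ e k) :
    ∃ f : (Fin R → ZMod m) →+ C, Function.Injective f := by
  classical
  let W : Submodule ℤ (Fin u → ℤ) :=
    { carrier := {x | ∃ e β, φ e = π x + (m : ℤ) • β}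
      zero_mem' := ⟨0, 0, by simp⟩
      add_mem' := by
        rintro x y ⟨e, β, h⟩ ⟨e', β', h'⟩
        refine ⟨e + e', β + β', ?_⟩
        rw [map_add, map_add, h, h', smul_add]; abel
      smul_mem' := by
        rintro c x ⟨e, β, h⟩
        refine ⟨c • e, c • β, ?_⟩
        rw [map_zsmul, map_zsmul, h, smul_add, smul_comm] }
  obtain ⟨k, b⟩ := Submodule.basisOfPid (Pi.basisFun ℤ (Fin u)) W
  have hk : k ≤ u := by
    have h1 : Module.finrank ℤ W = k := by
      rw [Module.finrank_eq_card_basis b, Fintype.card_fin]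
    have h2 := Submodule.finrank_le W
    rw [h1] at h2
    simpa using h2
  have hb : ∀ i : Fin k, ∃ e β, φ e = π (b i : Fin u → ℤ) + (m : ℤ) • β := fun i => (b i).2
  choose w β hw using hb
  refine exists_injective_zmod_of_ker_generated (u := k) hm (by omega) Ψ hΨ w ?_
  intro e he
  obtain ⟨x, γ, hx⟩ := hker e he
  have hxW : x ∈ W := ⟨e, γ, hx⟩
  let c := b.repr ⟨x, hxW⟩
  have hc : ∑ i, c i • (b i : Fin u → ℤ) = x := by
    have := congrArg W.subtype (b.sum_repr ⟨x, hxW⟩)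
    rw [map_sum] at this
    exact this
  have key : φ (e - ∑ i, c i • w i) = (m : ℤ) • (γ - ∑ i, c i • β i) := by
    rw [map_sub, map_sum, hx, ← hc, map_sum]
    simp only [map_zsmul, hw, smul_add, Finset.sum_add_distrib, smul_sub, Finset.smul_sum]
    simp only [smul_comm (m : ℤ)]
    abel
  have hdvd := hind _ _ key
  choose y hy using hdvd
  refine ⟨c, y, ?_⟩
  have : e - ∑ i, c i • w i = (m : ℤ) • y := by
    ext i; rw [hy i]; simp
  rw [← this]; abel

open scoped nonZeroDivisors in
/-- An element whose valuation at every prime is an `m`-th power generates the `m`-th power of a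
fractional ideal. -/
theorem exists_fractionalIdeal_pow_eq_toPrincipalIdeal {R K : Type*} [CommRing R]
    [IsDedekindDomain R] [Field K] [Algebra R K] [IsFractionRing R K] {m : ℕ} (hm : 0 < m)
    (x : Kˣ) (hx : ∀ v : IsDedekindDomain.HeightOneSpectrum R,
      ∃ z : WithZero (Multiplicative ℤ), v.valuation K (x : K) = z ^ m) :
    ∃ I : (FractionalIdeal R⁰ K)ˣ, I ^ m = toPrincipalIdeal R K x := by
  classical
  obtain ⟨a, b, hab⟩ := IsLocalization.exists_mk'_eq R⁰ (x : K)
  have hb : algebraMap R K b ≠ 0 := IsFractionRing.to_map_ne_zero_of_mem_nonZeroDivisors b.2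
  have hxab : (x : K) * algebraMap R K b = algebraMap R K a := by
    rw [← hab]; exact IsLocalization.mk'_spec K a b
  set c : R := a * (b : R) ^ (m - 1) with hc
  have hcx : algebraMap R K c = (x : K) * algebraMap R K b ^ m := by
    rw [hc, map_mul, map_pow, ← hxab, mul_assoc, ← pow_succ', Nat.sub_add_cancel hm]
  have hc0 : c ≠ 0 := by
    intro h
    rw [h, map_zero] at hcx
    exact (mul_ne_zero x.ne_zero (pow_ne_zero _ hb)) hcx.symm
  have hspan : (Ideal.span {c} : Ideal R) ≠ 0 := by
    rw [Ne, Ideal.zero_eq_bot, Ideal.span_singleton_eq_bot]; exact hc0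
  have hcount : ∀ v : IsDedekindDomain.HeightOneSpectrum R,
      m ∣ (Associates.mk v.asIdeal).count (Associates.mk (Ideal.span {c})).factors := by
    intro v
    obtain ⟨z, hz⟩ := hx v
    have h1 : v.valuation K (algebraMap R K c) = (z * v.valuation K (algebraMap R K b)) ^ m := by
      rw [hcx, map_mul, map_pow, hz, mul_pow]
    rw [v.valuation_of_algebraMap, v.intValuation_if_neg hc0] at h1
    have hy0 : z * v.valuation K (algebraMap R K b) ≠ 0 := by
      intro h
      rw [h, zero_pow hm.ne'] at h1
      exact WithZero.exp_ne_zero h1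
    obtain ⟨n, hn⟩ : ∃ n : ℤ, z * v.valuation K (algebraMap R K b) = WithZero.exp n :=
      ⟨_, (WithZero.exp_log hy0).symm⟩
    rw [hn, ← WithZero.exp_nsmul] at h1
    have h2 := WithZero.exp_injective h1
    have h3 : (m : ℤ) ∣
        ((Associates.mk v.asIdeal).count (Associates.mk (Ideal.span {c})).factors : ℤ) := by
      refine ⟨-n, ?_⟩
      rw [nsmul_eq_mul] at h2
      linarith
    exact_mod_cast h3
  choose k hk using hcount
  have hfin := Ideal.hasFiniteMulSupport hspan
  set J : Ideal R := ∏ᶠ v : IsDedekindDomain.HeightOneSpectrum R, v.asIdeal ^ k v with hJ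
  have hsupp : (Function.mulSupport fun v : IsDedekindDomain.HeightOneSpectrum R =>
      v.asIdeal ^ k v).Finite := by
    refine Set.Finite.subset hfin ?_
    intro v hv
    rw [Function.mem_mulSupport] at hv ⊢
    intro h
    apply hv
    rw [IsDedekindDomain.HeightOneSpectrum.maxPowDividing, hk v, pow_mul', Ideal.one_eq_top] at h
    rw [Ideal.one_eq_top]
    by_contra hne
    have := Ideal.pow_le_self (I := v.asIdeal ^ k v) hm.ne'
    rw [h, top_le_iff] at this
    exact hne this
  have hJm : J ^ m = Ideal.span {c} := by
    rw [← Ideal.finprod_heightOneSpectrum_factorization hspan, hJ, finprod_pow hsupp]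
    refine finprod_congr fun v => ?_
    rw [IsDedekindDomain.HeightOneSpectrum.maxPowDividing, hk v, pow_mul']
  have hJ0 : J ≠ 0 := by
    intro h
    rw [h, zero_pow hm.ne'] at hJm
    exact hspan hJm.symm
  set bu : Kˣ := Units.mk0 _ hb
  refine ⟨FractionalIdeal.mk0 K ⟨J, mem_nonZeroDivisors_of_ne_zero hJ0⟩ *
    (toPrincipalIdeal R K bu)⁻¹, ?_⟩
  rw [mul_pow, inv_pow, mul_inv_eq_iff_eq_mul, ← map_pow, ← map_pow, ← map_mul]
  ext1
  rw [coe_toPrincipalIdeal, FractionalIdeal.coe_mk0]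
  simp only [SubmonoidClass.mk_pow]
  rw [hJm, FractionalIdeal.coeIdeal_span_singleton, hcx]
  rfl

open scoped nonZeroDivisors in
/-- If `g₁, …, g_T` have valuations that are `m`-th powers, are independent modulo `m`-th powers,
and the units among their products are generated modulo `m`-th powers by `u` elements, then the
class group has `m`-rank at least `T - u`. -/
theorem exists_injective_zmod_classGroup {R K : Type*} [CommRing R]
    [IsDedekindDomain R] [Field K] [Algebra R K] [IsFractionRing R K] {m T u r : ℕ} (hm : 1 < m)
    (hr : r + u ≤ T) (g : Fin T → Kˣ)
    (hg : ∀ k, ∀ v : IsDedekindDomain.HeightOneSpectrum R,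
      ∃ z : WithZero (Multiplicative ℤ), v.valuation K (g k : K) = z ^ m)
    (π : (Fin u → ℤ) →+ Additive Kˣ)
    (hunit : ∀ (e : Fin T → ℤ) (ε : Rˣ) (β : Kˣ),
      ∏ k, g k ^ e k = Units.map (algebraMap R K : R →* K) ε * β ^ m →
      ∃ x β', Additive.ofMul (∏ k, g k ^ e k) = π x + (m : ℤ) • β')
    (hind : ∀ (e : Fin T → ℤ) (β : Kˣ), ∏ k, g k ^ e k = β ^ m → ∀ k, (m : ℤ) ∣ e k) :
    ∃ f : (Fin r → ZMod m) →+ Additive (ClassGroup R), Function.Injective f := by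
  classical
  have hI : ∀ k, ∃ I : (FractionalIdeal R⁰ K)ˣ, I ^ m = toPrincipalIdeal R K (g k) := fun k =>
    exists_fractionalIdeal_pow_eq_toPrincipalIdeal (by omega) (g k) (hg k)
  choose I hI using hI
  let φ : (Fin T → ℤ) →+ Additive Kˣ :=
    { toFun := fun e => Additive.ofMul (∏ k, g k ^ e k)
      map_zero' := by simp
      map_add' := fun a b => by simp [zpow_add, Finset.prod_mul_distrib] }
  let q : (FractionalIdeal R⁰ K)ˣ →* ClassGroup R :=
    (ClassGroup.equiv K).symm.toMonoidHom.comp (QuotientGroup.mk' (toPrincipalIdeal R K).range)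
  have hmk : ∀ J : (FractionalIdeal R⁰ K)ˣ, q J = 1 ↔ ∃ β, toPrincipalIdeal R K β = J := by
    intro J
    change (ClassGroup.equiv K).symm (QuotientGroup.mk' (toPrincipalIdeal R K).range J) = 1 ↔ _
    rw [← map_one (ClassGroup.equiv K).symm, (ClassGroup.equiv K).symm.injective.eq_iff,
      QuotientGroup.mk'_apply, QuotientGroup.eq_one_iff, MonoidHom.mem_range]
  let Ψ : (Fin T → ℤ) →+ Additive (ClassGroup R) :=
    { toFun := fun e => Additive.ofMul (q (∏ k, I k ^ e k))
      map_zero' := by simp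
      map_add' := fun a b => by
        simp only [Pi.add_apply, zpow_add, Finset.prod_mul_distrib, map_mul]
        rfl }
  have hIpow : ∀ e : Fin T → ℤ, (∏ k, I k ^ e k) ^ m = toPrincipalIdeal R K (∏ k, g k ^ e k) := by
    intro e
    rw [map_prod, ← Finset.prod_pow]
    refine Finset.prod_congr rfl fun k _ => ?_
    rw [map_zpow, ← hI k, ← zpow_natCast, ← zpow_natCast, zpow_comm]
  refine exists_injective_zmod_of_units hm hr φ π Ψ ?_ ?_ ?_
  · intro e
    change q (∏ k, I k ^ ((m : ℤ) • e) k) = 1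
    rw [hmk]
    refine ⟨∏ k, g k ^ e k, ?_⟩
    rw [← hIpow, ← Finset.prod_pow]
    refine Finset.prod_congr rfl fun k _ => ?_
    simp only [Pi.smul_apply, smul_eq_mul]
    rw [mul_comm, zpow_mul, zpow_natCast]
  · intro e he
    have he' : q (∏ k, I k ^ e k) = 1 := he
    rw [hmk] at he'
    obtain ⟨β, hβ⟩ := he'
    have h1 : toPrincipalIdeal R K (β ^ m) = toPrincipalIdeal R K (∏ k, g k ^ e k) := by
      rw [← hIpow, ← hβ, map_pow]
    have h2 := congrArg (fun J : (FractionalIdeal R⁰ K)ˣ => (J : FractionalIdeal R⁰ K)) h1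
    simp only [coe_toPrincipalIdeal] at h2
    rw [FractionalIdeal.spanSingleton_eq_spanSingleton] at h2
    obtain ⟨ε, hε⟩ := h2
    refine hunit e ε β ?_
    ext
    rw [← hε, Units.val_mul, Units.coe_map, Units.smul_def, Algebra.smul_def]
    rfl
  · intro e β h
    refine hind e (Additive.toMul β) ?_
    have := congrArg Additive.toMul h
    simpa [φ] using this

/-- A lower bound for the `m`-rank of the class group of a number field. -/
theorem exists_injective_zmod_classGroup_numberField {K : Type*} [Field K] [NumberField K]
    {m T r : ℕ} (hm : 1 < m) (g : Fin T → Kˣ)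
    (hr : r + (NumberField.Units.rank K + 1) ≤ T ∨
      (r + NumberField.Units.rank K ≤ T ∧ ∃ σ : K →+* ℝ, ∀ k, 0 < σ (g k : K)))
    (hg : ∀ k, ∀ v : IsDedekindDomain.HeightOneSpectrum (NumberField.RingOfIntegers K),
      ∃ z : WithZero (Multiplicative ℤ), v.valuation K (g k : K) = z ^ m)
    (hind : ∀ (e : Fin T → ℤ) (β : Kˣ), ∏ k, g k ^ e k = β ^ m → ∀ k, (m : ℤ) ∣ e k) :
    ∃ f : (Fin r → ZMod m) →+ Additive (ClassGroup (NumberField.RingOfIntegers K)),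
      Function.Injective f := by
  classical
  set ι : (NumberField.RingOfIntegers K)ˣ →* Kˣ :=
    Units.map (algebraMap (NumberField.RingOfIntegers K) K : NumberField.RingOfIntegers K →* K)
    with hι
  rcases hr with hr | ⟨hr, σ, hσ⟩
  · obtain ⟨ζ, hζ⟩ := IsCyclic.exists_generator (α := NumberField.Units.torsion K)
    let π : (Fin (NumberField.Units.rank K + 1) → ℤ) →+ Additive Kˣ :=
      { toFun := fun e => Additive.ofMul
          (ι (ζ ^ e 0 * ∏ i, NumberField.Units.fundSystem K i ^ e (Fin.succ i)))
        map_zero' := by simp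
        map_add' := fun a b => by
          rw [← ofMul_mul, ← map_mul]
          simp only [Pi.add_apply, zpow_add, Finset.prod_mul_distrib]
          congr 2
          exact mul_mul_mul_comm _ _ _ _ }
    refine exists_injective_zmod_classGroup hm hr g hg π ?_ hind
    intro e ε β h
    obtain ⟨⟨z, x⟩, hx, -⟩ := NumberField.Units.exist_unique_eq_mul_prod K ε
    obtain ⟨n, hn⟩ := Subgroup.mem_zpowers_iff.1 (hζ z)
    refine ⟨Fin.cons n x, Additive.ofMul β, ?_⟩
    rw [h, ofMul_mul, natCast_zsmul, ← ofMul_pow]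
    congr 1
    change Additive.ofMul (ι ε) = Additive.ofMul (ι _)
    rw [hx]
    simp only [Fin.cons_zero, Fin.cons_succ, ← hn, Subgroup.coe_zpow]
  · let s : Fin (NumberField.Units.rank K) → (NumberField.RingOfIntegers K)ˣ := fun i =>
      if 0 < σ (ι (NumberField.Units.fundSystem K i) : K) then 1 else -1
    have hs : ∀ i, s i = 1 ∨ s i = -1 := by
      intro i; simp only [s]; split_ifs <;> simp
    let η : Fin (NumberField.Units.rank K) → (NumberField.RingOfIntegers K)ˣ := fun i =>
      s i * NumberField.Units.fundSystem K i
    have hη : ∀ i, 0 < σ (ι (η i) : K) := by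
      intro i
      simp only [η, s]
      split_ifs with h
      · simpa using h
      · have hne : σ (ι (NumberField.Units.fundSystem K i) : K) ≠ 0 := by
          rw [Ne, map_eq_zero]; exact Units.ne_zero _
        have h2 : σ (ι (NumberField.Units.fundSystem K i) : K) < 0 :=
          lt_of_le_of_ne (not_lt.1 h) hne
        have : (ι (-1 * NumberField.Units.fundSystem K i) : K) =
            -(ι (NumberField.Units.fundSystem K i) : K) := by
          simp [hι]
        rw [this, map_neg]; linarith
    let π : (Fin (NumberField.Units.rank K) → ℤ) →+ Additive Kˣ :=
      { toFun := fun e => Additive.ofMul (ι (∏ i, η i ^ e i))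
        map_zero' := by simp
        map_add' := fun a b => by
          rw [← ofMul_mul, ← map_mul]
          simp only [Pi.add_apply, zpow_add, Finset.prod_mul_distrib] }
    refine exists_injective_zmod_classGroup hm hr g hg π ?_ hind
    intro e ε β h
    obtain ⟨⟨z, x⟩, hx, -⟩ := NumberField.Units.exist_unique_eq_mul_prod K ε
    have hz : (z : (NumberField.RingOfIntegers K)ˣ) = 1 ∨
        (z : (NumberField.RingOfIntegers K)ˣ) = -1 := by
      have h1 : IsOfFinOrder (z : (NumberField.RingOfIntegers K)ˣ) := z.2
      obtain ⟨n, hn, h1⟩ := isOfFinOrder_iff_pow_eq_one.1 h1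
      have h2 : σ (ι z : K) ^ n = 1 := by
        rw [← map_pow, ← Units.val_pow_eq_pow_val, ← map_pow, h1]; simp
      have h3 : |σ (ι z : K)| = 1 := by
        have := congrArg abs h2
        rw [abs_pow, abs_one] at this
        exact (pow_eq_one_iff_of_nonneg (abs_nonneg _) hn.ne').1 this
      rcases (abs_eq zero_le_one).1 h3 with h4 | h4
      · left
        have : σ (ι z : K) = σ 1 := by rw [h4, map_one]
        have := σ.injective this
        ext; simpa [hι] using this
      · right
        have : σ (ι z : K) = σ (-1) := by rw [h4, map_neg, map_one]
        have := σ.injective this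
        ext; simpa [hι] using this
    obtain ⟨z', hz', hε⟩ : ∃ z' : (NumberField.RingOfIntegers K)ˣ, (z' = 1 ∨ z' = -1) ∧
        ε = z' * ∏ i, η i ^ x i := by
      refine ⟨z * ∏ i, (s i ^ x i)⁻¹, ?_, ?_⟩
      · have key : ∀ t : Finset (Fin (NumberField.Units.rank K)),
            ∏ i ∈ t, (s i ^ x i)⁻¹ = 1 ∨ ∏ i ∈ t, (s i ^ x i)⁻¹ = -1 := by
          intro t
          refine Finset.prod_induction _ (fun y => y = 1 ∨ y = -1) ?_ (Or.inl rfl) ?_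
          · rintro a b (rfl | rfl) (rfl | rfl) <;> simp
          · intro i _
            rcases hs i with h | h
            · simp [h]
            · rw [h]
              rcases Int.even_or_odd (x i) with h' | h'
              · left; rw [Even.neg_one_zpow h']; simp
              · right; rw [Odd.neg_one_zpow h']; simp
        rcases hz with h | h <;> rcases key Finset.univ with h' | h' <;> rw [h, h'] <;> simp
      · rw [hx]
        simp only [η, mul_zpow, Finset.prod_mul_distrib, Finset.prod_inv_distrib]
        rw [mul_assoc, inv_mul_cancel_left]
    have hpos1 : 0 < σ ((∏ k, g k ^ e k : Kˣ) : K) := by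
      rw [Units.coe_prod, map_prod]
      refine Finset.prod_pos fun k _ => ?_
      rw [Units.val_zpow_eq_zpow_val, map_zpow₀]
      exact zpow_pos (hσ k) _
    have hpos2 : 0 < σ (ι (∏ i, η i ^ x i) : K) := by
      rw [map_prod, Units.coe_prod, map_prod]
      refine Finset.prod_pos fun k _ => ?_
      rw [map_zpow, Units.val_zpow_eq_zpow_val, map_zpow₀]
      exact zpow_pos (hη k) _
    obtain ⟨y, hy⟩ : ∃ y : Kˣ, ι z' = y ^ m := by
      rcases Nat.even_or_odd m with hme | hmo
      · refine ⟨1, ?_⟩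
        rw [one_pow]
        rcases hz' with h' | h'
        · rw [h', map_one]
        · exfalso
          rw [h, hε, h'] at hpos1
          have h5 : ((Units.map (algebraMap (NumberField.RingOfIntegers K) K :
              NumberField.RingOfIntegers K →* K) (-1 * ∏ i, η i ^ x i) * β ^ m : Kˣ) : K) =
              -((ι (∏ i, η i ^ x i) : K) * (β : K) ^ m) := by
            rw [← hι, map_mul, Units.val_mul, Units.val_mul, Units.val_pow_eq_pow_val]
            simp [hι]
          rw [h5, map_neg, map_mul, map_pow] at hpos1
          have := hme.pow_nonneg (σ (β : K))
          nlinarith [mul_nonneg hpos2.le this]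
      · rcases hz' with h' | h'
        · exact ⟨1, by rw [h', map_one, one_pow]⟩
        · refine ⟨-1, ?_⟩
          rw [h', Odd.neg_one_pow hmo]
          ext; simp [hι]
    refine ⟨x, Additive.ofMul (y * β), ?_⟩
    rw [h, natCast_zsmul, ← ofMul_pow]
    change _ = Additive.ofMul (ι (∏ i, η i ^ x i)) + _
    rw [← ofMul_mul]
    congr 1
    rw [← hι, hε, map_mul, hy, mul_pow]
    rw [mul_comm (y ^ m), mul_assoc]

theorem Valuation.map_intCast_le_one' {K Γ : Type*} [Field K] [LinearOrderedCommGroupWithZero Γ]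
    (v : Valuation K Γ) (n : ℤ) : v (n : K) ≤ 1 := by
  have hnat : ∀ k : ℕ, v (k : K) ≤ 1 := by
    intro k
    induction k with
    | zero => simp
    | succ k ih =>
      rw [Nat.cast_succ]
      exact (v.map_add _ _).trans (max_le ih (by simp))
  rcases Int.eq_nat_or_neg n with ⟨k, rfl | rfl⟩
  · simpa using hnat k
  · simpa using hnat k

theorem Valuation.map_aeval_le_one {K Γ : Type*} [Field K] [LinearOrderedCommGroupWithZero Γ]
    (v : Valuation K Γ) {α : K} (hα : v α ≤ 1) (P : Polynomial ℤ) :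
    v (Polynomial.aeval α P) ≤ 1 := by
  rw [Polynomial.aeval_eq_sum_range]
  refine v.map_sum_le fun i _ => ?_
  rw [zsmul_eq_mul, map_mul, map_pow]
  exact mul_le_one' (v.map_intCast_le_one' _) (pow_le_one' hα _)

theorem Valuation.map_intCast_mono {K Γ : Type*} [Field K] [LinearOrderedCommGroupWithZero Γ]
    (v : Valuation K Γ) {a b : ℤ} (h : a ∣ b) : v (b : K) ≤ v (a : K) := by
  obtain ⟨c, rfl⟩ := h
  rw [Int.cast_mul, map_mul]
  exact mul_le_of_le_one_right' (v.map_intCast_le_one' c)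

theorem Valuation.map_intCast_eq_one_of_isCoprime {K Γ : Type*} [Field K]
    [LinearOrderedCommGroupWithZero Γ] (v : Valuation K Γ) {a b : ℤ} (h : IsCoprime a b)
    (hb : v (b : K) < 1) : v (a : K) = 1 := by
  obtain ⟨x, y, hxy⟩ := h
  refine le_antisymm (v.map_intCast_le_one' a) ?_
  by_contra hlt
  rw [not_le] at hlt
  have h1 : v ((x * a + y * b : ℤ) : K) < 1 := by
    push_cast
    refine v.map_add_lt ?_ ?_
    · rw [map_mul]; exact (mul_le_of_le_one_left' (v.map_intCast_le_one' x)).trans_lt hlt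
    · rw [map_mul]; exact (mul_le_of_le_one_left' (v.map_intCast_le_one' y)).trans_lt hb
  rw [hxy] at h1
  simp at h1

/-- On the curve `x^ρ (t + R(x))^m = ∏ (x - bᵢ^m)`, at parameters `t = s / (Bℓ)` with `s` prime to
`Bℓ` and `B` sufficiently divisible, the functions `(x - b_k^m) / (x - b_j^m)` take values whose
valuations are all `m`-th powers. -/
theorem Valuation.exists_pow_eq_div {K Γ : Type*} [Field K] [CharZero K]
    [LinearOrderedCommGroupWithZero Γ] (v : Valuation K Γ) {ρ m n : ℕ} (hm : 0 < m)
    (b : Fin n → ℤ) (R : Polynomial ℤ) {D Z l s : ℤ} (hZ : Z ≠ 0) (hl : l ≠ 0)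
    (hD : D ∣ Z) (hb : ∀ i, b i ^ m ∣ Z) (hbb : ∀ i j, i ≠ j → b i ^ m - b j ^ m ∣ Z)
    (hs : IsCoprime s (Z * l)) {α : K}
    (hα : α ^ ρ * ((s : K) / (Z ^ (ρ + 2) * l) + Polynomial.aeval α R / D) ^ m =
      ∏ i, (α - (b i : K) ^ m)) (k j : Fin n) :
    ∃ z : Γ, v ((α - (b k : K) ^ m) / (α - (b j : K) ^ m)) = z ^ m := by
  have hZK : (Z : K) ≠ 0 := Int.cast_ne_zero.2 hZ
  have hlK : (l : K) ≠ 0 := Int.cast_ne_zero.2 hl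
  have hvZ : v (Z : K) ≠ 0 := (v.ne_zero_iff).2 hZK
  have hvl : v (l : K) ≠ 0 := (v.ne_zero_iff).2 hlK
  have hvZ1 := v.map_intCast_le_one' Z
  have hvl1 := v.map_intCast_le_one' l
  have hvb : ∀ i, v (Z : K) ≤ v ((b i : K) ^ m) := fun i => by
    simpa using v.map_intCast_mono (hb i)
  have hvb1 : ∀ i, v ((b i : K) ^ m) ≤ 1 := fun i => by
    simpa using v.map_intCast_le_one' (b i ^ m)
  by_cases h1 : 1 < v α
  · have h2 : ∀ i, v (α - (b i : K) ^ m) = v α := fun i =>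
      v.map_sub_eq_of_lt_left ((hvb1 i).trans_lt h1)
    refine ⟨1, ?_⟩
    rw [map_div₀, h2, h2, one_pow, div_self]
    exact (zero_lt_one.trans h1).ne'
  rw [not_lt] at h1
  suffices h : ∀ i, ∃ z : Γ, v (α - (b i : K) ^ m) = z ^ m by
    obtain ⟨y, hy⟩ := h k
    obtain ⟨z, hz⟩ := h j
    exact ⟨y / z, by rw [map_div₀, hy, hz, div_pow]⟩
  have hRD : v (Polynomial.aeval α R / (D : K)) ≤ (v (Z : K))⁻¹ := by
    rw [map_div₀, div_eq_mul_inv]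
    refine mul_le_of_le_one_of_le (v.map_aeval_le_one h1 R) ?_
    exact inv_anti₀ (zero_lt_iff.2 hvZ) (v.map_intCast_mono hD)
  set τ : K := (s : K) / (Z ^ (ρ + 2) * l) with hτ
  by_cases h2 : v ((Z * l : ℤ) : K) < 1
  · have hvs : v (s : K) = 1 := v.map_intCast_eq_one_of_isCoprime hs h2
    have hvτ : v τ = (v (Z : K) ^ (ρ + 2) * v (l : K))⁻¹ := by
      rw [hτ, map_div₀, hvs, map_mul, map_pow, one_div]
    have hlt : v (Z : K) * v (l : K) < 1 := by simpa using h2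
    have hAτ : v (τ + Polynomial.aeval α R / (D : K)) = v τ := by
      refine v.map_add_eq_of_lt_left (hRD.trans_lt ?_)
      rw [hvτ]
      refine inv_strictAnti₀ (mul_pos (pow_pos (zero_lt_iff.2 hvZ) _) (zero_lt_iff.2 hvl)) ?_
      rw [pow_succ', mul_assoc]
      refine mul_lt_of_lt_one_right (zero_lt_iff.2 hvZ) (lt_of_le_of_lt ?_ hlt)
      gcongr
      exact pow_le_of_le_one zero_le hvZ1 (Nat.succ_ne_zero _)
    have hsmall : ∀ i, v α < v ((b i : K) ^ m) := by
      intro i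
      by_contra hcon
      rw [not_lt] at hcon
      have h3 : v Z ≤ v α := (hvb i).trans hcon
      have h4 : v (α ^ ρ * (τ + Polynomial.aeval α R / D) ^ m) ≤ 1 := by
        rw [hα, map_prod]
        refine Finset.prod_le_one' fun i _ => ?_
        exact (v.map_sub _ _).trans (max_le h1 (hvb1 i))
      rw [map_mul, map_pow, map_pow, hAτ, hvτ] at h4
      have h5 : v (Z : K) ^ ρ * ((v (Z : K) ^ (ρ + 2) * v (l : K))⁻¹) ^ m ≤ 1 :=
        (mul_le_mul_left (pow_le_pow_left' h3 ρ) _).trans h4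
      rw [inv_pow, mul_inv_le_iff₀ (pow_pos (mul_pos (pow_pos (zero_lt_iff.2 hvZ) _)
        (zero_lt_iff.2 hvl)) _), one_mul] at h5
      have h6 : (v (Z : K) ^ (ρ + 2) * v (l : K)) ^ m ≤ v (Z : K) ^ (ρ + 2) * v (l : K) :=
        pow_le_of_le_one zero_le (mul_le_one' (pow_le_one' hvZ1 _) hvl1) hm.ne'
      refine absurd (h5.trans h6) (not_le.2 ?_)
      rw [pow_add, mul_assoc]
      refine mul_lt_of_lt_one_right (pow_pos (zero_lt_iff.2 hvZ) _) (lt_of_le_of_lt ?_ hlt)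
      gcongr
      exact pow_le_of_le_one zero_le hvZ1 two_ne_zero
    intro i
    refine ⟨v (b i : K), ?_⟩
    rw [v.map_sub_eq_of_lt_right (hsmall i), map_pow]
  · have hZl : v (Z : K) = 1 ∧ v (l : K) = 1 := by
      rw [not_lt, Int.cast_mul, map_mul] at h2
      constructor
      · exact le_antisymm hvZ1 (h2.trans (mul_le_of_le_one_right' hvl1))
      · exact le_antisymm hvl1 (h2.trans (mul_le_of_le_one_left' hvZ1))
    have hA : v (τ + Polynomial.aeval α R / (D : K)) ≤ 1 := by
      refine (v.map_add _ _).trans (max_le ?_ (by simpa [hZl.1] using hRD))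
      rw [hτ, map_div₀, map_mul, map_pow, hZl.1, hZl.2]
      simpa using v.map_intCast_le_one' s
    intro i
    by_cases h3 : v (α - (b i : K) ^ m) < 1
    · refine ⟨v (τ + Polynomial.aeval α R / (D : K)), ?_⟩
      have hbi : v ((b i : K) ^ m) = 1 := le_antisymm (hvb1 i) (hZl.1 ▸ hvb i)
      have hα1 : v α = 1 := by
        have := v.map_add_eq_of_lt_right (x := α - (b i : K) ^ m) (y := (b i : K) ^ m)
          (by rw [hbi]; exact h3)
        rw [sub_add_cancel] at this
        rw [this, hbi]
      have hoth : ∀ j, j ≠ i → v (α - (b j : K) ^ m) = 1 := by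
        intro j hj
        have h5 : v ((b i : K) ^ m - (b j : K) ^ m) = 1 := by
          refine le_antisymm ?_ ?_
          · simpa using v.map_intCast_le_one' (b i ^ m - b j ^ m)
          · rw [← hZl.1]; simpa using v.map_intCast_mono (K := K) (hbb i j hj.symm)
        have := v.map_add_eq_of_lt_right (x := α - (b i : K) ^ m)
          (y := (b i : K) ^ m - (b j : K) ^ m) (by rw [h5]; exact h3)
        rw [← h5, ← this]; congr 1; ring
      have h6 := congrArg v hα
      rw [map_mul, map_pow, map_pow, hα1, one_pow, one_mul, map_prod,
        Finset.prod_eq_single i (fun j _ hj => hoth j hj) (by simp)] at h6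
      exact h6.symm
    · refine ⟨1, ?_⟩
      rw [one_pow]
      exact le_antisymm ((v.map_sub _ _).trans (max_le h1 (hvb1 i))) (not_lt.1 h3)

theorem Int.exists_prime_mul_gcd_dvd {m : ℕ} {e : ℤ} (he : ¬ (m : ℤ) ∣ e) :
    ∃ l : ℕ, l.Prime ∧ l * Int.gcd m e ∣ m := by
  obtain ⟨k, hk⟩ : Int.gcd m e ∣ m := Int.natCast_dvd_natCast.1 (Int.gcd_dvd_left (m : ℤ) e)
  have hk1 : k ≠ 1 := by
    rintro rfl
    apply he
    rw [mul_one] at hk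
    have : ((Int.gcd m e : ℕ) : ℤ) ∣ e := Int.gcd_dvd_right (m : ℤ) e
    rwa [← hk] at this
  obtain ⟨l, hl, k', rfl⟩ := Nat.exists_prime_and_dvd hk1
  exact ⟨l, hl, k', by nth_rewrite 1 [hk]; ring⟩

/-- In a finite cyclic group whose order is divisible by `m`, if `u ^ e` is an `m`-th power then
`u` is an `l`-th power whenever `l * gcd m e` divides `m`. -/
theorem IsCyclic.exists_eq_pow_of_zpow_eq_pow {G : Type*} [CommGroup G] [IsCyclic G]
    {m l : ℕ} (hmG : m ∣ Nat.card G) {e : ℤ} (hm : m ≠ 0) (hl : l * Int.gcd m e ∣ m) {u y : G}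
    (huy : u ^ e = y ^ m) : ∃ w, u = w ^ l := by
  set m' : ℕ := Int.gcd m e with hm'
  obtain ⟨k', hk⟩ := hl
  have hm'0 : m' ≠ 0 := by rintro h; rw [h, mul_zero, zero_mul] at hk; exact hm hk
  have hbez : (m' : ℤ) = m * Int.gcdA m e + e * Int.gcdB m e := Int.gcd_eq_gcd_ab _ _
  obtain ⟨z, hz⟩ : ∃ z : G, u ^ m' = z ^ m := by
    refine ⟨u ^ Int.gcdA m e * y ^ Int.gcdB m e, ?_⟩
    rw [← zpow_natCast u m', hbez, zpow_add, zpow_mul, zpow_mul, huy, mul_pow, zpow_natCast,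
      ← zpow_natCast y m, ← zpow_natCast (y ^ _) m, ← zpow_natCast (u ^ Int.gcdA _ _) m,
      ← zpow_natCast u m, zpow_comm u, zpow_comm y]
  obtain ⟨ζ, hζ⟩ := IsCyclic.exists_generator (α := G)
  obtain ⟨i, hi⟩ := Subgroup.mem_zpowers_iff.1 (hζ (u * (z ^ (l * k'))⁻¹))
  have h1 : (u * (z ^ (l * k'))⁻¹) ^ m' = 1 := by
    rw [mul_pow, hz, inv_pow, ← pow_mul, show l * k' * m' = m by rw [hk]; ring, mul_inv_cancel]
  rw [← hi, ← zpow_natCast, ← zpow_mul, ← orderOf_dvd_iff_zpow_eq_one,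
    orderOf_eq_card_of_forall_mem_zpowers hζ] at h1
  obtain ⟨j, rfl⟩ : (l : ℤ) ∣ i := by
    have h3 : ((l * m' * k' : ℕ) : ℤ) ∣ i * m' :=
      (Int.natCast_dvd_natCast.2 (hk ▸ hmG)).trans h1
    have h4 : ((l * m' : ℕ) : ℤ) ∣ i * m' :=
      (Int.natCast_dvd_natCast.2 (Dvd.intro _ rfl)).trans h3
    push_cast at h4
    exact Int.dvd_of_mul_dvd_mul_right (by exact_mod_cast hm'0) h4
  refine ⟨ζ ^ j * z ^ k', ?_⟩
  have h4 : u = ζ ^ ((l : ℤ) * j) * z ^ (l * k') := by rw [hi, inv_mul_cancel_right]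
  rw [h4, mul_pow, mul_comm (l : ℤ), zpow_mul, zpow_natCast, mul_comm l, pow_mul]

/-- Independence modulo `m`-th powers of the elements `(α - c_{k+2}) / (α - c₁)`, detected by
residues at auxiliary primes at which `α` reduces to `1`. -/
theorem dvd_of_prod_zpow_eq_pow {K : Type*} [Field K] {m T : ℕ} (hm : m ≠ 0) (α : K)
    (c : ℕ → ℤ) (g : Fin T → Kˣ)
    (hg : ∀ k, (g k : K) = (α - c (k + 2)) / (α - c 1))
    (hq : ∀ k : Fin T, ∀ l : ℕ, l.Prime → l ∣ m → ∃ q : ℕ, ∃ _ : Fact q.Prime, m ∣ q - 1 ∧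
      (∃ (φ : K →+* ℚ_[q]) (a : ℤ_[q]), φ α = a ∧ PadicInt.toZMod a = 1) ∧
      (∀ j ≤ T + 1, j ≠ 0 → (1 - c j : ZMod q) ≠ 0) ∧
      (∀ j : Fin T, j ≠ k → ∃ y : ZMod q, (1 - c (j + 2) : ZMod q) = y ^ m * (1 - c 1)) ∧
      ∀ y : ZMod q, (1 - c (k + 2) : ZMod q) ≠ y ^ l * (1 - c 1))
    (e : Fin T → ℤ) (β : Kˣ) (h : ∏ k, g k ^ e k = β ^ m) (k : Fin T) : (m : ℤ) ∣ e k := by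
  by_contra hcon
  obtain ⟨l, hl, hlm⟩ := Int.exists_prime_mul_gcd_dvd hcon
  obtain ⟨q, _, hmq, ⟨φ, a, hφ, ha⟩, hne, hpow, hnot⟩ := hq k l hl ((Dvd.intro _ rfl).trans hlm)
  have hunit : ∀ x : ℤ_[q], PadicInt.toZMod x ≠ 0 → IsUnit x := by
    intro x hx
    by_contra hnu
    apply hx
    rw [← RingHom.mem_ker, PadicInt.ker_toZMod]
    exact (IsLocalRing.mem_maximalIdeal x).2 hnu
  have hx : ∀ j, PadicInt.toZMod (a - (c j : ℤ_[q])) = (1 - c j : ZMod q) := by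
    intro j; rw [map_sub, ha, map_intCast]
  have hφx : ∀ j, φ (α - c j) = ((a - (c j : ℤ_[q]) : ℤ_[q]) : ℚ_[q]) := by
    intro j; rw [map_sub, hφ, map_intCast]; push_cast; rfl
  have hu : ∀ j ≤ T + 1, j ≠ 0 → IsUnit (a - (c j : ℤ_[q])) := fun j hj hj0 =>
    hunit _ (by rw [hx]; exact hne j hj hj0)
  have h1 := hu 1 (by omega) one_ne_zero
  have h2 : ∀ j : Fin T, IsUnit (a - (c (j + 2) : ℤ_[q])) := fun j =>
    hu (j + 2) (by omega) (by omega)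
  let γ : Fin T → ℤ_[q]ˣ := fun j => (h2 j).unit * h1.unit⁻¹
  let ι : ℤ_[q]ˣ →* ℚ_[q]ˣ := Units.map (PadicInt.Coe.ringHom : ℤ_[q] →+* ℚ_[q])
  have hι : Function.Injective ι := Units.map_injective Subtype.val_injective
  have hγ : ∀ j, ι (γ j) = Units.map (φ : K →* ℚ_[q]) (g j) := by
    intro j
    ext
    simp only [Units.coe_map, MonoidHom.coe_coe, hg, γ, map_mul, map_inv,
      Units.val_mul, Units.val_inv_eq_inv_val, ι]
    rw [map_div₀, hφx, hφx, div_eq_mul_inv]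
    rfl
  have hβ : ∃ b : ℤ_[q]ˣ, ι b = Units.map (φ : K →* ℚ_[q]) β := by
    have hnorm : ‖φ (β : K)‖ = 1 := by
      have h3 : φ (β : K) ^ m = (((∏ j, γ j ^ e j : ℤ_[q]ˣ) : ℤ_[q]) : ℚ_[q]) := by
        have h4 : ι (∏ j, γ j ^ e j) = Units.map (φ : K →* ℚ_[q]) (β ^ m) := by
          rw [← h, map_prod, map_prod]
          simp only [map_zpow, hγ]
        have := congrArg Units.val h4
        rw [map_pow, Units.val_pow_eq_pow_val] at this
        exact this.symm
      have h5 : ‖φ (β : K)‖ ^ m = 1 := by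
        rw [← norm_pow, h3]
        exact PadicInt.norm_units _
      exact (pow_eq_one_iff_of_nonneg (norm_nonneg _) hm).1 h5
    refine ⟨PadicInt.mkUnits hnorm, ?_⟩
    ext; rfl
  obtain ⟨b, hb⟩ := hβ
  have hmain : ∏ j, γ j ^ e j = b ^ m := by
    apply hι
    rw [map_pow, hb, ← map_pow, ← h, map_prod, map_prod]
    simp only [map_zpow, hγ]
  let r : ℤ_[q]ˣ →* (ZMod q)ˣ := Units.map (PadicInt.toZMod : ℤ_[q] →+* ZMod q)
  have hr : ∀ j, (r (γ j) : ZMod q) * (1 - c 1) = 1 - c (j + 2) := by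
    intro j
    rw [← hx, ← hx]
    change PadicInt.toZMod _ * _ = _
    rw [← map_mul]
    congr 1
    simp [γ, mul_assoc]
  have hc1 : (1 - c 1 : ZMod q) ≠ 0 := hne 1 (by omega) one_ne_zero
  have hoth : ∀ j, j ≠ k → ∃ y, r (γ j) = y ^ m := by
    intro j hj
    obtain ⟨y, hy⟩ := hpow j hj
    have h6 : (r (γ j) : ZMod q) = y ^ m := mul_right_cancel₀ hc1 ((hr j).trans hy)
    have hy0 : y ≠ 0 := by
      rintro rfl
      rw [zero_pow hm] at h6
      exact Units.ne_zero _ h6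
    exact ⟨Units.mk0 y hy0, by ext; simpa using h6⟩
  have hfin : ∃ y, r (γ k) ^ e k = y ^ m := by
    have h7 := congrArg r hmain
    rw [map_prod, ← Finset.mul_prod_erase _ _ (Finset.mem_univ k), map_zpow, map_pow] at h7
    obtain ⟨y, hy⟩ : ∃ y, ∏ j ∈ Finset.univ.erase k, r (γ j ^ e j) = y ^ m := by
      choose! y hy using hoth
      refine ⟨∏ j ∈ Finset.univ.erase k, y j ^ e j, ?_⟩
      rw [← Finset.prod_pow]
      refine Finset.prod_congr rfl fun j hj => ?_
      rw [map_zpow, hy j (Finset.ne_of_mem_erase hj), ← zpow_natCast, ← zpow_natCast, zpow_comm]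
    rw [hy] at h7
    exact ⟨r b * y⁻¹, by rw [mul_pow, inv_pow, ← h7, mul_inv_cancel_right]⟩
  obtain ⟨y, hy⟩ := hfin
  have hcard : m ∣ Nat.card (ZMod q)ˣ := by
    rw [Nat.card_eq_fintype_card, ZMod.card_units]; exact hmq
  obtain ⟨w, hw⟩ := IsCyclic.exists_eq_pow_of_zpow_eq_pow hcard hm hlm hy
  refine hnot w ?_
  rw [← hr k, hw]; simp

theorem ZMod.card_range_powMonoidHom {q m : ℕ} [Fact q.Prime] (hmq : m ∣ q - 1) :
    Nat.card (powMonoidHom m : (ZMod q)ˣ →* (ZMod q)ˣ).range * m = q - 1 := by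
  have := IsCyclic.card_powMonoidHom_range (G := (ZMod q)ˣ) m
  rw [this, Nat.card_eq_fintype_card, ZMod.card_units, Nat.gcd_eq_right hmq, Nat.div_mul_cancel hmq]

/-- Modulo a large prime `q ≡ 1 (mod m)`, there are `m`-th powers `u` such that the values `1 - u`
realize a prescribed pattern modulo powers. -/
theorem ZMod.exists_pow_family {q m l T : ℕ} [Fact q.Prime] (hm : 1 < m) (hmq : m ∣ q - 1)
    (hl : l.Prime) (hlm : l ∣ m) (hqm : m * (m + 1) < q) (hqT : m * (m * (T + 2) + 1) < q)
    (k : Fin T) :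
    ∃ b : ℕ → ZMod q, b 0 = 1 ∧ (∀ i, b i ≠ 0) ∧
      (∀ i ≤ T + 1, ∀ j ≤ T + 1, i ≠ j → b i ^ m ≠ b j ^ m) ∧
      (∀ j : Fin T, j ≠ k → ∃ y : ZMod q, 1 - b (j + 2) ^ m = y ^ m * (1 - b 1 ^ m)) ∧
      ∀ y : ZMod q, 1 - b (k + 2) ^ m ≠ y ^ l * (1 - b 1 ^ m) := by
  classical
  set H := (powMonoidHom m : (ZMod q)ˣ →* (ZMod q)ˣ).range with hH
  obtain ⟨h, hh⟩ : ∃ h, h = Nat.card H := ⟨_, rfl⟩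
  have hhm : h * m = q - 1 := by rw [hh]; exact ZMod.card_range_powMonoidHom hmq
  have hq1 : 1 < q := (Fact.out : q.Prime).one_lt
  have hGcard : Nat.card (ZMod q)ˣ = q - 1 := by
    rw [Nat.card_eq_fintype_card, ZMod.card_units]
  have hfer : ∀ x : ZMod q, x ≠ 0 → x ^ (q - 1) = 1 := fun x hx => ZMod.pow_card_sub_one_eq_one hx
  have hcardH : Fintype.card H = h := by rw [hh, Nat.card_eq_fintype_card]
  -- pigeonhole
  let s : Finset H := Finset.univ.erase 1
  have hs : s.card = h - 1 := by
    rw [Finset.card_erase_of_mem (Finset.mem_univ _), Finset.card_univ, hcardH]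
  have hsub : ∀ u ∈ s, (1 - ((u : (ZMod q)ˣ) : ZMod q)) ≠ 0 := by
    intro u hu h0
    apply (Finset.mem_erase.1 hu).1
    ext
    rw [sub_eq_zero] at h0
    simp [← h0]
  let t : Finset (ZMod q) := (Polynomial.nthRoots m (1 : ZMod q)).toFinset
  have ht : t.card ≤ m :=
    (Multiset.toFinset_card_le _).trans (Polynomial.card_nthRoots m _)
  have hmaps : ∀ u ∈ s, (1 - ((u : (ZMod q)ˣ) : ZMod q)) ^ h ∈ t := by
    intro u hu
    rw [Multiset.mem_toFinset, Polynomial.mem_nthRoots (by omega), ← pow_mul, hhm]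
    exact hfer _ (hsub u hu)
  have hlt : t.card * T < s.card := by
    rw [hs]
    have h1 : t.card * T ≤ m * T := Nat.mul_le_mul_right _ ht
    have h2 : m * T + m + 1 < h := by
      by_contra hcon
      push Not at hcon
      have : h * m ≤ (m * T + m + 1) * m := Nat.mul_le_mul_right _ hcon
      have h3 : m * (m * (T + 2) + 1) = (m * T + m + 1) * m + m * m := by ring
      have h4 : 1 ≤ m * m := Nat.one_le_iff_ne_zero.2 (by positivity)
      omega
    omega
  obtain ⟨r, -, hr⟩ := Finset.exists_lt_card_fiber_of_mul_lt_card_of_maps_to hmaps hlt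
  set F := s.filter (fun u : H => (1 - ((u : (ZMod q)ˣ) : ZMod q)) ^ h = r) with hF
  let f : Fin (T + 1) → H := fun i =>
    (F.equivFin.symm (Fin.castLE hr i) : H)
  have hf : Function.Injective f := by
    intro i j hij
    have := F.equivFin.symm.injective (Subtype.ext hij)
    exact Fin.castLE_injective _ this
  have hfs : ∀ i, f i ∈ s := fun i => (Finset.mem_filter.1 (F.equivFin.symm _).2).1
  have hfr : ∀ i, (1 - ((f i : (ZMod q)ˣ) : ZMod q)) ^ h = r :=
    fun i => (Finset.mem_filter.1 (F.equivFin.symm _).2).2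
  have hpow : ∀ i j, ∃ y : ZMod q, (1 - ((f i : (ZMod q)ˣ) : ZMod q)) =
      y ^ m * (1 - ((f j : (ZMod q)ˣ) : ZMod q)) := by
    intro i j
    let u : (ZMod q)ˣ := Units.mk0 _ (hsub _ (hfs i)) / Units.mk0 _ (hsub _ (hfs j))
    have hu : u ^ h = 1 := by
      rw [div_pow, div_eq_one]
      ext
      simp [hfr]
    have hgcd : Int.gcd ((q - 1 : ℕ) : ℤ) (h : ℤ) = h := by
      rw [Int.gcd_natCast_natCast]
      exact Nat.gcd_eq_right ⟨m, hhm.symm⟩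
    obtain ⟨w, hw⟩ := IsCyclic.exists_eq_pow_of_zpow_eq_pow (G := (ZMod q)ˣ) (m := q - 1) (l := m)
      (e := h) (u := u) (y := 1) (by rw [hGcard]) (by omega)
      (by rw [hgcd, ← hhm, mul_comm]) (by simpa using hu)
    refine ⟨w, ?_⟩
    have : ((u : (ZMod q)ˣ) : ZMod q) = (w : ZMod q) ^ m := by rw [hw]; simp
    rw [← this]
    simp only [u, Units.val_div_eq_div_val, Units.val_mk0]
    rw [div_mul_cancel₀ _ (hsub _ (hfs j))]
  -- an element with nontrivial class
  obtain ⟨hL, hhL⟩ : ∃ hL, l * hL = q - 1 := (hlm.trans hmq).imp fun _ h => h.symm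
  obtain ⟨w, hws, hw⟩ : ∃ w ∈ s, ∀ y : ZMod q, 1 - ((w : (ZMod q)ˣ) : ZMod q) ≠
      y ^ l * (1 - ((f 0 : (ZMod q)ˣ) : ZMod q)) := by
    by_contra hcon
    push Not at hcon
    set ω := (1 - ((f 0 : (ZMod q)ˣ) : ZMod q)) ^ hL with hω
    have hω0 : ω ≠ 0 := pow_ne_zero _ (hsub _ (hfs 0))
    have h1 : ∀ w ∈ s, (1 - ((w : (ZMod q)ˣ) : ZMod q)) ^ hL = ω := by
      intro w hw
      obtain ⟨y, hy⟩ := hcon w hw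
      have hy0 : y ≠ 0 := by
        rintro rfl
        rw [zero_pow hl.ne_zero, zero_mul] at hy
        exact hsub w hw hy
      rw [hy, mul_pow, ← pow_mul, hhL, hfer y hy0, one_mul]
    have h2 : ∀ a b : H, a ≠ b →
        (((a : (ZMod q)ˣ) : ZMod q) - ((b : (ZMod q)ˣ) : ZMod q)) ^ hL = ω := by
      intro a b hab
      have e1 : a⁻¹ * b ∈ s := Finset.mem_erase.2
        ⟨fun h => hab (by rw [inv_mul_eq_one] at h; exact h), Finset.mem_univ _⟩
      have e2 : (((a : (ZMod q)ˣ) : ZMod q)) ^ hL = 1 := by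
        obtain ⟨y, hy⟩ := a.2
        obtain ⟨m', rfl⟩ := hlm
        rw [← hy]
        simp only [powMonoidHom_apply, Units.val_pow_eq_pow_val]
        rw [← pow_mul, show l * m' * hL = (q - 1) * m' by rw [← hhL]; ring, pow_mul,
          hfer _ (Units.ne_zero y), one_pow]
      have e3 : (((a : (ZMod q)ˣ) : ZMod q) - ((b : (ZMod q)ˣ) : ZMod q)) =
          ((a : (ZMod q)ˣ) : ZMod q) * (1 - (((a⁻¹ * b : H) : (ZMod q)ˣ) : ZMod q)) := by
        rw [mul_sub, mul_one, ← Units.val_mul, ← Subgroup.coe_mul, mul_inv_cancel_left]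
      rw [e3, mul_pow, e2, h1 _ e1, one_mul]
    obtain ⟨γ, hγ⟩ := IsCyclic.exists_generator (α := (ZMod q)ˣ)
    have hγ1 : (γ : ZMod q) ^ hL ≠ 1 := by
      intro h
      have h' : γ ^ hL = 1 := by ext; simpa using h
      have hpos : 0 < hL := Nat.pos_of_ne_zero (by rintro rfl; omega)
      have := Nat.le_of_dvd hpos (orderOf_dvd_of_pow_eq_one h')
      rw [orderOf_eq_card_of_forall_mem_zpowers hγ, hGcard, ← hhL] at this
      have := hl.two_le
      nlinarith
    have hinj : Function.Injective (fun p : H × H =>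
        ((p.1 : (ZMod q)ˣ) : ZMod q) + γ * ((p.2 : (ZMod q)ˣ) : ZMod q)) := by
      rintro ⟨a, a'⟩ ⟨b, b'⟩ hab
      simp only at hab
      by_cases hab' : a' = b'
      · subst hab'
        have : a = b := by ext; exact add_right_cancel hab
        rw [this]
      · have e1 : ((a : (ZMod q)ˣ) : ZMod q) - ((b : (ZMod q)ˣ) : ZMod q) =
            γ * (((b' : (ZMod q)ˣ) : ZMod q) - ((a' : (ZMod q)ˣ) : ZMod q)) := by
          linear_combination hab
        have hne : a ≠ b := by
          rintro rfl
          rw [sub_self] at e1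
          rcases mul_eq_zero.1 e1.symm with h | h
          · exact Units.ne_zero γ h
          · exact hab' (by ext; exact (sub_eq_zero.1 h).symm)
        have e2 := congrArg (· ^ hL) e1
        simp only [mul_pow] at e2
        rw [h2 _ _ hne, h2 _ _ (Ne.symm hab')] at e2
        exact absurd (mul_right_cancel₀ hω0 ((one_mul ω).trans e2)).symm hγ1
    have := Fintype.card_le_of_injective _ hinj
    rw [Fintype.card_prod, hcardH, ZMod.card] at this
    have hmh : m < h := by
      by_contra hc
      push Not at hc
      have : h * m ≤ m * m := Nat.mul_le_mul_right _ hc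
      have : m * (m + 1) = m * m + m := by ring
      omega
    have : q = h * m + 1 := by omega
    nlinarith
  -- assemble
  have hroot : ∀ u : H, ∃ y : (ZMod q)ˣ, (y : ZMod q) ^ m = ((u : (ZMod q)ˣ) : ZMod q) := by
    intro u
    obtain ⟨y, hy⟩ := u.2
    exact ⟨y, by rw [← hy]; simp⟩
  choose ψ hψ using hroot
  let U : ℕ → H := fun i => if i = k + 2 then w else f (Fin.ofNat _ (i - 1))
  have hU2 : U (k + 2) = w := by simp [U]
  have hU1 : ∀ i : ℕ, i ≠ k + 2 → U i = f (Fin.ofNat _ (i - 1)) := fun i hi => by simp [U, hi]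
  have hUs : ∀ i, U i ∈ s := by
    intro i
    by_cases hi : i = k + 2
    · rw [hi, hU2]; exact hws
    · rw [hU1 i hi]; exact hfs _
  have hU11 : U 1 = f 0 := by rw [hU1 1 (by omega)]; rfl
  have hwf : ∀ i, w ≠ f i := by
    intro i h
    obtain ⟨m', hm'⟩ := hlm
    obtain ⟨y, hy⟩ := hpow i 0
    apply hw (y ^ m')
    rw [h, hy, ← pow_mul, hm', mul_comm l]
  have hUinj : ∀ i ≤ T + 1, ∀ j ≤ T + 1, i ≠ 0 → j ≠ 0 → U i = U j → i = j := by
    intro i hi j hj hi0 hj0 hij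
    by_cases hik : i = k + 2
    · by_cases hjk : j = k + 2
      · rw [hik, hjk]
      · rw [hik, hU2, hU1 j hjk] at hij
        exact absurd hij (hwf _)
    · by_cases hjk : j = k + 2
      · rw [hjk, hU2, hU1 i hik] at hij
        exact absurd hij.symm (hwf _)
      · rw [hU1 i hik, hU1 j hjk] at hij
        have := congrArg Fin.val (hf hij)
        simp only [Fin.val_ofNat] at this
        rw [Nat.mod_eq_of_lt (by omega), Nat.mod_eq_of_lt (by omega)] at this
        omega
  refine ⟨fun i => if i = 0 then 1 else ψ (U i), by simp, ?_, ?_, ?_, ?_⟩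
  · intro i
    by_cases hi : i = 0 <;> simp [hi]
  · have key : ∀ j, (1 : ZMod q) ≠ ψ (U j) ^ m := by
      intro j h
      rw [hψ] at h
      exact hsub _ (hUs j) (by rw [← h, sub_self])
    intro i hi j hj hij
    by_cases hi0 : i = 0
    · have hj0 : j ≠ 0 := by omega
      simpa [hi0, hj0] using key j
    · by_cases hj0 : j = 0
      · simpa [hi0, hj0] using (key i).symm
      · simp only [hi0, hj0, if_false, hψ]
        intro h
        exact hij (hUinj i hi j hj hi0 hj0 (by ext; exact h))
  · intro j hj
    have hj' : (j : ℕ) + 2 ≠ k + 2 := fun h => hj (Fin.ext (by omega))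
    simp only [Nat.add_eq_zero_iff, OfNat.ofNat_ne_zero, and_false, if_false, one_ne_zero, hψ,
      hU11, hU1 _ hj']
    exact hpow _ _
  · simp only [Nat.add_eq_zero_iff, OfNat.ofNat_ne_zero, and_false, if_false, one_ne_zero, hψ,
      hU11, hU2]
    exact hw

/-- Integers `b i` and a modulus `Q` whose prime factors detect the classes of the differences
`1 - b i ^ m` modulo powers. -/
theorem exists_pow_family_of_modulus {m T : ℕ} (hm : 1 < m) (hT : 0 < T) :
    ∃ (b : ℕ → ℕ) (Q : ℕ), 1 < Q ∧ b 0 = 1 ∧ (∀ i, 0 < b i) ∧ Nat.Coprime Q m ∧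
      (∀ i, Nat.Coprime Q (b i)) ∧
      (∀ i ≤ T + 1, ∀ j ≤ T + 1, i ≠ j → IsCoprime (Q : ℤ) ((b i : ℤ) ^ m - (b j : ℤ) ^ m)) ∧
      (∀ i ≤ T + 1, ∀ j ≤ T + 1, i ≠ j → b i ^ m ≠ b j ^ m) ∧
      ∀ k : Fin T, ∀ l : ℕ, l.Prime → l ∣ m → ∃ q : ℕ, q ∣ Q ∧ q.Prime ∧ m ∣ q - 1 ∧
        (∀ j : Fin T, j ≠ k → ∃ y : ZMod q,
          (1 - (b (j + 2) : ZMod q) ^ m) = y ^ m * (1 - (b 1 : ZMod q) ^ m)) ∧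
        ∀ y : ZMod q, (1 - (b (k + 2) : ZMod q) ^ m) ≠ y ^ l * (1 - (b 1 : ZMod q) ^ m) := by
  classical
  let ι := Fin T × m.primeFactors
  have hinf : {p : ℕ | p.Prime ∧ p ≡ 1 [MOD m] ∧
      m * (m + 1) + m * (m * (T + 2) + 1) < p}.Infinite := by
    apply Set.infinite_of_forall_exists_gt
    intro a
    obtain ⟨p, hp, h1, h2⟩ := Nat.exists_prime_gt_modEq_one (k := m)
      (a + (m * (m + 1) + m * (m * (T + 2) + 1))) (by omega)
    exact ⟨p, ⟨hp, h2, by omega⟩, by omega⟩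
  let e : ι → ℕ := fun x => (hinf.natEmbedding _ (Fintype.equivFin ι x) : ℕ)
  have he : Function.Injective e := by
    intro x y hxy
    exact (Fintype.equivFin ι).injective
      (Fin.ext ((hinf.natEmbedding _).injective (Subtype.ext hxy)))
  have hp : ∀ x, (e x).Prime := fun x => (hinf.natEmbedding _ (Fintype.equivFin ι x)).2.1
  have hmod : ∀ x, m ∣ e x - 1 := fun x =>
    (Nat.modEq_iff_dvd' (hp x).one_le).1 (hinf.natEmbedding _ (Fintype.equivFin ι x)).2.2.1.symm
  have hlarge : ∀ x, m * (m + 1) + m * (m * (T + 2) + 1) < e x :=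
    fun x => (hinf.natEmbedding _ (Fintype.equivFin ι x)).2.2.2
  have hfam : ∀ x : ι, ∃ b : ℕ → ZMod (e x), b 0 = 1 ∧ (∀ i, b i ≠ 0) ∧
      (∀ i ≤ T + 1, ∀ j ≤ T + 1, i ≠ j → b i ^ m ≠ b j ^ m) ∧
      (∀ j : Fin T, j ≠ x.1 → ∃ y : ZMod (e x), 1 - b (j + 2) ^ m = y ^ m * (1 - b 1 ^ m)) ∧
      ∀ y : ZMod (e x), 1 - b (x.1 + 2) ^ m ≠ y ^ (x.2 : ℕ) * (1 - b 1 ^ m) := by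
    intro x
    have : Fact (e x).Prime := ⟨hp x⟩
    have h := hlarge x
    exact ZMod.exists_pow_family hm (hmod x) (Nat.prime_of_mem_primeFactors x.2.2)
      (Nat.dvd_of_mem_primeFactors x.2.2) (by omega) (by omega) _
  choose B hB0 hB1 hB2 hB3 hB4 using hfam
  have hcop : Pairwise fun x y => Nat.Coprime (e x) (e y) := fun x y hxy =>
    (Nat.coprime_primes (hp x) (hp y)).2 (fun h => hxy (he h))
  have hcrt : ∀ i : ℕ, ∃ n : ℕ, (i = 0 → n = 1) ∧ ∀ x, (n : ZMod (e x)) = B x i := by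
    intro i
    by_cases hi : i = 0
    · exact ⟨1, fun _ => rfl, fun x => by rw [hi, hB0, Nat.cast_one]⟩
    · obtain ⟨n, hn⟩ := Nat.chineseRemainderOfFinset (fun x => (B x i).val) e Finset.univ
        (fun x _ => (hp x).ne_zero) (fun x _ y _ hxy => hcop hxy)
      refine ⟨n, fun h => absurd h hi, fun x => ?_⟩
      have : NeZero (e x) := ⟨(hp x).ne_zero⟩
      have h1 := (ZMod.natCast_eq_natCast_iff _ _ _).2 (hn x (Finset.mem_univ _))
      rw [h1, ZMod.natCast_zmod_val]
  choose b hb0 hb using hcrt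
  obtain ⟨l₀, hl₀, hl₀m⟩ := Nat.exists_prime_and_dvd (show m ≠ 1 by omega)
  let x₀ : ι := (⟨0, hT⟩, ⟨l₀, Nat.mem_primeFactors.2 ⟨hl₀, hl₀m, by omega⟩⟩)
  set Q := ∏ x, e x with hQ
  have hdvd : ∀ x, e x ∣ Q := fun x => Finset.dvd_prod_of_mem _ (Finset.mem_univ _)
  have hQ0 : 0 < Q := Finset.prod_pos fun x _ => (hp x).pos
  have hbQ : ∀ i, Nat.Coprime Q (b i) := by
    intro i
    refine Nat.Coprime.prod_left fun x _ => ?_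
    rw [(hp x).coprime_iff_not_dvd, ← ZMod.natCast_eq_zero_iff, hb]
    exact hB1 _ _
  have hQ1 : 1 < Q := (hp x₀).one_lt.trans_le (Nat.le_of_dvd hQ0 (hdvd x₀))
  have hne : ∀ i ≤ T + 1, ∀ j ≤ T + 1, i ≠ j →
      IsCoprime (Q : ℤ) ((b i : ℤ) ^ m - (b j : ℤ) ^ m) := by
    intro i hi j hj hij
    rw [hQ, Nat.cast_prod]
    refine IsCoprime.prod_left fun x _ => ?_
    rw [(Nat.prime_iff_prime_int.1 (hp x)).irreducible.coprime_iff_not_dvd,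
      ← ZMod.intCast_zmod_eq_zero_iff_dvd]
    push_cast
    rw [hb, hb]
    exact sub_ne_zero.2 (hB2 x i hi j hj hij)
  refine ⟨b, Q, hQ1, hb0 0 rfl, ?_, ?_, hbQ, hne, ?_, ?_⟩
  · intro i
    refine Nat.pos_of_ne_zero fun h => ?_
    have := hbQ i
    rw [h, Nat.coprime_zero_right] at this
    omega
  · refine Nat.Coprime.prod_left fun x _ => ?_
    rw [(hp x).coprime_iff_not_dvd]
    intro h
    have := Nat.le_of_dvd (by omega) h
    have := hlarge x
    have : m ≤ m * (m + 1) := Nat.le_mul_of_pos_right _ (by omega)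
    omega
  · intro i hi j hj hij h
    have := hne i hi j hj hij
    rw [← Nat.cast_pow, ← Nat.cast_pow, h, sub_self, isCoprime_zero_right,
      Int.isUnit_iff] at this
    omega
  · intro k l hl hlm
    let x : ι := (k, ⟨l, Nat.mem_primeFactors.2 ⟨hl, hlm, by omega⟩⟩)
    refine ⟨e x, hdvd x, hp x, hmod x, ?_, ?_⟩
    · simp only [hb]
      exact hB3 x
    · simp only [hb]
      exact hB4 x

open Polynomial in
/-- Approximate `m`-th root of a monic polynomial of degree `m * g + ρ`. -/
theorem Polynomial.exists_monic_approx_root {A : Type*} [CommRing A] [Nontrivial A] {m g ρ : ℕ}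
    (hmA : IsUnit (m : A)) (h : A[X]) (hh : h.Monic) (hdeg : h.natDegree = m * g + ρ) :
    ∃ r : A[X], r.Monic ∧ r.natDegree = g ∧
      (X ^ ρ * r ^ m - h).degree < ((ρ + (m - 1) * g : ℕ) : WithBot ℕ) := by
  obtain ⟨u, hu⟩ := hmA
  have hm0 : m ≠ 0 := by
    rintro rfl
    rw [Nat.cast_zero] at hu
    exact u.ne_zero hu
  have key : ∀ j ≤ g, ∃ r : A[X], r.Monic ∧ r.natDegree = g ∧
      (X ^ ρ * r ^ m - h).degree < ((ρ + (m - 1) * g + (g - j) : ℕ) : WithBot ℕ) := by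
    intro j
    induction j with
    | zero =>
      intro _
      refine ⟨X ^ g, monic_X_pow g, natDegree_X_pow g, ?_⟩
      have hmon : (X ^ ρ * (X ^ g) ^ m : A[X]).Monic := by
        rw [← pow_mul, ← pow_add]; exact monic_X_pow _
      have hd : ρ + (m - 1) * g + (g - 0) = m * g + ρ := by
        obtain ⟨k, rfl⟩ := Nat.exists_eq_succ_of_ne_zero hm0
        simp only [Nat.succ_eq_add_one, Nat.add_sub_cancel, Nat.sub_zero]; ring
      have h1 : (X ^ ρ * (X ^ g) ^ m : A[X]).natDegree = m * g + ρ := by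
        rw [← pow_mul, ← pow_add, natDegree_X_pow]; ring
      have h2 : (X ^ ρ * (X ^ g) ^ m : A[X]).degree = h.degree := by
        rw [degree_eq_natDegree hmon.ne_zero, degree_eq_natDegree hh.ne_zero, h1, hdeg]
      have := degree_sub_lt_left h2 hmon.ne_zero (by rw [hmon.leadingCoeff, hh.leadingCoeff])
      rwa [degree_eq_natDegree hmon.ne_zero, h1, ← hd] at this
    | succ j ih =>
      intro hj
      obtain ⟨r, hr, hrg, hrd⟩ := ih (by omega)
      obtain ⟨e, he⟩ : ∃ e, g - j = e + 1 := ⟨g - j - 1, by omega⟩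
      have he' : g - (j + 1) = e := by omega
      rw [he] at hrd
      rw [he']
      set N := ρ + (m - 1) * g + e with hN
      set a := (X ^ ρ * r ^ m - h).coeff N with ha
      set c : A := -(↑u⁻¹ * a) with hc
      set s : A[X] := C c * X ^ e with hs
      have hsdeg : s.degree < (g : WithBot ℕ) :=
        (degree_C_mul_X_pow_le e c).trans_lt (by exact_mod_cast (by omega : e < g))
      have hrdeg : r.degree = g := by rw [degree_eq_natDegree hr.ne_zero, hrg]
      have hrs : (r + s).Monic := hr.add_of_left (by rw [hrdeg]; exact hsdeg)
      have hrsg : (r + s).natDegree = g := by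
        rw [natDegree_add_eq_left_of_degree_lt (by rw [hrdeg]; exact hsdeg), hrg]
      refine ⟨r + s, hrs, hrsg, ?_⟩
      have hexp : (r + s) ^ m = r ^ m + (m : A[X]) * r ^ (m - 1) * s +
          ∑ k ∈ Finset.range (m - 1), r ^ k * s ^ (m - k) * (m.choose k : A[X]) := by
        obtain ⟨m', rfl⟩ := Nat.exists_eq_succ_of_ne_zero hm0
        rw [add_pow, Finset.sum_range_succ, Finset.sum_range_succ]
        simp only [Nat.succ_eq_add_one, Nat.add_sub_cancel, Nat.sub_self, pow_zero, mul_one,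
          Nat.choose_self, Nat.cast_one, Nat.choose_succ_self_right,
          show m' + 1 - m' = 1 by omega, pow_one]
        push_cast
        ring
      have hsmall : ∀ k ∈ Finset.range (m - 1),
          (X ^ ρ * (r ^ k * s ^ (m - k) * (m.choose k : A[X]))).natDegree < N ∨
            X ^ ρ * (r ^ k * s ^ (m - k) * (m.choose k : A[X])) = 0 := by
        intro k hk
        left
        rw [Finset.mem_range] at hk
        have b1 : (r ^ k).natDegree ≤ k * g := by
          rw [← hrg]; exact natDegree_pow_le
        have b2 : (s ^ (m - k)).natDegree ≤ (m - k) * e :=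
          natDegree_pow_le.trans (Nat.mul_le_mul_left _ (natDegree_C_mul_X_pow_le _ _))
        have b3 : (X ^ ρ * (r ^ k * s ^ (m - k) * (m.choose k : A[X]))).natDegree ≤
            ρ + (k * g + (m - k) * e) := by
          refine natDegree_mul_le.trans (add_le_add (natDegree_X_pow_le _) ?_)
          refine natDegree_mul_le.trans ?_
          rw [natDegree_natCast, add_zero]
          exact natDegree_mul_le.trans (add_le_add b1 b2)
        refine b3.trans_lt ?_
        obtain ⟨i, hi⟩ : ∃ i, m = k + (i + 2) := ⟨m - k - 2, by omega⟩
        have heg : e + 1 ≤ g := by omega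
        rw [hN]
        have e1 : m - 1 = k + i + 1 := by omega
        have e2 : m - k = i + 2 := by omega
        rw [e1, e2]
        nlinarith [Nat.mul_le_mul_left (i + 1) heg]
      have hsum : (X ^ ρ * ∑ k ∈ Finset.range (m - 1),
          r ^ k * s ^ (m - k) * (m.choose k : A[X])).degree < (N : WithBot ℕ) := by
        rw [Finset.mul_sum]
        refine (degree_sum_le _ _).trans_lt ?_
        rw [Finset.sup_lt_iff (WithBot.bot_lt_coe _)]
        intro k hk
        rcases hsmall k hk with h1 | h1
        · exact (degree_le_natDegree).trans_lt (by exact_mod_cast h1)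
        · rw [h1, degree_zero]; exact WithBot.bot_lt_coe _
      have hmain : X ^ ρ * ((m : A[X]) * r ^ (m - 1) * s) =
          C ((m : A) * c) * (X ^ (ρ + e) * r ^ (m - 1)) := by
        rw [hs, C_mul, pow_add, map_natCast]; ring
      have hmon2 : (X ^ (ρ + e) * r ^ (m - 1)).Monic := (monic_X_pow _).mul (hr.pow _)
      have hmon2d : (X ^ (ρ + e) * r ^ (m - 1)).natDegree = N := by
        rw [(monic_X_pow _).natDegree_mul (hr.pow _), natDegree_X_pow, hr.natDegree_pow, hrg, hN]
        ring
      have hfirst : (X ^ ρ * r ^ m - h + X ^ ρ * ((m : A[X]) * r ^ (m - 1) * s)).degree <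
          (N : WithBot ℕ) := by
        rw [degree_lt_iff_coeff_zero]
        intro M hM
        rw [coeff_add, hmain, coeff_C_mul]
        rcases hM.eq_or_lt with rfl | hM
        · have : (X ^ (ρ + e) * r ^ (m - 1)).coeff N = 1 := by
            rw [← hmon2d]; exact hmon2
          rw [this, ← ha, hc, ← hu, mul_one, mul_neg, Units.mul_inv_cancel_left, add_neg_cancel]
        · rw [coeff_eq_zero_of_degree_lt (hrd.trans_le (by exact_mod_cast (by omega))),
            coeff_eq_zero_of_natDegree_lt (by rw [hmon2d]; exact hM), mul_zero, add_zero]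
      have : X ^ ρ * (r + s) ^ m - h = (X ^ ρ * r ^ m - h + X ^ ρ * ((m : A[X]) * r ^ (m - 1) * s)) +
          X ^ ρ * ∑ k ∈ Finset.range (m - 1), r ^ k * s ^ (m - k) * (m.choose k : A[X]) := by
        rw [hexp]; ring
      rw [this]
      exact (degree_add_le _ _).trans_lt (max_lt hfirst hsum)
  simpa using key g le_rfl

open Polynomial in
/-- Integral form of the approximate root: denominators are powers of `m`. -/
theorem Polynomial.exists_int_approx_root {m g ρ : ℕ} (hm : m ≠ 0) (h : ℤ[X]) (hh : h.Monic)
    (hdeg : h.natDegree = m * g + ρ) :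
    ∃ (k : ℕ) (r : ℤ[X]), r.natDegree = g ∧ r.leadingCoeff = (m : ℤ) ^ k ∧
      (X ^ ρ * r ^ m - C (((m : ℤ) ^ k) ^ m) * h).degree < ((ρ + (m - 1) * g : ℕ) : WithBot ℕ) := by
  have hm' : (m : ℤ) ≠ 0 := by exact_mod_cast hm
  let A := Localization.Away (m : ℤ)
  have hinj : Function.Injective (algebraMap ℤ A) :=
    IsLocalization.injective A (powers_le_nonZeroDivisors_of_noZeroDivisors hm')
  have hnt : Nontrivial A := hinj.nontrivial
  have hu : IsUnit ((m : ℕ) : A) := by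
    have := IsLocalization.Away.algebraMap_isUnit (S := A) (m : ℤ)
    simpa using this
  obtain ⟨r, hr, hrg, hrd⟩ := exists_monic_approx_root (g := g) (ρ := ρ) hu
    (h.map (algebraMap ℤ A)) (hh.map _) (by rw [hh.natDegree_map, hdeg])
  obtain ⟨b, ⟨k, hk⟩, hb⟩ :=
    IsLocalization.integerNormalization_spec (Submonoid.powers (m : ℤ)) r
  set r₁ := IsLocalization.integerNormalization (Submonoid.powers (m : ℤ)) r with hr₁
  have hmap : r₁.map (algebraMap ℤ A) = C (algebraMap ℤ A ((m : ℤ) ^ k)) * r := by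
    rw [hb, show (m : ℤ) ^ k = b from hk]
    ext i
    rw [coeff_C_mul, ← Algebra.smul_def]
    rfl
  have hE : algebraMap ℤ A ((m : ℤ) ^ k) ≠ 0 := by
    rw [Ne, map_eq_zero_iff _ hinj]
    exact pow_ne_zero _ hm'
  have hd1 : r₁.natDegree = g := by
    rw [← natDegree_map_eq_of_injective hinj, hmap,
      natDegree_C_mul_of_mul_ne_zero (by rwa [hr.leadingCoeff, mul_one]), hrg]
  refine ⟨k, r₁, hd1, ?_, ?_⟩
  · apply hinj
    rw [leadingCoeff, ← coeff_map, hmap, hd1, coeff_C_mul, ← hrg, hr.coeff_natDegree, mul_one]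
  · rw [← degree_map_eq_of_injective hinj]
    have : (X ^ ρ * r₁ ^ m - C (((m : ℤ) ^ k) ^ m) * h).map (algebraMap ℤ A) =
        C ((algebraMap ℤ A ((m : ℤ) ^ k)) ^ m) * (X ^ ρ * r ^ m - h.map (algebraMap ℤ A)) := by
      simp only [Polynomial.map_sub, Polynomial.map_mul, Polynomial.map_pow, map_X, hmap, map_C,
        map_pow]
      ring
    rw [this]
    refine lt_of_le_of_lt ?_ hrd
    rw [← smul_eq_C_mul]
    exact degree_smul_le _ _

open Polynomial IntermediateField in
/-- A number field generated by a root of `F` embeds into `ℚ_q` when `1` is a simple root of `F`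
modulo `q`. -/
theorem exists_ringHom_padic {K : Type*} [Field K] [CharZero K] {q : ℕ} [Fact q.Prime]
    (F : ℤ[X]) (hF : Irreducible (F.map (Int.castRingHom ℚ))) (α : K) (hα : aeval α F = 0)
    (hgen : ℚ⟮α⟯ = ⊤) (h1 : (q : ℤ) ∣ F.eval 1) (h2 : ¬ (q : ℤ) ∣ F.derivative.eval 1) :
    ∃ (φ : K →+* ℚ_[q]) (a : ℤ_[q]), φ α = a ∧ PadicInt.toZMod a = 1 := by
  have hev : ∀ P : ℤ[X], aeval (1 : ℤ_[q]) P = ((P.eval 1 : ℤ) : ℤ_[q]) := by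
    intro P
    have := aeval_algebraMap_apply_eq_algebraMap_eval (A := ℤ_[q]) (1 : ℤ) P
    simpa using this
  have hn1 : ‖aeval (1 : ℤ_[q]) F‖ < 1 := by
    rw [hev]; exact (PadicInt.norm_int_lt_one_iff_dvd _).2 h1
  have hn2 : ‖aeval (1 : ℤ_[q]) F.derivative‖ = 1 := by
    rw [hev]
    refine le_antisymm (PadicInt.norm_le_one _) (not_lt.1 fun h => h2 ?_)
    exact (PadicInt.norm_int_lt_one_iff_dvd _).1 h
  obtain ⟨z, hz, hz1, -, -⟩ := hensels_lemma (F := F) (a := (1 : ℤ_[q]))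
    (by rw [hn2]; simpa using hn1)
  rw [hn2] at hz1
  have hlc : aeval α (F.map (Int.castRingHom ℚ)) = 0 := by
    rw [show Int.castRingHom ℚ = algebraMap ℤ ℚ from rfl, aeval_map_algebraMap]; exact hα
  have hmin := minpoly.eq_of_irreducible hF hlc
  have hint : IsIntegral ℚ α := by
    have : IsAlgebraic ℚ α := ⟨_, hF.ne_zero, hlc⟩
    exact this.isIntegral
  have hzq : aeval (z : ℚ_[q]) (minpoly ℚ α) = 0 := by
    rw [← hmin, map_mul, show Int.castRingHom ℚ = algebraMap ℤ ℚ from rfl, aeval_map_algebraMap]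
    have : aeval (z : ℚ_[q]) F = ((aeval z F : ℤ_[q]) : ℚ_[q]) := by
      have := aeval_algebraMap_apply (ℚ_[q]) z F
      exact this
    rw [this, hz]
    simp
  let pb := adjoin.powerBasis hint
  have hpb : pb.gen = AdjoinSimple.gen ℚ α := adjoin.powerBasis_gen hint
  let φ₀ : ℚ⟮α⟯ →ₐ[ℚ] ℚ_[q] := pb.lift (z : ℚ_[q]) (by
    rw [hpb, IntermediateField.minpoly_gen]; exact hzq)
  let ψ : K →ₐ[ℚ] ℚ⟮α⟯ :=
    ((IntermediateField.topEquiv (F := ℚ) (E := K)).symm.trans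
      (IntermediateField.equivOfEq hgen.symm)).toAlgHom
  refine ⟨(φ₀.comp ψ).toRingHom, z, ?_, ?_⟩
  · have hψ : ψ α = AdjoinSimple.gen ℚ α := by
      ext
      simp [ψ, IntermediateField.topEquiv]
      rfl
    have : φ₀ (AdjoinSimple.gen ℚ α) = (z : ℚ_[q]) := by
      rw [← hpb]; exact pb.lift_gen _ _
    change φ₀ (ψ α) = _
    rw [hψ, this]
  · have : z - 1 ∈ RingHom.ker (PadicInt.toZMod (p := q)) := by
      rw [PadicInt.ker_toZMod]
      exact (IsLocalRing.mem_maximalIdeal _).2 (by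
        rw [PadicInt.mem_nonunits]; exact hz1)
    rw [RingHom.mem_ker, map_sub, map_one, sub_eq_zero] at this
    exact this

open Polynomial in
/-- Dividing a polynomial with integral coefficients by a linear factor keeps the coefficients
integral. -/
theorem Polynomial.exists_map_eq_X_sub_C_mul {R K : Type*} [CommRing R] [CommRing K] [Algebra R K]
    [IsIntegrallyClosedIn R K] (P : R[X]) (α : K) (hα : aeval α P = 0) :
    ∃ G : R[X], P.map (algebraMap R K) = (X - C α) * G.map (algebraMap R K) := by
  induction hn : P.natDegree using Nat.strong_induction_on generalizing P with
  | _ n ih =>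
    rcases Nat.eq_zero_or_pos n with rfl | hpos
    · rw [natDegree_eq_zero] at hn
      obtain ⟨a, rfl⟩ := hn
      rw [aeval_C] at hα
      exact ⟨0, by simp [hα]⟩
    · obtain ⟨N, rfl⟩ : ∃ N, n = N + 1 := ⟨n - 1, by omega⟩
      have hint : IsIntegral R (P.leadingCoeff • α) := isIntegral_leadingCoeff_smul P α hα
      obtain ⟨b, hb⟩ := (IsIntegrallyClosedIn.isIntegral_iff (R := R)).1 hint
      set P' : R[X] := P - (C P.leadingCoeff * X ^ (N + 1) - C b * X ^ N) with hP'
      have hP'α : aeval α P' = 0 := by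
        rw [hP', map_sub, map_sub, hα]
        simp only [map_mul, aeval_C, map_pow, aeval_X, hb, Algebra.smul_def]
        ring
      have hdeg : P'.natDegree < N + 1 := by
        rw [Nat.lt_succ_iff, natDegree_le_iff_coeff_eq_zero]
        intro i hi
        rw [hP', coeff_sub, coeff_sub, coeff_C_mul, coeff_C_mul, coeff_X_pow, coeff_X_pow,
          if_neg (show i ≠ N by omega)]
        by_cases h : i = N + 1
        · rw [if_pos h, leadingCoeff, hn, h]; ring
        · rw [if_neg h, coeff_eq_zero_of_natDegree_lt (by omega)]; ring
      obtain ⟨G, hG⟩ := ih _ hdeg P' hP'α rfl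
      refine ⟨C P.leadingCoeff * X ^ N + G, ?_⟩
      have h1 : P = P' + (C P.leadingCoeff * X ^ (N + 1) - C b * X ^ N) := by rw [hP']; ring
      conv_lhs => rw [h1]
      rw [Polynomial.map_add, hG]
      simp only [Polynomial.map_sub, Polynomial.map_mul, Polynomial.map_pow, map_X, map_C,
        Polynomial.map_add, hb, Algebra.smul_def, C_mul]
      ring

open Polynomial in
theorem Polynomial.exists_algebraMap_eq_sum_Ioc {R K : Type*} [CommRing R] [CommRing K]
    [Algebra R K] [IsIntegrallyClosedIn R K] (P : R[X]) (α : K) (hα : aeval α P = 0) {n : ℕ}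
    (hn : P.natDegree ≤ n) {j : ℕ} (hj : j ≠ 0) :
    ∃ y : R, algebraMap R K y = ∑ i ∈ Finset.Ioc j n, algebraMap R K (P.coeff i) * α ^ (i - j) := by
  obtain ⟨G, hG⟩ := exists_map_eq_X_sub_C_mul P α hα
  have hrec : ∀ i, algebraMap R K (P.coeff (i + 1)) =
      algebraMap R K (G.coeff i) - α * algebraMap R K (G.coeff (i + 1)) := by
    intro i
    rw [← coeff_map, hG, sub_mul, coeff_sub, coeff_X_mul, coeff_C_mul, coeff_map, coeff_map]
  set N := max n G.natDegree + 1 with hN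
  have key : ∀ t j, N ≤ j + t → α * algebraMap R K (G.coeff j) =
      ∑ i ∈ Finset.Ioc j N, algebraMap R K (P.coeff i) * α ^ (i - j) := by
    intro t
    induction t with
    | zero =>
      intro j hj
      rw [Finset.Ioc_eq_empty (by omega), Finset.sum_empty,
        coeff_eq_zero_of_natDegree_lt (by omega), map_zero, mul_zero]
    | succ t ih =>
      intro j hj
      by_cases hjN : N ≤ j + t
      · exact ih j hjN
      · have h1 := ih (j + 1) (by omega)
        have h2 := hrec j
        have h3 : Finset.Ioc j N = insert (j + 1) (Finset.Ioc (j + 1) N) := by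
          ext i
          simp only [Finset.mem_Ioc, Finset.mem_insert]
          omega
        have h4 : ∑ i ∈ Finset.Ioc (j + 1) N, algebraMap R K (P.coeff i) * α ^ (i - j) =
            α * (α * algebraMap R K (G.coeff (j + 1))) := by
          rw [h1, Finset.mul_sum]
          refine Finset.sum_congr rfl fun i hi => ?_
          rw [Finset.mem_Ioc] at hi
          rw [show i - j = i - (j + 1) + 1 by omega, pow_succ]
          ring
        rw [h3, Finset.sum_insert (by simp), h4, h2, show j + 1 - j = 1 by omega]
        ring
  obtain ⟨j', rfl⟩ := Nat.exists_eq_succ_of_ne_zero hj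
  refine ⟨G.coeff j' - P.coeff (j' + 1), ?_⟩
  have h1 := key N (j' + 1) (by omega)
  have h2 : ∑ i ∈ Finset.Ioc (j' + 1) n, algebraMap R K (P.coeff i) * α ^ (i - (j' + 1)) =
      ∑ i ∈ Finset.Ioc (j' + 1) N, algebraMap R K (P.coeff i) * α ^ (i - (j' + 1)) := by
    refine Finset.sum_subset (Finset.Ioc_subset_Ioc_right (by omega)) fun i hi hi' => ?_
    rw [Finset.mem_Ioc] at hi hi'
    rw [coeff_eq_zero_of_natDegree_lt (by omega), map_zero, zero_mul]
  rw [Nat.succ_eq_add_one, h2, ← h1, map_sub, hrec]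
  ring

open Polynomial in
/-- Leading coefficient times a product of some of the roots is integral. -/
theorem Polynomial.exists_algebraMap_eq_mul_prod {R K : Type*} [CommRing R] [CommRing K]
    [IsDomain K] [Algebra R K] [IsIntegrallyClosedIn R K] (s t : Multiset K) (P : R[X]) (a : K)
    (hP : P.map (algebraMap R K) = C a * ((s + t).map (fun x => X - C x)).prod) :
    ∃ y : R, algebraMap R K y = a * t.prod := by
  induction s using Multiset.induction_on generalizing P with
  | empty =>
    rw [zero_add] at hP
    refine ⟨(-1) ^ Multiset.card t * P.coeff 0, ?_⟩
    rw [map_mul, ← coeff_map, hP, coeff_C_mul, coeff_zero_eq_eval_zero, eval_multiset_prod,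
      Multiset.map_map]
    have : (t.map ((eval 0) ∘ fun x => X - C x)).prod = (-1) ^ Multiset.card t * t.prod := by
      have h1 : (t.map ((eval 0) ∘ fun x => X - C x)) = t.map Neg.neg := by
        refine Multiset.map_congr rfl fun x _ => ?_
        simp
      rw [h1, Multiset.prod_map_neg]
    rw [this]
    simp only [map_pow, map_neg, map_one]
    have h2 : ((-1 : K) ^ Multiset.card t) * (-1) ^ Multiset.card t = 1 := by
      rw [← mul_pow]; simp
    linear_combination a * t.prod * h2
  | cons x s ih =>
    have hx : aeval x P = 0 := by
      rw [← eval_map_algebraMap, hP]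
      simp [Multiset.cons_add]
    obtain ⟨G, hG⟩ := exists_map_eq_X_sub_C_mul P x hx
    refine ih G ?_
    rw [hG, Multiset.cons_add, Multiset.map_cons, Multiset.prod_cons, mul_left_comm] at hP
    exact mul_left_cancel₀ (X_sub_C_ne_zero x) hP

open NumberField in
theorem NumberField.abs_discr_le_abs_discr_basis {K : Type*} [Field K] [NumberField K] {ι : Type*}
    [Fintype ι] [DecidableEq ι] (b : Module.Basis ι ℚ K) (hb : ∀ i, IsIntegral ℤ (b i)) :
    |((discr K : ℤ) : ℝ)| ≤ |((Algebra.discr ℚ b : ℚ) : ℝ)| := by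
  let b₀ := (integralBasis K).reindex ((integralBasis K).indexEquiv b)
  have hint : ∀ i j, ∃ z : ℤ, b₀.toMatrix b i j = z := by
    intro i j
    obtain ⟨x, hx⟩ : ∃ x : 𝓞 K, algebraMap (𝓞 K) K x = b j := ⟨⟨b j, hb j⟩, rfl⟩
    rw [Module.Basis.toMatrix_apply, ← hx, Module.Basis.repr_reindex_apply,
      integralBasis_repr_apply]
    exact ⟨_, rfl⟩
  choose P hP using hint
  have hPm : b₀.toMatrix b = (Int.castRingHom ℚ).mapMatrix (Matrix.of P) := by
    ext i j; simp [hP]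
  have h1 : Algebra.discr ℚ b = (b₀.toMatrix b).det ^ 2 * discr K := by
    have h2 := Algebra.discr_of_matrix_vecMul (A := ℚ) (b₀ : ι → K) (b₀.toMatrix b)
    have h3 : (b₀ : ι → K) = (integralBasis K) ∘ ((integralBasis K).indexEquiv b).symm := by
      ext i; simp [b₀]
    rw [Module.Basis.toMatrix_map_vecMul] at h2
    rw [h2, h3, Algebra.discr_reindex, coe_discr]
  have h4 : (b₀.toMatrix b).det = ((Matrix.of P).det : ℤ) := by
    rw [hPm, ← RingHom.map_det]; rfl
  have h5 : (Matrix.of P).det ≠ 0 := by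
    intro h
    rw [h4, h] at h1
    exact Algebra.discr_not_zero_of_basis ℚ b (by simpa using h1)
  rw [h1, h4]
  push_cast
  rw [abs_mul, abs_pow, sq_abs]
  refine le_mul_of_one_le_left (abs_nonneg _) ?_
  have h6 : 1 ≤ (Matrix.of P).det ^ 2 := by
    have := sq_nonneg (Matrix.of P).det
    have := pow_ne_zero 2 h5
    omega
  exact_mod_cast h6

open NumberField in
theorem NumberField.abs_discr_le_of_basis {K : Type*} [Field K] [NumberField K] {d : ℕ}
    (b : Module.Basis (Fin d) ℚ K) (hb : ∀ i, IsIntegral ℤ (b i)) (B : Fin d → ℝ)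
    (hB : ∀ (τ : K →+* ℂ) i, ‖τ (b i)‖ ≤ B i) :
    |((discr K : ℤ) : ℝ)| ≤ (d.factorial * ∏ i, B i) ^ 2 := by
  refine (abs_discr_le_abs_discr_basis b hb).trans ?_
  have hcard : Fintype.card (Fin d) = Fintype.card (K →ₐ[ℚ] ℂ) := by
    rw [AlgHom.card, Module.finrank_eq_card_basis b]
  let e := Fintype.equivOfCardEq hcard
  have h := Algebra.discr_eq_det_embeddingsMatrixReindex_pow_two ℚ ℂ (b : Fin d → K) e
  have h1 : |((Algebra.discr ℚ b : ℚ) : ℝ)| = ‖algebraMap ℚ ℂ (Algebra.discr ℚ b)‖ := by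
    rw [eq_ratCast, Complex.norm_ratCast]
  rw [h1, h, norm_pow]
  refine pow_le_pow_left₀ (norm_nonneg _) ?_ 2
  rw [Matrix.det_apply]
  refine (norm_sum_le _ _).trans ?_
  refine (Finset.sum_le_card_nsmul _ _ (∏ i, B i) fun σ _ => ?_).trans ?_
  · have : ‖Equiv.Perm.sign σ • ∏ i, Algebra.embeddingsMatrixReindex ℚ ℂ (b : Fin d → K) e (σ i) i‖
        = ‖∏ i, Algebra.embeddingsMatrixReindex ℚ ℂ (b : Fin d → K) e (σ i) i‖ := by
      rcases Int.units_eq_one_or (Equiv.Perm.sign σ) with h | h <;> simp [h]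
    rw [this, norm_prod, ← Equiv.prod_comp σ B]
    exact Finset.prod_le_prod (fun _ _ => norm_nonneg _)
      fun i _ => hB ((e i : K →ₐ[ℚ] ℂ) : K →+* ℂ) (σ i)
  · rw [Finset.card_univ, Fintype.card_perm, Fintype.card_fin, nsmul_eq_mul]

open Polynomial IntermediateField in
theorem exists_basis_of_degree {K : Type*} [Field K] [NumberField K] {d : ℕ}
    (hd : Module.finrank ℚ K = d) (α : K) (hgen : ℚ⟮α⟯ = ⊤) (Q : ℕ → ℚ[X])
    (hQ : ∀ k < d, (Q k).degree = k) :
    ∃ b : Module.Basis (Fin d) ℚ K, ∀ k : Fin d, b k = aeval α (Q k) := by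
  have hmin : (minpoly ℚ α).degree = d := by
    have hint := Algebra.IsIntegral.isIntegral (R := ℚ) α
    have h1 := IntermediateField.adjoin.finrank hint
    rw [hgen, IntermediateField.finrank_top', hd] at h1
    rw [degree_eq_natDegree (minpoly.ne_zero hint), h1]
  let S : Polynomial.Sequence ℚ :=
    { elems' := fun k => if k < d then Q k else X ^ k
      degree_eq' := by
        intro k
        by_cases h : k < d
        · simp [h, hQ k h]
        · simp [h] }
  have hS : ∀ k : Fin d, S k = Q k := fun k => if_pos k.2
  have hli := S.linearIndependent
  have hli2 : LinearIndependent ℚ fun k : Fin d => aeval α (Q k) := by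
    rw [Fintype.linearIndependent_iff]
    intro c hc
    have h2 : aeval α (∑ k : Fin d, c k • Q k) = 0 := by
      rw [map_sum, ← hc]
      simp [map_smul]
    have h3 : (∑ k : Fin d, c k • Q k) = 0 := by
      by_contra hne
      have := minpoly.degree_le_of_ne_zero ℚ α hne h2
      rw [hmin] at this
      refine absurd this (not_le.2 ((degree_sum_le _ _).trans_lt ?_))
      rw [Finset.sup_lt_iff (WithBot.bot_lt_coe _)]
      intro k _
      refine (degree_smul_le _ _).trans_lt ?_
      rw [hQ k k.2]
      exact_mod_cast k.2
    have h4 := (hli.comp (fun k : Fin d => (k : ℕ)) Fin.val_injective)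
    rw [Fintype.linearIndependent_iff] at h4
    exact h4 c (by simpa [hS] using h3)
  have hcard : Fintype.card (Fin d) = Module.finrank ℚ K := by rw [Fintype.card_fin, hd]
  by_cases hd0 : Nonempty (Fin d)
  · exact ⟨basisOfLinearIndependentOfCardEqFinrank hli2 hcard, fun k => by simp⟩
  · exfalso
    have : 0 < Module.finrank ℚ K := Module.finrank_pos
    exact hd0 ⟨⟨0, by omega⟩⟩

open Polynomial IntermediateField NumberField in
/-- Discriminant bound for a number field generated by a root of a polynomial `F` whose rescaling
`P` by a `g`-th root of `ℓ` has integral coefficients. -/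
theorem NumberField.abs_discr_le_of_rescaled_root {K : Type*} [Field K] [NumberField K]
    {d g ρ m ℓ : ℕ} (hd : Module.finrank ℚ K = d) (F : ℤ[X]) (α : K) (hgen : ℚ⟮α⟯ = ⊤)
    (hFd : F.natDegree = d) (hα : aeval α F = 0) (hℓ : 0 < ℓ) (lam : ℂ)
    (hlam : lam ^ g = ℓ) (P : (integralClosure ℤ ℂ)[X])
    (hP : ∀ i, lam ^ i * (P.coeff i : ℂ) = lam ^ ρ * F.coeff i) {M N : ℝ} (hM : 1 ≤ M)
    (hF : ∀ i, |(F.coeff i : ℝ)| ≤ M * N ^ m) (hαM : ∀ τ : K →+* ℂ, ‖τ α‖ ≤ M) (hN : 1 ≤ N)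
    (hNℓ : N ≤ ℓ) (hm : (d - 1 - ρ) / g ≤ m) :
    |((discr K : ℤ) : ℝ)| ≤ (d.factorial * (d * M ^ (d + 1)) ^ d) ^ 2 *
      N ^ (∑ j ∈ Finset.range (d - 1), 2 * (m - ((j + 1) - ρ) / g)) := by
  have hd0 : 0 < d := hd ▸ Module.finrank_pos
  have hg : g ≠ 0 → lam ≠ 0 := by
    rintro hg rfl
    rw [zero_pow hg] at hlam
    exact hℓ.ne (by exact_mod_cast hlam)
  set W : ℕ → ℤ[X] := fun j => ∑ i ∈ Finset.Ioc j d, C (F.coeff i) * X ^ (i - j) with hW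
  have hWα : ∀ {A : Type _} [CommRing A] (x : A) (j : ℕ),
      aeval x (W j) = ∑ i ∈ Finset.Ioc j d, (F.coeff i : A) * x ^ (i - j) := by
    intro A _ x j
    simp [hW]
  let a : ℕ → ℕ := fun j => (j - ρ) / g
  -- integrality
  have hint : ∀ j, j ≠ 0 → IsIntegral ℤ (aeval α (W j) / (ℓ : K) ^ a j) := by
    intro j hj
    let τ : K →+* ℂ := (IsAlgClosed.lift (R := ℚ) (S := K) (M := ℂ) : K →ₐ[ℚ] ℂ)
    have hτ : Function.Injective (τ.toIntAlgHom) := τ.injective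
    rw [← isIntegral_algHom_iff τ.toIntAlgHom hτ]
    have e1 : τ.toIntAlgHom (aeval α (W j) / (ℓ : K) ^ a j) =
        (∑ i ∈ Finset.Ioc j d, (F.coeff i : ℂ) * τ α ^ (i - j)) / (ℓ : ℂ) ^ a j := by
      change τ _ = _
      rw [hWα]
      simp
    rw [e1]
    have hτα : aeval (τ α) F = 0 := by
      have := aeval_algHom_apply τ.toIntAlgHom α F
      rw [hα, map_zero] at this
      exact this
    by_cases ha : a j = 0
    · rw [ha, pow_zero, div_one]
      have h1 : aeval (τ α) (F.map (algebraMap ℤ (integralClosure ℤ ℂ))) = 0 := by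
        rw [aeval_map_algebraMap]; exact hτα
      obtain ⟨y, hy⟩ := exists_algebraMap_eq_sum_Ioc _ (τ α) h1
        (natDegree_map_le.trans hFd.le) hj
      have h2 : ∑ i ∈ Finset.Ioc j d, (F.coeff i : ℂ) * τ α ^ (i - j) = (y : ℂ) := by
        change _ = algebraMap (integralClosure ℤ ℂ) ℂ y
        rw [hy]
        simp
      rw [h2]
      exact y.2
    · have hg0 : g ≠ 0 := by
        rintro rfl
        exact ha (Nat.div_zero _)
      have hlam0 := hg hg0
      have hPα : aeval (lam * τ α) P = 0 := by
        rw [aeval_eq_sum_range' (n := P.natDegree + d + 1) (by omega)]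
        have h1 : ∀ i ∈ Finset.range (P.natDegree + d + 1), P.coeff i • (lam * τ α) ^ i =
            lam ^ ρ * (F.coeff i • (τ α) ^ i) := by
          intro i _
          rw [Subalgebra.smul_def, smul_eq_mul, mul_pow, zsmul_eq_mul, ← mul_assoc,
            mul_comm _ (lam ^ i), hP, mul_assoc]
        rw [Finset.sum_congr rfl h1, ← Finset.mul_sum,
          ← aeval_eq_sum_range' (p := F) (n := P.natDegree + d + 1) (by omega), hτα, mul_zero]
      have hPd : P.natDegree ≤ d := by
        rw [natDegree_le_iff_coeff_eq_zero]
        intro i hi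
        have := hP i
        rw [coeff_eq_zero_of_natDegree_lt (p := F) (by omega), Int.cast_zero, mul_zero] at this
        have h2 := (mul_eq_zero.1 this).resolve_left (pow_ne_zero _ hlam0)
        exact_mod_cast h2
      obtain ⟨y, hy⟩ := exists_algebraMap_eq_sum_Ioc P _ hPα hPd hj
      have hy' : lam ^ j * (y : ℂ) =
          lam ^ ρ * ∑ i ∈ Finset.Ioc j d, (F.coeff i : ℂ) * τ α ^ (i - j) := by
        have : (y : ℂ) = algebraMap (integralClosure ℤ ℂ) ℂ y := rfl
        rw [this, hy, Finset.mul_sum, Finset.mul_sum]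
        refine Finset.sum_congr rfl fun i hi => ?_
        rw [Finset.mem_Ioc] at hi
        rw [← mul_assoc (lam ^ ρ), ← hP i, mul_pow]
        have h3 : lam ^ i = lam ^ j * lam ^ (i - j) := by rw [← pow_add]; congr 1; omega
        rw [h3]
        change lam ^ j * ((P.coeff i : ℂ) * _) = _
        ring
      obtain ⟨t, ht⟩ : ∃ t, j = ρ + g * a j + t := by
        have h1 : g * a j ≤ j - ρ := Nat.mul_div_le _ _
        have h2 : 0 < a j := Nat.pos_of_ne_zero ha
        have h3 : 0 < g * a j := Nat.mul_pos (Nat.pos_of_ne_zero hg0) h2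
        exact ⟨j - (ρ + g * a j), by omega⟩
      have h4 : (∑ i ∈ Finset.Ioc j d, (F.coeff i : ℂ) * τ α ^ (i - j)) / (ℓ : ℂ) ^ a j =
          lam ^ t * y := by
        rw [div_eq_iff (pow_ne_zero _ (by exact_mod_cast hℓ.ne')), ← hlam]
        apply mul_left_cancel₀ (pow_ne_zero ρ hlam0)
        rw [← hy']
        nth_rewrite 1 [ht]
        rw [pow_add, pow_add, pow_mul]
        ring
      rw [h4]
      refine IsIntegral.mul (IsIntegral.pow ?_ t) y.2
      refine IsIntegral.of_pow (Nat.pos_of_ne_zero hg0) ?_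
      rw [hlam]
      simpa using isIntegral_algebraMap (R := ℤ) (A := ℂ) (x := (ℓ : ℤ))
  -- the basis
  set Q : ℕ → ℚ[X] := fun k => if k = 0 then 1 else
    C (((ℓ : ℚ) ^ a (d - k))⁻¹) * (W (d - k)).map (algebraMap ℤ ℚ) with hQ
  have hF0 : F.coeff d ≠ 0 := by
    rw [← hFd]
    exact leadingCoeff_ne_zero.2 (by rintro rfl; rw [natDegree_zero] at hFd; omega)
  have hWdeg : ∀ k < d, k ≠ 0 → (W (d - k)).degree = k := by
    intro k hk hk0
    have h1 : W (d - k) = ∑ i ∈ Finset.Ioc (d - k) (d - 1), C (F.coeff i) * X ^ (i - (d - k)) +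
        C (F.coeff d) * X ^ k := by
      simp only [hW]
      have : Finset.Ioc (d - k) d = insert d (Finset.Ioc (d - k) (d - 1)) := by
        ext i; simp only [Finset.mem_Ioc, Finset.mem_insert]; omega
      rw [this, Finset.sum_insert (by simp; omega), add_comm, show d - (d - k) = k by omega]
    rw [h1, degree_add_eq_right_of_degree_lt, degree_C_mul_X_pow _ hF0]
    rw [degree_C_mul_X_pow _ hF0]
    refine (degree_sum_le _ _).trans_lt ?_
    rw [Finset.sup_lt_iff (WithBot.bot_lt_coe _)]
    intro i hi
    rw [Finset.mem_Ioc] at hi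
    exact (degree_C_mul_X_pow_le _ _).trans_lt (by exact_mod_cast (by omega))
  have hQdeg : ∀ k < d, (Q k).degree = k := by
    intro k hk
    by_cases hk0 : k = 0
    · simp [hQ, hk0]
    · simp only [hQ, hk0, if_false]
      rw [degree_C_mul (inv_ne_zero (pow_ne_zero _ (by exact_mod_cast hℓ.ne'))),
        degree_map_eq_of_injective (algebraMap ℤ ℚ).injective_int, hWdeg k hk hk0]
  obtain ⟨b, hb⟩ := exists_basis_of_degree hd α hgen Q hQdeg
  have hbk : ∀ k : Fin d, (k : ℕ) ≠ 0 →
      b k = aeval α (W (d - k)) / (ℓ : K) ^ a (d - k) := by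
    intro k hk
    rw [hb]
    simp only [hQ, hk, if_false]
    rw [map_mul, aeval_C, aeval_map_algebraMap, map_inv₀, map_pow, map_natCast]
    ring
  have hb0 : ∀ k : Fin d, (k : ℕ) = 0 → b k = 1 := by
    intro k hk
    rw [hb]
    simp [hQ, hk]
  set S : ℝ := d * M ^ (d + 1) with hS
  have hS1 : 1 ≤ S := by
    have h1 : (1 : ℝ) ≤ d := by exact_mod_cast hd0
    have h2 : 1 ≤ M ^ (d + 1) := one_le_pow₀ hM
    nlinarith
  have hN0 : 0 < N := by linarith
  let B : Fin d → ℝ := fun k => S * N ^ (if (k : ℕ) = 0 then 0 else m - a (d - k))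
  refine (abs_discr_le_of_basis b ?_ B ?_).trans ?_
  · intro k
    by_cases hk : (k : ℕ) = 0
    · rw [hb0 k hk]; exact isIntegral_one
    · rw [hbk k hk]
      exact hint _ (by have := k.2; omega)
  · intro τ k
    by_cases hk : (k : ℕ) = 0
    · simp only [B, hk, hb0 k hk, map_one, norm_one, if_true, pow_zero, mul_one]
      exact hS1
    · simp only [B, hk, if_false]
      rw [hbk k hk, map_div₀, map_pow, map_natCast, norm_div, norm_pow, Complex.norm_natCast]
      have hl0 : (0 : ℝ) < (ℓ : ℝ) ^ a (d - k) := by positivity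
      have ham : a (d - k) ≤ m := by
        refine le_trans (Nat.div_le_div_right ?_) hm
        omega
      have h1 : ‖τ (aeval α (W (d - k)))‖ ≤ S * N ^ m := by
        rw [hWα, map_sum]
        refine (norm_sum_le _ _).trans ?_
        refine (Finset.sum_le_card_nsmul _ _ (M ^ (d + 1) * N ^ m) fun i hi => ?_).trans ?_
        · rw [Finset.mem_Ioc] at hi
          rw [map_mul, map_intCast, map_pow, norm_mul, norm_pow, Complex.norm_intCast]
          have h2 : ‖τ α‖ ^ (i - (d - k)) ≤ M ^ d :=
            (pow_le_pow_left₀ (norm_nonneg _) (hαM τ) _).trans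
              (pow_le_pow_right₀ hM (by omega))
          calc |(F.coeff i : ℝ)| * ‖τ α‖ ^ (i - (d - k)) ≤ (M * N ^ m) * M ^ d :=
                mul_le_mul (hF i) h2 (by positivity) (by positivity)
            _ = M ^ (d + 1) * N ^ m := by ring
        · rw [nsmul_eq_mul, Nat.card_Ioc, hS, mul_assoc]
          refine mul_le_mul_of_nonneg_right ?_ (by positivity)
          exact_mod_cast (by omega)
      rw [div_le_iff₀ hl0]
      refine h1.trans ?_
      rw [mul_assoc S]
      refine mul_le_mul_of_nonneg_left ?_ (zero_le_one.trans hS1)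
      calc N ^ m = N ^ (m - a (d - k)) * N ^ a (d - k) := by
            rw [← pow_add]; congr 1; omega
        _ ≤ N ^ (m - a (d - k)) * (ℓ : ℝ) ^ a (d - k) :=
            mul_le_mul_of_nonneg_left (pow_le_pow_left₀ hN0.le hNℓ _) (by positivity)
  · apply le_of_eq
    have h1 : ∏ k, B k = S ^ d * N ^ (∑ j ∈ Finset.range (d - 1), (m - ((j + 1) - ρ) / g)) := by
      simp only [B]
      rw [Finset.prod_mul_distrib, Finset.prod_const, Finset.card_univ, Fintype.card_fin,
        Finset.prod_pow_eq_pow_sum,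
        Fin.sum_univ_eq_sum_range (fun k => if k = 0 then 0 else m - a (d - k)) d]
      congr 2
      obtain ⟨d', rfl⟩ : ∃ d', d = d' + 1 := ⟨d - 1, by omega⟩
      rw [Finset.sum_range_succ', if_pos rfl, add_zero, Nat.add_sub_cancel,
        ← Finset.sum_range_reflect]
      refine Finset.sum_congr rfl fun j hj => ?_
      rw [Finset.mem_range] at hj
      rw [if_neg (by omega)]
      simp only [a]
      congr 3
      omega
    rw [h1, ← Finset.mul_sum]
    ring

open IsDedekindDomain in
theorem NumberField.dvd_discr_of_valuation_eq_pow {K : Type*} [Field K] [NumberField K]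
    {p : ℕ} (hp : p.Prime) (v : HeightOneSpectrum (𝓞 K)) (z : K) {g : ℕ} (hg : 2 ≤ g)
    (hlt : v.valuation K (p : K) < 1) (h : v.valuation K (p : K) = v.valuation K z ^ g) :
    (p : ℤ) ∣ discr K := by
  have hcast : ((p : 𝓞 K) : K) = (p : K) := by simp
  have hz : v.valuation K z < 1 := by
    by_contra hz
    exact absurd (h ▸ hlt) (not_lt.mpr (one_le_pow₀ (not_lt.mp hz)))
  have hz' : v.valuation K z ≤ WithZero.exp (-1 : ℤ) := by
    rcases eq_or_ne (v.valuation K z) 0 with h0 | h0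
    · simp [h0]
    · rw [← WithZero.exp_log h0, WithZero.exp_le_exp]
      have : WithZero.log (v.valuation K z) < 0 := by
        rwa [← WithZero.exp_lt_exp, WithZero.exp_log h0, WithZero.exp_zero]
      omega
  have h2 : v.valuation K (p : K) ≤ WithZero.exp (-(2 : ℕ) : ℤ) := by
    rw [h]
    calc v.valuation K z ^ g ≤ v.valuation K z ^ 2 := pow_le_pow_right_of_le_one' hz.le hg
      _ ≤ WithZero.exp (-1 : ℤ) ^ 2 := by gcongr
      _ = _ := by rw [← WithZero.exp_nsmul]; rfl
  rw [← hcast, HeightOneSpectrum.valuation_of_algebraMap,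
    HeightOneSpectrum.intValuation_le_pow_iff_mem] at h2
  have hmem : (p : 𝓞 K) ∈ v.asIdeal := Ideal.pow_le_self two_ne_zero h2
  by_contra hnd
  have hcop : IsCoprime (p : ℤ) (discr K) :=
    (Nat.prime_iff_prime_int.mp hp).coprime_iff_not_dvd.mpr hnd
  obtain ⟨a, b, hab⟩ := hcop
  have hmax : (Ideal.span {(p : ℤ)}).IsMaximal := PrincipalIdealRing.isMaximal_of_irreducible
      (Nat.prime_iff_prime_int.mp hp).irreducible
  have hdiff : v.asIdeal ∣ differentIdeal ℤ (𝓞 K) := by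
    have := pow_sub_one_dvd_differentIdeal (A := ℤ) (B := 𝓞 K) (p := Ideal.span {(p : ℤ)})
      v.asIdeal 2 (by simpa using hp.ne_zero) (by
        rw [Ideal.dvd_iff_le, Ideal.map_span, Ideal.span_le]
        simpa using h2)
    simpa using this
  have hd : ((discr K : ℤ) : 𝓞 K) ∈ v.asIdeal :=
    Ideal.dvd_iff_le.mp hdiff (discr_mem_differentIdeal K (𝓞 K))
  refine v.isPrime.ne_top ((Ideal.eq_top_iff_one _).mpr ?_)
  have : ((a * p + b * discr K : ℤ) : 𝓞 K) ∈ v.asIdeal := by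
    push_cast
    exact add_mem (Ideal.mul_mem_left _ _ hmem) (Ideal.mul_mem_left _ _ hd)
  rw [hab] at this
  simpa using this

open IsDedekindDomain Polynomial in
theorem NumberField.exists_one_lt_valuation {K : Type*} [Field K] [NumberField K]
    {p : ℕ} (hp : p.Prime) (F : ℤ[X]) (hF : Irreducible (F.map (Int.castRingHom ℚ))) (α : K)
    (hα : aeval α F = 0) (h0 : (p : ℤ) ∣ F.leadingCoeff) (i : ℕ) (hi : ¬ (p : ℤ) ∣ F.coeff i) :
    ∃ v : HeightOneSpectrum (𝓞 K), v.valuation K (p : K) < 1 ∧ 1 < v.valuation K α := by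
  by_contra! hcon
  have hF0 : F ≠ 0 := by rintro rfl; simp at hi
  have hlc : F.leadingCoeff ≠ 0 := leadingCoeff_ne_zero.mpr hF0
  have hint0 : IsIntegral ℤ ((F.leadingCoeff : K) * α) := by
    have := RingHom.isIntegralElem_leadingCoeff_mul (algebraMap ℤ K) F α
      (by rwa [← aeval_def])
    rwa [eq_intCast] at this
  obtain ⟨u, hu, hpu⟩ := (Int.finiteMultiplicity_iff (a := (p : ℤ)).mpr
    ⟨by simpa using hp.ne_one, hlc⟩).exists_eq_pow_mul_and_not_dvd
  set k := multiplicity (p : ℤ) F.leadingCoeff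
  have hpK : (p : K) ≠ 0 := by exact_mod_cast hp.ne_zero
  have hint : IsIntegral ℤ ((u : K) * α) := by
    obtain ⟨y, hy⟩ := HeightOneSpectrum.mem_integers_of_valuation_le_one (R := 𝓞 K) K
      ((u : K) * α) (fun v => by
        have hle : ∀ n : ℤ, v.valuation K (n : K) ≤ 1 := fun n => by
          simpa using v.valuation_le_one (K := K) (n : 𝓞 K)
        rcases lt_or_eq_of_le (hle p) with hv | hv
        · rw [map_mul]
          exact mul_le_one' (hle u) (hcon v (by simpa using hv))
        · have h1 : v.valuation K ((F.leadingCoeff : K) * α) ≤ 1 :=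
            v.valuation_le_one (K := K) (⟨_, hint0⟩ : 𝓞 K)
          rw [hu] at h1
          push_cast at h1 hv
          rwa [mul_assoc, map_mul, map_pow, hv, one_pow, one_mul] at h1)
    rw [← hy]
    exact y.2
  obtain ⟨G, hG, hGu⟩ := hint
  set H := G.comp (C u * X) with hH
  have hu0 : u ≠ 0 := by rintro rfl; simp at hpu
  have hHα : aeval α H = 0 := by
    rw [hH, aeval_comp]
    have h1 : aeval ((u : K) * α) G = 0 := hGu
    simpa using h1
  have hHlc : H.leadingCoeff = u ^ G.natDegree := by
    rw [hH, leadingCoeff_comp (by rw [natDegree_C_mul_X _ hu0]; simp), hG.leadingCoeff, one_mul,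
      leadingCoeff_C_mul_X]
  have hH0 : H ≠ 0 := by
    rw [← leadingCoeff_ne_zero, hHlc]; exact pow_ne_zero _ hu0
  have hdvdQ : F.primPart.map (Int.castRingHom ℚ) ∣ H.map (Int.castRingHom ℚ) := by
    have h1 : F.map (Int.castRingHom ℚ) ∣ H.map (Int.castRingHom ℚ) := by
      refine ((minpoly.irreducible (A := ℚ) (Algebra.IsIntegral.isIntegral α)).associated_of_dvd hF
        (minpoly.dvd ℚ α ?_)).symm.dvd.trans (minpoly.dvd ℚ α ?_)
      · rwa [show Int.castRingHom ℚ = algebraMap ℤ ℚ from rfl, aeval_map_algebraMap]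
      · rwa [show Int.castRingHom ℚ = algebraMap ℤ ℚ from rfl, aeval_map_algebraMap]
    refine dvd_trans ?_ h1
    exact Polynomial.map_dvd _ ⟨C F.content, by
      conv_lhs => rw [F.eq_C_content_mul_primPart]
      ring⟩
  have hdvd := (IsPrimitive.Int.dvd_iff_map_cast_dvd_map_cast _ H F.isPrimitive_primPart).mpr hdvdQ
  have h3 := leadingCoeff_dvd_leadingCoeff hdvd
  have hpp := Nat.prime_iff_prime_int.mp hp
  have hcont : ¬ (p : ℤ) ∣ F.content := fun h => hi (h.trans (F.content_dvd_coeff i))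
  have h4 : (p : ℤ) ∣ F.primPart.leadingCoeff := by
    have : F.leadingCoeff = F.content * F.primPart.leadingCoeff := by
      conv_lhs => rw [F.eq_C_content_mul_primPart]
      rw [leadingCoeff_mul, leadingCoeff_C]
    rw [this] at h0
    exact (hpp.dvd_or_dvd h0).resolve_left hcont
  rw [hHlc] at h3
  exact hpu (hpp.dvd_of_dvd_pow (h4.trans h3))

open Polynomial in
theorem Valuation.aeval_le_of_natDegree_le {K Γ : Type*} [Field K]
    [LinearOrderedCommGroupWithZero Γ] (v : Valuation K Γ) (hv : ∀ n : ℤ, v (n : K) ≤ 1)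
    (f : ℤ[X]) {D : ℕ} (hf : f.natDegree ≤ D) {α : K} (hα : 1 ≤ v α) :
    v (aeval α f) ≤ v α ^ D := by
  rw [aeval_eq_sum_range]
  refine v.map_sum_le fun i hi => ?_
  rw [zsmul_eq_mul, map_mul, map_pow]
  have : i ≤ D := by simp at hi; omega
  calc v (f.coeff i : K) * v α ^ i ≤ 1 * v α ^ D :=
        mul_le_mul' (hv _) (pow_le_pow_right₀ hα this)
    _ = _ := one_mul _

open Polynomial in
theorem Valuation.aeval_eq_of_leadingCoeff {K Γ : Type*} [Field K]
    [LinearOrderedCommGroupWithZero Γ] (v : Valuation K Γ) (hv : ∀ n : ℤ, v (n : K) ≤ 1)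
    (f : ℤ[X]) (hf : v (f.leadingCoeff : K) = 1) {α : K} (hα : 1 < v α) :
    v (aeval α f) = v α ^ f.natDegree := by
  have hlead : v (f.leadingCoeff * α ^ f.natDegree) = v α ^ f.natDegree := by
    rw [map_mul, hf, one_mul, map_pow]
  have hsplit : aeval α f = aeval α f.eraseLead + f.leadingCoeff * α ^ f.natDegree := by
    conv_lhs => rw [← f.eraseLead_add_C_mul_X_pow]
    simp
  suffices hlt : v (aeval α f.eraseLead) < v α ^ f.natDegree by
    rw [hsplit, v.map_add_eq_of_lt_right (by rwa [hlead]), hlead]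
  by_cases h0 : f.natDegree = 0
  · have : f.eraseLead = 0 := by
      obtain ⟨c, rfl⟩ := natDegree_eq_zero.mp h0
      exact eraseLead_C c
    rw [this, map_zero, map_zero, h0]
    simp
  · refine (v.aeval_le_of_natDegree_le hv _ f.eraseLead_natDegree_le hα.le).trans_lt ?_
    exact pow_lt_pow_right₀ hα (by omega)

open Polynomial in
theorem Valuation.mul_pow_eq_one_of_aeval_eq {K Γ : Type*} [Field K]
    [LinearOrderedCommGroupWithZero Γ] (v : Valuation K Γ) (hv : ∀ n : ℤ, v (n : K) ≤ 1)
    {m g ρ : ℕ} (hm : 0 < m) (h r : ℤ[X]) {s ℓ B E : ℤ}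
    (hh : h.Monic) (hhd : h.natDegree = m * g + ρ) (hr : r.natDegree = g)
    (hrlc : v (r.leadingCoeff : K) = 1)
    (happ : (X ^ ρ * r ^ m - C (E ^ m) * h).natDegree < ρ + (m - 1) * g)
    (hvs : v (s : K) = 1) (hvB : v (B : K) = 1) (hvE : v (E : K) = 1) (hvm : v ((m : ℤ) : K) = 1)
    (hℓ : v (ℓ : K) < 1) (hℓ0 : ℓ ≠ 0) [CharZero K] {α : K} (hα : 1 < v α)
    (heq : α ^ ρ * ((s : K) + ℓ * B * aeval α r) ^ m = (ℓ * B * E) ^ m * aeval α h) :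
    v (ℓ : K) * v α ^ g = 1 := by
  have hvr : v (aeval α r) = v α ^ g := by
    rw [v.aeval_eq_of_leadingCoeff hv r hrlc hα, hr]
  have hvh : v (aeval α h) = v α ^ (m * g + ρ) := by
    rw [v.aeval_eq_of_leadingCoeff hv h (by rw [hh.leadingCoeff]; simp) hα, hhd]
  have hα0 : (0 : Γ) < v α := zero_lt_one.trans hα
  have hℓ' : (0 : Γ) < v (ℓ : K) := by
    rw [zero_lt_iff, Ne, map_eq_zero]; exact_mod_cast hℓ0
  set y : K := ℓ * B * aeval α r with hy
  have hvy : v y = v (ℓ : K) * v α ^ g := by rw [hy, map_mul, map_mul, hvB, hvr, mul_one]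
  rw [← hvy]
  rcases lt_trichotomy (v y) 1 with hlt | heq1 | hgt
  · exfalso
    have hA : v ((s : K) + y) = 1 := by
      rw [v.map_add_eq_of_lt_left (by rwa [hvs]), hvs]
    have := congrArg v heq
    rw [map_mul, map_pow, map_pow, hA, one_pow, mul_one, map_mul, map_pow, map_mul, map_mul, hvB,
      hvE, hvh, mul_one, mul_one, pow_add, ← mul_assoc, mul_comm m g, pow_mul, ← mul_pow,
      ← hvy] at this
    have h1 : v y ^ m < 1 := pow_lt_one₀ zero_le hlt hm.ne'
    have h2 : v y ^ m * v α ^ ρ < v α ^ ρ := by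
      calc v y ^ m * v α ^ ρ < 1 * v α ^ ρ := by
            exact (mul_lt_mul_iff_left₀ (pow_pos hα0 _)).mpr h1
        _ = _ := one_mul _
    exact absurd this h2.ne'
  · exact heq1
  · exfalso
    have key : α ^ ρ * (((s : K) + y) ^ m - y ^ m) =
        -((ℓ * B) ^ m * aeval α (X ^ ρ * r ^ m - C (E ^ m) * h)) := by
      rw [mul_sub, heq, hy]
      simp
      ring
    have hgeom : v (((s : K) + y) ^ m - y ^ m) = v y ^ (m - 1) := by
      set f : ℤ[X] := (X + C s) ^ m - X ^ m with hf
      have hco : f.coeff (m - 1) = m * s := by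
        rw [hf, coeff_sub, coeff_X_add_C_pow, coeff_X_pow, if_neg (by omega),
          Nat.choose_symm_of_eq_add (show m = m - 1 + 1 by omega), Nat.choose_one_right,
          show m - (m - 1) = 1 by omega]
        ring
      have hvms : v ((m * s : ℤ) : K) = 1 := by
        push_cast at hvm ⊢
        rw [map_mul, hvm, hvs, one_mul]
      have hdeg : f.natDegree = m - 1 := by
        refine natDegree_eq_of_le_of_coeff_ne_zero ?_ ?_
        · rw [natDegree_le_iff_coeff_eq_zero]
          intro N hN
          rw [hf, coeff_sub, coeff_X_add_C_pow, coeff_X_pow]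
          rcases eq_or_ne N m with rfl | hne
          · simp
          · rw [if_neg hne, Nat.choose_eq_zero_of_lt (by omega)]
            simp
        · rw [hco]
          intro h0
          rw [h0] at hvms
          simp at hvms
      have hfe : aeval y f = ((s : K) + y) ^ m - y ^ m := by
        rw [hf]; simp [add_comm]
      rw [← hfe, v.aeval_eq_of_leadingCoeff hv f (by rw [leadingCoeff, hdeg, hco, hvms]) hgt, hdeg]
    have := congrArg v key
    rw [map_mul, map_pow, hgeom, Valuation.map_neg, map_mul _ (((ℓ : K) * B) ^ m),
      map_pow v ((ℓ : K) * B), map_mul v (ℓ : K), hvB, mul_one] at this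
    have hle : v α ^ ρ * v y ^ (m - 1) ≤ v (ℓ : K) ^ m * v α ^ (ρ + (m - 1) * g - 1) := by
      rw [this]
      gcongr
      exact v.aeval_le_of_natDegree_le hv _ (by omega) hα.le
    obtain ⟨m, rfl⟩ : ∃ m', m = m' + 1 := ⟨m - 1, by omega⟩
    simp only [Nat.add_sub_cancel] at *
    rw [hvy, mul_pow, ← pow_mul, mul_left_comm, ← pow_add, pow_succ, mul_assoc,
      mul_le_mul_iff_right₀ (pow_pos hℓ' _), mul_comm g m] at hle
    have h1 : v (ℓ : K) * v α ^ (ρ + m * g - 1) < 1 * v α ^ (ρ + m * g) := by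
      refine mul_lt_mul'' hℓ ?_ zero_le zero_le
      exact pow_lt_pow_right₀ hα (by omega)
    rw [one_mul] at h1
    exact absurd hle (not_le.mpr h1)

open Polynomial in
theorem Polynomial.natDegree_X_add_C_pow_sub {R : Type*} [CommRing R] [IsDomain R] [CharZero R]
    {m : ℕ} (hm : 0 < m) {t : R} (ht : t ≠ 0) :
    ((X + C t) ^ m - X ^ m : R[X]).natDegree = m - 1 ∧
      ((X + C t) ^ m - X ^ m : R[X]).leadingCoeff = m * t := by
  set f : R[X] := (X + C t) ^ m - X ^ m with hf
  have hco : f.coeff (m - 1) = m * t := by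
    rw [hf, coeff_sub, coeff_X_add_C_pow, coeff_X_pow, if_neg (by omega),
      Nat.choose_symm_of_eq_add (show m = m - 1 + 1 by omega), Nat.choose_one_right,
      show m - (m - 1) = 1 by omega]
    ring
  have hdeg : f.natDegree = m - 1 := by
    refine natDegree_eq_of_le_of_coeff_ne_zero ?_ ?_
    · rw [natDegree_le_iff_coeff_eq_zero]
      intro N hN
      rw [hf, coeff_sub, coeff_X_add_C_pow, coeff_X_pow]
      rcases eq_or_ne N m with rfl | hne
      · simp
      · rw [if_neg hne, Nat.choose_eq_zero_of_lt (by omega)]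
        simp
    · rw [hco]
      exact mul_ne_zero (by exact_mod_cast hm.ne') ht
  exact ⟨hdeg, by rw [leadingCoeff, hdeg, hco]⟩

open Polynomial in
theorem Polynomial.natDegree_X_pow_mul_add_pow_sub {R : Type*} [CommRing R] [IsDomain R]
    [CharZero R] {m g ρ : ℕ} (hm : 0 < m) (hg : 0 < g) {r h : R[X]} (hr : r.Monic)
    (hrg : r.natDegree = g) (happ : (X ^ ρ * r ^ m - h).natDegree < ρ + (m - 1) * g) {t : R}
    (ht : t ≠ 0) :
    (X ^ ρ * (C t + r) ^ m - h).natDegree = ρ + (m - 1) * g ∧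
      (X ^ ρ * (C t + r) ^ m - h).leadingCoeff = m * t := by
  obtain ⟨h1, h2⟩ := natDegree_X_add_C_pow_sub (R := R) hm ht
  set u : R[X] := (X + C t) ^ m - X ^ m with hu
  have hsplit : X ^ ρ * (C t + r) ^ m - h = X ^ ρ * u.comp r + (X ^ ρ * r ^ m - h) := by
    rw [hu]; simp; ring
  have hd1 : (u.comp r).natDegree = (m - 1) * g := by rw [natDegree_comp, h1, hrg]
  have hl1 : (u.comp r).leadingCoeff = m * t := by
    rw [leadingCoeff_comp (by omega), h2, hr.leadingCoeff, one_pow, mul_one]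
  have hne : u.comp r ≠ 0 := by
    rw [← leadingCoeff_ne_zero, hl1]
    exact mul_ne_zero (by exact_mod_cast hm.ne') ht
  have hd2 : (X ^ ρ * u.comp r).natDegree = ρ + (m - 1) * g := by
    rw [natDegree_mul (pow_ne_zero _ X_ne_zero) hne, natDegree_X_pow, hd1]
  rw [hsplit]
  constructor
  · rw [natDegree_add_eq_left_of_natDegree_lt (by rwa [hd2]), hd2]
  · rw [leadingCoeff_add_of_degree_lt' (degree_lt_degree (by rwa [hd2])), leadingCoeff_mul, hl1,
      leadingCoeff_X_pow, one_mul]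

open Polynomial in
theorem Polynomial.eventually_pos_atTop {P : ℝ[X]} (hP : 0 < P.leadingCoeff) :
    ∃ R : ℝ, ∀ x, R ≤ x → 0 < P.eval x := by
  rcases Nat.eq_zero_or_pos P.natDegree with h0 | h0
  · obtain ⟨c, rfl⟩ := natDegree_eq_zero.mp h0
    exact ⟨0, fun x _ => by simpa using hP⟩
  · have := P.tendsto_atTop_of_leadingCoeff_nonneg (natDegree_pos_iff_degree_pos.mp h0) hP.le
    obtain ⟨R, hR⟩ := Filter.eventually_atTop.mp (this.eventually_gt_atTop 0)
    exact ⟨R, hR⟩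

open Polynomial in
theorem Polynomial.eventually_pos_atBot {P : ℝ[X]} (hP : 0 < (-1) ^ P.natDegree * P.leadingCoeff) :
    ∃ R : ℝ, ∀ x, x ≤ -R → 0 < P.eval x := by
  obtain ⟨R, hR⟩ := eventually_pos_atTop (P := P.comp (-X)) (by
    rw [leadingCoeff_comp (by simp)]
    simpa [mul_comm] using hP)
  exact ⟨R, fun x hx => by simpa using hR (-x) (by linarith)⟩

open Polynomial in
/-- The roots of `X ^ ρ * (t + r) ^ m - h` avoid any annulus once `t` is large. -/
theorem Polynomial.exists_root_location {m ρ : ℕ} (hm : 0 < m) (r h : ℝ[X]) (R ε : ℝ)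
    (hε : 0 < ε) : ∃ T : ℝ, ∀ t, T ≤ t → ∀ x : ℂ, aeval x (X ^ ρ * (C t + r) ^ m - h) = 0 →
      R < ‖x‖ ∨ (‖x‖ < ε ∧ 0 < ρ) := by
  have hK : IsCompact (Metric.closedBall (0 : ℂ) R) := isCompact_closedBall _ _
  obtain ⟨H, hH⟩ := hK.exists_bound_of_continuousOn (f := fun x : ℂ => aeval x h)
    (Polynomial.continuous_aeval h).continuousOn
  obtain ⟨G, hG⟩ := hK.exists_bound_of_continuousOn (f := fun x : ℂ => aeval x r)
    (Polynomial.continuous_aeval r).continuousOn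
  set e := (min ε 1) ^ ρ with he
  have he0 : 0 < e := by positivity
  refine ⟨G + max 1 (H / e + 1), fun t ht x hx => ?_⟩
  by_contra! hcon
  obtain ⟨hxR, hxε⟩ := hcon
  have hmem : x ∈ Metric.closedBall (0 : ℂ) R := by simpa using hxR
  have h1 := hH x hmem
  have h2 := hG x hmem
  have hA : max 1 (H / e + 1) ≤ ‖(t : ℂ) + aeval x r‖ := by
    have h3 : ‖(t : ℂ)‖ ≤ ‖(t : ℂ) + aeval x r‖ + ‖aeval x r‖ := by
      simpa using norm_sub_le ((t : ℂ) + aeval x r) (aeval x r)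
    have h4 : t ≤ ‖(t : ℂ)‖ := by simpa using le_abs_self t
    linarith
  have hxe : e ≤ ‖x‖ ^ ρ := by
    rcases Nat.eq_zero_or_pos ρ with h0 | h0
    · simp [he, h0]
    · have : ε ≤ ‖x‖ := by
        by_contra! hlt
        exact absurd (hxε hlt) (by omega)
      exact pow_le_pow_left₀ (by positivity) ((min_le_left _ _).trans this) _
  have hx' : x ^ ρ * ((t : ℂ) + aeval x r) ^ m = aeval x h := by
    simpa [sub_eq_zero] using hx
  have := congrArg norm hx'
  rw [norm_mul, norm_pow, norm_pow] at this
  have h5 : H / e + 1 ≤ ‖(t : ℂ) + aeval x r‖ ^ m :=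
    (le_max_right 1 _).trans (hA.trans (le_self_pow₀ ((le_max_left _ _).trans hA) hm.ne'))
  have h6 : e * (H / e + 1) ≤ ‖x‖ ^ ρ * ‖(t : ℂ) + aeval x r‖ ^ m := by
    have : 0 ≤ H / e + 1 := by
      have := (norm_nonneg _).trans h1
      positivity
    exact mul_le_mul hxe h5 this (by positivity)
  have h7 : e * (H / e + 1) = H + e := by field_simp
  linarith

open Polynomial in
/-- A double root of `X ^ ρ * (t + r) ^ m - h` lies in a finite set independent of `t`. -/
theorem Polynomial.exists_double_root_avoid {m ρ : ℕ} (hm : 2 ≤ m) (r h : ℝ[X]) {c : ℝ}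
    (hc0 : c ≠ 0) (hc : h.eval c = 0) (hc' : h.derivative.eval c ≠ 0) :
    ∃ S : Finset ℂ, ∀ (t : ℝ) (x : ℂ), aeval x (X ^ ρ * (C t + r) ^ m - h) = 0 →
      aeval x h ≠ 0 → aeval x (X ^ ρ * (C t + r) ^ m - h).derivative = 0 → x ∈ S := by
  set P : ℝ[X] := X * h.derivative - C (ρ : ℝ) * h with hP
  set U : ℝ[X] := X ^ (ρ + m) * (C (m : ℝ) * r.derivative) ^ m * h ^ (m - 1) - P ^ m with hU
  have hU0 : U ≠ 0 := by
    intro h0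
    have := congrArg (eval c) h0
    rw [hU, hP] at this
    simp [hc, show m - 1 ≠ 0 by omega, show m ≠ 0 by omega, hc0, hc'] at this
  refine ⟨(U.aroots ℂ).toFinset, fun t x hx hhx hx' => ?_⟩
  rw [Multiset.mem_toFinset, mem_aroots]
  refine ⟨hU0, ?_⟩
  set A : ℂ := (t : ℂ) + aeval x r with hA
  set r' := aeval x r.derivative
  set h' := aeval x h.derivative
  have e1 : x ^ ρ * A ^ m = aeval x h := by simpa [sub_eq_zero, hA] using hx
  have e2 : ρ * x ^ ρ * A ^ m + m * x ^ (ρ + 1) * A ^ (m - 1) * r' = x * h' := by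
    have h3 : ρ * x ^ (ρ - 1) * A ^ m + x ^ ρ * (m * A ^ (m - 1) * r') = h' := by
      simpa [derivative_mul, derivative_pow, sub_eq_zero] using hx'
    rw [← h3]
    rcases Nat.eq_zero_or_pos ρ with h0 | h0
    · subst h0
      simp
      ring
    · obtain ⟨e, rfl⟩ : ∃ e, ρ = e + 1 := ⟨ρ - 1, by omega⟩
      simp only [Nat.add_sub_cancel]
      ring
  obtain ⟨k, rfl⟩ : ∃ k, m = k + 1 := ⟨m - 1, by omega⟩
  have e3 : A * (x * h' - ρ * aeval x h) = (k + 1 : ℕ) * x * r' * aeval x h := by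
    rw [← e2, ← e1]
    simp only [Nat.add_sub_cancel]
    ring
  have e4 : aeval x U * aeval x h = 0 := by
    have : aeval x P = x * h' - ρ * aeval x h := by simp [hP, h']
    have e6 : aeval x U = x ^ (ρ + (k + 1)) * ((k + 1 : ℕ) * r') ^ (k + 1) * aeval x h ^ k -
        (x * h' - ρ * aeval x h) ^ (k + 1) := by
      rw [hU, map_sub, map_pow _ P, this]
      simp [r']
    have e5 : aeval x h * (x * h' - ρ * aeval x h) ^ (k + 1) =
        x ^ ρ * ((k + 1 : ℕ) * x * r' * aeval x h) ^ (k + 1) := by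
      rw [← e3, mul_pow, ← mul_assoc, e1]
    rw [e6, sub_mul, mul_comm _ (aeval x h), mul_comm _ (aeval x h), e5]
    generalize aeval x h = w
    simp only [mul_pow]
    ring
  exact (mul_eq_zero.mp e4).resolve_right hhx

open Polynomial in
theorem Polynomial.rolle_log {m ρ : ℕ} (hm : 0 < m) (r h : ℝ[X]) (t : ℝ) {x y : ℝ} (hxy : x < y)
    (h0 : ∀ z ∈ Set.Icc x y, z ≠ 0) (hh : ∀ z ∈ Set.Icc x y, h.eval z ≠ 0)
    (hA : ∀ z ∈ Set.Ioo x y, t + r.eval z ≠ 0)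
    (hW : ∀ z ∈ Set.Ioo x y, (t + r.eval z) * (z * h.derivative.eval z - ρ * h.eval z) ≠
      m * z * r.derivative.eval z * h.eval z)
    (hx : (X ^ ρ * (C t + r) ^ m - h).eval x = 0) (hy : (X ^ ρ * (C t + r) ^ m - h).eval y = 0) :
    False := by
  set A : ℝ[X] := C t + r with hAdef
  set ψ : ℝ → ℝ := fun z => (X ^ ρ * A ^ m).eval z / h.eval z with hψ
  have hψ1 : ∀ z ∈ Set.Icc x y, (X ^ ρ * A ^ m - h).eval z = 0 → ψ z = 1 := by
    intro z hz hz0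
    rw [eval_sub, sub_eq_zero] at hz0
    rw [hψ]
    simp only
    rw [hz0, div_self (hh z hz)]
  have hder : ∀ z ∈ Set.Icc x y, HasDerivAt ψ (((X ^ ρ * A ^ m).derivative.eval z * h.eval z -
      (X ^ ρ * A ^ m).eval z * h.derivative.eval z) / h.eval z ^ 2) z := fun z hz =>
    ((X ^ ρ * A ^ m).hasDerivAt z).div (h.hasDerivAt z) (hh z hz)
  obtain ⟨z, hz, hz0⟩ := exists_hasDerivAt_eq_zero hxy
    (fun z hz => (hder z hz).continuousAt.continuousWithinAt)
    ((hψ1 x ⟨le_rfl, hxy.le⟩ hx).trans (hψ1 y ⟨hxy.le, le_rfl⟩ hy).symm)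
    (fun z hz => hder z (Set.Ioo_subset_Icc_self hz))
  have hzz := Set.Ioo_subset_Icc_self hz
  rw [div_eq_zero_iff, or_iff_left (pow_ne_zero _ (hh z hzz))] at hz0
  have hAz : A.eval z ≠ 0 := by simpa [hAdef] using hA z hz
  have hWz := hW z hz
  rw [show t + r.eval z = A.eval z by simp [hAdef]] at hWz
  have hAd : A.derivative = r.derivative := by simp [hAdef]
  have hkey : z ^ ρ * A.eval z ^ (m - 1) * (A.eval z * (z * h.derivative.eval z - ρ * h.eval z) -
      m * z * r.derivative.eval z * h.eval z) * A.eval z = 0 := by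
    have h1 : (X ^ ρ * A ^ m).derivative.eval z * z * A.eval z =
        z ^ ρ * A.eval z ^ m * (ρ * A.eval z + m * z * r.derivative.eval z) := by
      simp only [derivative_mul, derivative_pow, derivative_X, hAd]
      simp
      rcases Nat.eq_zero_or_pos ρ with hρ | hρ
      · subst hρ
        obtain ⟨k, rfl⟩ : ∃ k, m = k + 1 := ⟨m - 1, by omega⟩
        simp; ring
      · obtain ⟨e, rfl⟩ : ∃ e, ρ = e + 1 := ⟨ρ - 1, by omega⟩
        obtain ⟨k, rfl⟩ : ∃ k, m = k + 1 := ⟨m - 1, by omega⟩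
        simp; ring
    have h3 : (X ^ ρ * A ^ m).eval z = z ^ ρ * A.eval z ^ m := by simp
    rw [h3] at hz0
    obtain ⟨k, rfl⟩ : ∃ k, m = k + 1 := ⟨m - 1, by omega⟩
    simp only [Nat.add_sub_cancel]
    linear_combination (-z * A.eval z) * hz0 + h.eval z * h1
  rcases mul_eq_zero.mp hkey with h1 | h1
  · rcases mul_eq_zero.mp h1 with h2 | h2
    · exact (mul_ne_zero (pow_ne_zero _ (h0 z hzz)) (pow_ne_zero _ hAz)) h2
    · exact hWz (sub_eq_zero.mp h2)
  · exact hAz h1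

open Polynomial in
theorem Polynomial.exists_small_roots_unique {m ρ : ℕ} (hm : 0 < m) (hρ : 0 < ρ) (r h : ℝ[X])
    (h0 : h.eval 0 ≠ 0) : ∃ ε T : ℝ, 0 < ε ∧ ∀ t, T ≤ t → ∀ x y : ℝ, x < y → -ε < x → y < ε →
      0 < x * y → (X ^ ρ * (C t + r) ^ m - h).eval x = 0 →
      (X ^ ρ * (C t + r) ^ m - h).eval y = 0 → False := by
  set P : ℝ[X] := X * h.derivative - C (ρ : ℝ) * h with hP
  set M : ℝ[X] := C (m : ℝ) * X * r.derivative * h with hM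
  have hP0 : P.eval 0 ≠ 0 := by simp [hP, hρ.ne', h0]
  have hb : 0 < |P.eval 0| / 2 := by positivity
  have hev : ∀ᶠ z in nhds (0 : ℝ), h.eval z ≠ 0 ∧ |P.eval 0| / 2 < |P.eval z| ∧
      |M.eval z| < |M.eval 0| + 1 ∧ |r.eval z| < |r.eval 0| + 1 := by
    have hc : ∀ q : ℝ[X], ContinuousAt (fun z => |q.eval z|) 0 := fun q =>
      (q.continuous.abs).continuousAt
    refine (h.continuous.continuousAt.eventually_ne h0).and ?_
    refine ((hc P).eventually_const_lt (by linarith)).and ?_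
    exact ((hc M).eventually_lt_const (by linarith)).and ((hc r).eventually_lt_const (by linarith))
  obtain ⟨ε, hε, hball⟩ := Metric.eventually_nhds_iff.mp hev
  refine ⟨ε, |r.eval 0| + 1 + (|M.eval 0| + 1) / (|P.eval 0| / 2), hε,
    fun t ht x y hxy hx hy hpos hfx hfy => ?_⟩
  have hin : ∀ z ∈ Set.Icc x y, dist z 0 < ε := fun z hz => by
    rw [Real.dist_eq, sub_zero, abs_lt]
    exact ⟨by linarith [hz.1], by linarith [hz.2]⟩
  have hAge : ∀ z ∈ Set.Icc x y, (|M.eval 0| + 1) / (|P.eval 0| / 2) < t + r.eval z := fun z hz => by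
    have := (hball (hin z hz)).2.2.2
    have := (abs_lt.mp this).1
    linarith
  have hq : 0 < (|M.eval 0| + 1) / (|P.eval 0| / 2) := by positivity
  refine rolle_log hm r h t hxy ?_ (fun z hz => (hball (hin z hz)).1)
    (fun z hz => (hq.trans (hAge z (Set.Ioo_subset_Icc_self hz))).ne') ?_ hfx hfy
  · rintro z ⟨hz1, hz2⟩ rfl
    nlinarith
  · intro z hz heq
    have hzz := Set.Ioo_subset_Icc_self hz
    obtain ⟨-, h1, h2, -⟩ := hball (hin z hzz)
    have hA := hAge z hzz
    have heq' : (t + r.eval z) * P.eval z = M.eval z := by simpa [hP, hM] using heq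
    have h3 := congrArg abs heq'
    rw [abs_mul, abs_of_pos (hq.trans hA)] at h3
    have h4 : (|M.eval 0| + 1) / (|P.eval 0| / 2) * (|P.eval 0| / 2) <
        (t + r.eval z) * |P.eval z| := mul_lt_mul'' hA h1 hq.le hb.le
    rw [div_mul_cancel₀ _ hb.ne'] at h4
    linarith

open Polynomial in
theorem Polynomial.exists_large_roots {m g ρ : ℕ} (hm : 2 ≤ m) (hg : 0 < g) {r h : ℝ[X]}
    (hr : r.Monic) (hrg : r.natDegree = g) (hh : h.Monic) (hhd : h.natDegree = m * g + ρ)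
    (happ : (X ^ ρ * r ^ m - h).natDegree < ρ + (m - 1) * g) :
    ∃ R : ℝ, ∀ t, 1 ≤ t → (∀ x, (X ^ ρ * (C t + r) ^ m - h).eval x = 0 → x < R) ∧
      (Odd m → ∀ x, (X ^ ρ * (C t + r) ^ m - h).eval x = 0 → -R < x) ∧
      ∀ x y, x < y → y ≤ -R → (X ^ ρ * (C t + r) ^ m - h).eval x = 0 →
        (X ^ ρ * (C t + r) ^ m - h).eval y ≠ 0 := by
  obtain ⟨hd1, hl1⟩ := natDegree_X_pow_mul_add_pow_sub (by omega : 0 < m) hg hr hrg happ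
    (one_ne_zero (α := ℝ))
  have hm0 : (0 : ℝ) < m := by exact_mod_cast (by omega : 0 < m)
  obtain ⟨R1, hR1⟩ := eventually_pos_atTop (P := X ^ ρ * (C 1 + r) ^ m - h) (by rw [hl1, mul_one]; exact hm0)
  obtain ⟨R2, hR2⟩ := eventually_pos_atTop (P := r) (by rw [hr.leadingCoeff]; exact one_pos)
  have hsgn : ∀ k : ℕ, (0 : ℝ) < (-1) ^ k * (-1) ^ k := fun k => by
    rw [← mul_pow]; simp
  obtain ⟨R3, hR3⟩ := eventually_pos_atBot
    (P := C ((-1) ^ (ρ + (m - 1) * g)) * (X ^ ρ * (C 1 + r) ^ m - h)) (by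
      rw [natDegree_C_mul (by simp), hd1, leadingCoeff_mul, hl1, leadingCoeff_C, ← mul_assoc]
      exact mul_pos (hsgn _) (by rwa [mul_one]))
  obtain ⟨R4, hR4⟩ := eventually_pos_atBot (P := C ((-1) ^ g) * r) (by
      rw [natDegree_C_mul (by simp), hrg, leadingCoeff_mul, hr.leadingCoeff, leadingCoeff_C, mul_one]
      exact hsgn _)
  have hrc : r.derivative.coeff (g - 1) = g := by
    rw [coeff_derivative, Nat.sub_add_cancel hg, ← hrg, hr.coeff_natDegree, hrg, Nat.cast_sub hg]
    simp
  have hrd : r.derivative.natDegree = g - 1 := by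
    refine natDegree_eq_of_le_of_coeff_ne_zero ?_ (by rw [hrc]; exact_mod_cast hg.ne')
    exact (natDegree_derivative_le r).trans (by omega)
  have hrl : r.derivative.leadingCoeff = g := by rw [leadingCoeff, hrd, hrc]
  obtain ⟨R5, hR5⟩ := eventually_pos_atBot (P := C ((-1) ^ (g - 1)) * r.derivative) (by
      rw [natDegree_C_mul (by simp), hrd, leadingCoeff_mul, hrl, leadingCoeff_C, ← mul_assoc]
      exact mul_pos (hsgn _) (by exact_mod_cast hg))
  obtain ⟨R6, hR6⟩ := eventually_pos_atBot (P := C ((-1) ^ (m * g + ρ)) * h) (by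
      rw [natDegree_C_mul (by simp), hhd, leadingCoeff_mul, hh.leadingCoeff, leadingCoeff_C, mul_one]
      exact hsgn _)
  set P : ℝ[X] := X * h.derivative - C (ρ : ℝ) * h with hP
  have hmg : 0 < m * g := by positivity
  have hPc : P.coeff (m * g + ρ) = m * g := by
    rw [hP, coeff_sub, coeff_C_mul, show m * g + ρ = (m * g + ρ - 1) + 1 by omega, coeff_X_mul,
      coeff_derivative, show m * g + ρ - 1 + 1 = m * g + ρ by omega, ← hhd, hh.coeff_natDegree, hhd]
    push_cast [Nat.cast_sub (show 1 ≤ m * g + ρ by omega)]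
    ring
  have hmg' : (0 : ℝ) < m * g := by exact_mod_cast hmg
  have hPd : P.natDegree = m * g + ρ := by
    refine natDegree_eq_of_le_of_coeff_ne_zero ?_ (by rw [hPc]; exact hmg'.ne')
    rw [hP]
    refine (natDegree_sub_le _ _).trans (max_le ?_ ?_)
    · refine natDegree_mul_le.trans ?_
      have := natDegree_derivative_le h
      rw [natDegree_X]
      omega
    · exact (natDegree_C_mul_le _ _).trans hhd.le
  obtain ⟨R7, hR7⟩ := eventually_pos_atBot (P := C ((-1) ^ (m * g + ρ)) * P) (by
      rw [natDegree_C_mul (by simp), hPd, leadingCoeff_mul, leadingCoeff_C, leadingCoeff, hPd, hPc,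
        ← mul_assoc]
      exact mul_pos (hsgn _) hmg')
  set R := max 1 (max (max R1 R2) (max (max R3 R4) (max R5 (max R6 R7)))) with hR
  have hle : 1 ≤ R ∧ R1 ≤ R ∧ R2 ≤ R ∧ R3 ≤ R ∧ R4 ≤ R ∧ R5 ≤ R ∧ R6 ≤ R ∧ R7 ≤ R := by
    simp [hR]
  obtain ⟨hl0, hl1, hl2, hl3, hl4, hl5, hl6, hl7⟩ := hle
  have hev : ∀ t z : ℝ, (X ^ ρ * (C t + r) ^ m - h).eval z =
      z ^ ρ * (t + r.eval z) ^ m - h.eval z := fun t z => by simp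
  have hneg : ∀ t, 1 ≤ t → ∀ z, z ≤ -R → (X ^ ρ * (C t + r) ^ m - h).eval z = 0 →
      Even m ∧ Odd g ∧ 0 < t + r.eval z := by
    intro t ht z hz hf
    have hσ : 0 < (-1) ^ ρ * z ^ ρ := by
      rw [← mul_pow]
      exact pow_pos (by linarith) _
    have h3 := hR3 z (by linarith)
    rw [eval_C_mul, hev] at h3
    rw [hev] at hf
    have hf' : (-1) ^ ρ * h.eval z = (-1) ^ ρ * z ^ ρ * (t + r.eval z) ^ m := by
      linear_combination -(-1) ^ ρ * hf
    by_cases hpar : Odd m ∨ Even g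
    · exfalso
      have he : Even ((m - 1) * g) := by
        rcases hpar with h | h
        · exact (Nat.Odd.sub_odd h odd_one).mul_right g
        · exact h.mul_left _
      have hle : (1 + r.eval z) ^ m ≤ (t + r.eval z) ^ m := by
        rcases hpar with h | h
        · exact h.strictMono_pow.monotone (by linarith)
        · have h4 := hR4 z (by linarith)
          rw [h.neg_one_pow] at h4
          simp at h4
          exact pow_le_pow_left₀ (by linarith) (by linarith) m
      rw [pow_add, he.neg_one_pow, mul_one] at h3
      have := mul_le_mul_of_nonneg_left hle hσ.le
      linarith
    · rw [not_or, Nat.not_odd_iff_even, Nat.not_even_iff_odd] at hpar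
      refine ⟨hpar.1, hpar.2, ?_⟩
      by_contra! hA
      have ho : Odd ((m - 1) * g) :=
        (Nat.Even.sub_odd (by omega) hpar.1 odd_one).mul hpar.2
      have hle : (t + r.eval z) ^ m ≤ (1 + r.eval z) ^ m := by
        rw [← hpar.1.neg_pow, ← hpar.1.neg_pow (1 + r.eval z)]
        exact pow_le_pow_left₀ (by linarith) (by linarith) m
      rw [pow_add, ho.neg_one_pow] at h3
      have := mul_le_mul_of_nonneg_left hle hσ.le
      linarith
  refine ⟨R, fun t ht => ⟨fun x hx => ?_, fun hodd x hx => ?_, fun x y hxy hy hfx hfy => ?_⟩⟩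
  · by_contra! hxR
    have h1 := hR1 x (by linarith)
    have h2 := hR2 x (by linarith)
    rw [hev] at h1 hx
    have hxp : 0 < x ^ ρ := pow_pos (by linarith) _
    have := mul_le_mul_of_nonneg_left (pow_le_pow_left₀ (by linarith : 0 ≤ 1 + r.eval x)
      (by linarith : 1 + r.eval x ≤ t + r.eval x) m) hxp.le
    linarith
  · by_contra! hxR
    exact absurd (hneg t ht x hxR hx).1 (Nat.not_even_iff_odd.mpr hodd)
  · obtain ⟨hme, hgo, hA⟩ := hneg t ht x (by linarith) hfx
    have hrpos : ∀ z ≤ -R, 0 < r.derivative.eval z := fun z hz => by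
      have := hR5 z (by linarith)
      rw [(Nat.Odd.sub_odd hgo odd_one).neg_one_pow] at this
      simpa using this
    have hAz : ∀ z ∈ Set.Icc x y, 0 < t + r.eval z := fun z hz => by
      have hmono : MonotoneOn (fun z => r.eval z) (Set.Iic (-R)) := by
        refine monotoneOn_of_deriv_nonneg (convex_Iic _) r.continuous.continuousOn
          r.differentiable.differentiableOn fun w hw => ?_
        rw [interior_Iic] at hw
        rw [Polynomial.deriv]
        exact (hrpos w (Set.mem_Iio.mp hw).le).le
      have : r.eval x ≤ r.eval z := hmono (by simp; linarith) (by simp; linarith [hz.2]) hz.1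
      linarith
    refine rolle_log (by omega) r h t hxy (fun z hz => ?_) (fun z hz => ?_)
      (fun z hz => (hAz z (Set.Ioo_subset_Icc_self hz)).ne') (fun z hz => ?_) hfx hfy
    · have := hz.2
      exact (by linarith : z < 0).ne
    · have := hR6 z (by linarith [hz.2])
      intro h0
      simp [h0] at this
    · have hzR : z ≤ -R := by linarith [hz.2]
      have h6 := hR6 z (by linarith)
      have h7 := hR7 z (by linarith)
      rw [eval_C_mul] at h6 h7
      have hPe : P.eval z = z * h.derivative.eval z - ρ * h.eval z := by simp [hP]
      rw [← hPe]
      intro heq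
      have hL : 0 < (t + r.eval z) * ((-1) ^ (m * g + ρ) * P.eval z) :=
        mul_pos (hAz z (Set.Ioo_subset_Icc_self hz)) h7
      have hRr : 0 < m * (-z) * r.derivative.eval z * ((-1) ^ (m * g + ρ) * h.eval z) := by
        have := hrpos z hzR
        have : 0 < -z := by linarith
        positivity
      have : (t + r.eval z) * ((-1) ^ (m * g + ρ) * P.eval z) =
          -(m * (-z) * r.derivative.eval z * ((-1) ^ (m * g + ρ) * h.eval z)) := by
        linear_combination (-1) ^ (m * g + ρ) * heq
      linarith

open Polynomial in
/-- Bounds for the number of real roots of `X ^ ρ * (t + r) ^ m - h` for large `t`. -/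
theorem Polynomial.exists_card_real_roots_le {m g ρ : ℕ} (hm : 2 ≤ m) (hg : 0 < g) {r h : ℝ[X]}
    (hr : r.Monic) (hrg : r.natDegree = g) (hh : h.Monic) (hhd : h.natDegree = m * g + ρ)
    (happ : (X ^ ρ * r ^ m - h).natDegree < ρ + (m - 1) * g) (h0 : h.eval 0 ≠ 0) :
    ∃ R ε T : ℝ, 0 < ε ∧ ∀ t, T ≤ t → ∀ S : Finset ℝ,
      (∀ x ∈ S, (X ^ ρ * (C t + r) ^ m - h).eval x = 0) →
      (∀ x ∈ S, R < |x| ∨ (|x| < ε ∧ 0 < ρ)) →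
      S.card ≤ 3 ∧ (ρ = 0 → S.card ≤ 1) ∧ (Odd m → S.card ≤ 2) := by
  obtain ⟨R, hR⟩ := exists_large_roots hm hg hr hrg hh hhd happ
  obtain ⟨ε, T, hε, hT⟩ : ∃ ε T : ℝ, 0 < ε ∧ (0 < ρ → ∀ t, T ≤ t → ∀ x y : ℝ, x < y → -ε < x →
      y < ε → 0 < x * y → (X ^ ρ * (C t + r) ^ m - h).eval x = 0 →
      (X ^ ρ * (C t + r) ^ m - h).eval y = 0 → False) := by
    rcases Nat.eq_zero_or_pos ρ with h0' | h0'
    · exact ⟨1, 0, one_pos, fun h => absurd h0' h.ne'⟩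
    · obtain ⟨ε, T, h1, h2⟩ := exists_small_roots_unique (m := m) (by omega) h0' r h h0
      exact ⟨ε, T, h1, fun _ => h2⟩
  refine ⟨R, ε, max 1 T, hε, fun t ht S hS hloc => ?_⟩
  obtain ⟨hR1, hR2, hR3⟩ := hR t ((le_max_left _ _).trans ht)
  have hT' := fun hρ => hT hρ t ((le_max_right _ _).trans ht)
  set S1 := S.filter fun x => x ≤ -R
  set S2 := S.filter fun x => 0 < ρ ∧ |x| < ε ∧ x < 0
  set S3 := S.filter fun x => 0 < ρ ∧ |x| < ε ∧ 0 < x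
  have hsub : S ⊆ S1 ∪ (S2 ∪ S3) := by
    intro x hx
    simp only [Finset.mem_union, S1, S2, S3, Finset.mem_filter, hx, true_and]
    rcases hloc x hx with h | ⟨h, hρ⟩
    · left
      have := hR1 x (hS x hx)
      rcases lt_abs.mp h with h | h <;> linarith
    · right
      have hx0 : x ≠ 0 := by
        rintro rfl
        have := hS 0 hx
        simp [hρ.ne'] at this
        exact h0 this
      rcases lt_or_gt_of_ne hx0 with h' | h'
      · exact Or.inl ⟨hρ, h, h'⟩
      · exact Or.inr ⟨hρ, h, h'⟩
  have c1 : S1.card ≤ 1 := by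
    rw [Finset.card_le_one]
    intro x hx y hy
    rw [Finset.mem_filter] at hx hy
    by_contra hne
    rcases lt_or_gt_of_ne hne with h | h
    · exact hR3 x y h hy.2 (hS x hx.1) (hS y hy.1)
    · exact hR3 y x h hx.2 (hS y hy.1) (hS x hx.1)
  have c2 : S2.card ≤ 1 := by
    rw [Finset.card_le_one]
    intro x hx y hy
    rw [Finset.mem_filter, abs_lt] at hx hy
    by_contra hne
    have hpos := mul_pos_of_neg_of_neg hx.2.2.2 hy.2.2.2
    rcases lt_or_gt_of_ne hne with h | h
    · exact hT' hx.2.1 x y h hx.2.2.1.1 hy.2.2.1.2 hpos (hS x hx.1) (hS y hy.1)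
    · exact hT' hx.2.1 y x h hy.2.2.1.1 hx.2.2.1.2 (by linarith) (hS y hy.1) (hS x hx.1)
  have c3 : S3.card ≤ 1 := by
    rw [Finset.card_le_one]
    intro x hx y hy
    rw [Finset.mem_filter, abs_lt] at hx hy
    by_contra hne
    have hpos := mul_pos hx.2.2.2 hy.2.2.2
    rcases lt_or_gt_of_ne hne with h | h
    · exact hT' hx.2.1 x y h hx.2.2.1.1 hy.2.2.1.2 hpos (hS x hx.1) (hS y hy.1)
    · exact hT' hx.2.1 y x h hy.2.2.1.1 hx.2.2.1.2 (by linarith) (hS y hy.1) (hS x hx.1)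
  have hcard : S.card ≤ S1.card + (S2.card + S3.card) :=
    (Finset.card_le_card hsub).trans ((Finset.card_union_le _ _).trans
      (Nat.add_le_add_left (Finset.card_union_le _ _) _))
  refine ⟨by omega, fun hρ => ?_, fun hodd => ?_⟩
  · have h2 : S2 = ∅ := by simp [S2, hρ]
    have h3 : S3 = ∅ := by simp [S3, hρ]
    rw [h2, h3] at hcard
    simp at hcard
    omega
  · have h1 : S1 = ∅ := by
      rw [Finset.filter_eq_empty_iff]
      intro x hx
      exact not_le.mpr (hR2 hodd x (hS x hx))
    rw [h1] at hcard
    simp at hcard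
    omega

open Polynomial in
theorem Polynomial.exists_root_near (p : ℂ[X]) {z : ℂ} (hz : p.derivative.eval z ≠ 0) :
    ∃ x ∈ p.roots, ‖z - x‖ ≤ p.natDegree * (‖p.eval z‖ / ‖p.derivative.eval z‖) := by
  have hp : p ≠ 0 := by rintro rfl; simp at hz
  by_cases h0 : p.eval z = 0
  · exact ⟨z, (mem_roots hp).mpr h0, by simp [h0]⟩
  have hsum := (IsAlgClosed.splits p).eval_derivative_div_eval_of_ne_zero h0
  set a := ‖p.eval z‖ / ‖p.derivative.eval z‖ with ha
  have ha0 : 0 < a := div_pos (norm_pos_iff.mpr h0) (norm_pos_iff.mpr hz)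
  by_contra! hcon
  have hd : 0 < p.natDegree := by
    rcases Nat.eq_zero_or_pos p.natDegree with h | h
    · obtain ⟨c, rfl⟩ := natDegree_eq_zero.mp h
      simp at hz
    · exact h
  have hd' : (0 : ℝ) < p.natDegree := by exact_mod_cast hd
  have hcard : p.roots.card = p.natDegree := (IsAlgClosed.splits p).natDegree_eq_card_roots.symm
  have hne : p.roots ≠ 0 := by
    rw [← Multiset.card_pos, hcard]; exact hd
  have h1 : ‖p.derivative.eval z / p.eval z‖ < 1 / a := by
    rw [hsum]
    calc ‖(p.roots.map fun x => 1 / (z - x)).sum‖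
        ≤ ((p.roots.map fun x => 1 / (z - x)).map fun y => ‖y‖).sum := by
          exact Multiset.le_sum_of_subadditive _ (by simp) norm_add_le _
      _ < (p.roots.map fun _ => 1 / (p.natDegree * a)).sum := by
          rw [Multiset.map_map]
          refine Multiset.sum_lt_sum_of_nonempty hne fun x hx => ?_
          simp only [Function.comp, norm_div, norm_one]
          exact one_div_lt_one_div_of_lt (by positivity) (hcon x hx)
      _ = 1 / a := by
          rw [Multiset.map_const', Multiset.sum_replicate, hcard, nsmul_eq_mul]
          field_simp
  rw [norm_div, ha, one_div_div] at h1
  exact lt_irrefl _ h1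

open Polynomial in
theorem Polynomial.continuous_coeff_family {m ρ : ℕ} (r h : ℝ[X]) (i : ℕ) :
    Continuous fun t : ℝ => (X ^ ρ * (C t + r) ^ m - h).coeff i := by
  have : (fun t : ℝ => (X ^ ρ * (C t + r) ^ m - h).coeff i) = fun t =>
      ∑ j ∈ Finset.range (m + 1), t ^ j * (X ^ ρ * (r ^ (m - j) * C ((m.choose j : ℕ) : ℝ))).coeff i -
        h.coeff i := by
    funext t
    rw [coeff_sub, add_pow, Finset.mul_sum, finsetSum_coeff]
    congr 1
    refine Finset.sum_congr rfl fun j _ => ?_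
    rw [← coeff_C_mul, C_pow]
    congr 1
    simp
    ring
  rw [this]
  fun_prop

open Polynomial in
/-- Uniform control of coefficients and roots of the family on a compact parameter interval. -/
theorem Polynomial.exists_family_bounds {m g ρ : ℕ} (hm : 0 < m) (hg : 0 < g) {r h : ℝ[X]}
    (hr : r.Monic) (hrg : r.natDegree = g) (happ : (X ^ ρ * r ^ m - h).natDegree < ρ + (m - 1) * g)
    {T₁ T₂ : ℝ} (hT : 1 ≤ T₁) (hsep : ∀ t, T₁ ≤ t → ∀ x : ℂ,
      aeval x (X ^ ρ * (C t + r) ^ m - h) = 0 →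
        aeval x (X ^ ρ * (C t + r) ^ m - h).derivative ≠ 0) :
    ∃ M η L : ℝ, 1 ≤ M ∧ 0 < η ∧ 0 < L ∧ ∀ t ∈ Set.Icc T₁ T₂,
      (∀ i, |(X ^ ρ * (C t + r) ^ m - h).coeff i| ≤ M) ∧
      (∀ x : ℂ, aeval x (X ^ ρ * (C t + r) ^ m - h) = 0 → ‖x‖ ≤ M) ∧
      ∀ t' ∈ Set.Icc T₁ T₂, |t - t'| ≤ η → ∀ x' : ℂ, aeval x' (X ^ ρ * (C t' + r) ^ m - h) = 0 →
        ∃ x : ℂ, aeval x (X ^ ρ * (C t + r) ^ m - h) = 0 ∧ ‖x' - x‖ ≤ L * |t - t'| := by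
  set f : ℝ → ℝ[X] := fun t => X ^ ρ * (C t + r) ^ m - h with hf
  set d := ρ + (m - 1) * g with hd
  have hdeg : ∀ t ∈ Set.Icc T₁ T₂, (f t).natDegree = d ∧ (f t).leadingCoeff = m * t := fun t ht =>
    natDegree_X_pow_mul_add_pow_sub hm hg hr hrg happ (by linarith [ht.1])
  have hcoef : ∀ i, ∃ H : ℝ, ∀ t ∈ Set.Icc T₁ T₂, |(f t).coeff i| ≤ H := fun i =>
    isCompact_Icc.exists_bound_of_continuousOn (continuous_coeff_family r h i).continuousOn
  choose H hH using hcoef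
  set M₀ : ℝ := 1 + ∑ i ∈ Finset.range (d + 1), |H i| with hM₀
  have hM₀1 : 1 ≤ M₀ := by
    have : 0 ≤ ∑ i ∈ Finset.range (d + 1), |H i| := Finset.sum_nonneg fun _ _ => abs_nonneg _
    linarith
  have hcM : ∀ t ∈ Set.Icc T₁ T₂, ∀ i, |(f t).coeff i| ≤ M₀ := by
    intro t ht i
    rcases le_or_gt i d with hi | hi
    · have h1 : |H i| ≤ ∑ i ∈ Finset.range (d + 1), |H i| :=
        Finset.single_le_sum (f := fun i => |H i|) (s := Finset.range (d + 1))
          (fun _ _ => abs_nonneg _) (Finset.mem_range.mpr (Nat.lt_succ_of_le hi))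
      linarith [hH i t ht, le_abs_self (H i)]
    · rw [coeff_eq_zero_of_natDegree_lt (by rw [(hdeg t ht).1]; exact hi)]
      simp; linarith
  have hroot : ∀ t ∈ Set.Icc T₁ T₂, ∀ x : ℂ, aeval x (f t) = 0 → ‖x‖ ≤ M₀ + 1 := by
    intro t ht x hx
    have hm1 : (1 : ℝ) ≤ m := by exact_mod_cast hm
    have ht1 : 1 ≤ t := hT.trans ht.1
    have hmt : 1 ≤ (m : ℝ) * t := by nlinarith
    have hl : (f t).leadingCoeff ≠ 0 := by
      rw [(hdeg t ht).2]; linarith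
    set p : ℂ[X] := (f t).map (algebraMap ℝ ℂ) with hp
    have hp0 : p ≠ 0 := by
      rw [hp, Polynomial.map_ne_zero_iff (algebraMap ℝ ℂ).injective]
      exact leadingCoeff_ne_zero.mp hl
    have hpr : p.IsRoot x := by rw [IsRoot, hp, eval_map_algebraMap, hx]
    have hpl : 1 ≤ ‖p.leadingCoeff‖₊ := by
      rw [← NNReal.coe_le_coe, coe_nnnorm, hp, leadingCoeff_map, (hdeg t ht).2]
      rw [Complex.coe_algebraMap, Complex.norm_real, Real.norm_eq_abs, NNReal.coe_one]
      exact hmt.trans (le_abs_self _)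
    have hsup : (Finset.range p.natDegree).sup (‖p.coeff ·‖₊) ≤ M₀.toNNReal := by
      refine Finset.sup_le fun i _ => ?_
      rw [← NNReal.coe_le_coe, coe_nnnorm, Real.coe_toNNReal _ (by linarith), hp, coeff_map,
        Complex.coe_algebraMap, Complex.norm_real]
      exact hcM t ht i
    have h1 : ‖x‖₊ ≤ M₀.toNNReal + 1 := by
      refine (hpr.norm_lt_cauchyBound hp0).le.trans ?_
      unfold cauchyBound
      gcongr
      exact (div_le_self (zero_le) hpl).trans hsup
    have h2 := NNReal.coe_le_coe.mpr h1
    rwa [coe_nnnorm, NNReal.coe_add, Real.coe_toNNReal _ (by linarith), NNReal.coe_one] at h2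
  have hev : ∀ t (x : ℂ), aeval x (f t) = x ^ ρ * ((t : ℂ) + aeval x r) ^ m - aeval x h := by
    intro t x; simp [hf]
  have hev' : ∀ t (x : ℂ), aeval x (f t).derivative =
      (ρ : ℂ) * x ^ (ρ - 1) * ((t : ℂ) + aeval x r) ^ m +
        x ^ ρ * ((m : ℂ) * ((t : ℂ) + aeval x r) ^ (m - 1) * aeval x r.derivative) -
          aeval x h.derivative := by
    intro t x; simp [hf, derivative_pow]
  have hcr : ∀ q : ℝ[X], Continuous fun x : ℂ => aeval x q := fun q => q.continuous_aeval
  obtain ⟨c, hc0, hc⟩ := (isCompact_Icc.prod (isCompact_closedBall (0 : ℂ) (M₀ + 1))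
      (s := Set.Icc T₁ T₂)).exists_forall_le'
    (f := fun z : ℝ × ℂ => ‖aeval z.2 (f z.1)‖ + ‖aeval z.2 (f z.1).derivative‖) (a := 0) (by
      apply Continuous.continuousOn
      simp_rw [hev, hev']
      have h1 : Continuous fun z : ℝ × ℂ => ((z.1 : ℝ) : ℂ) :=
        Complex.continuous_ofReal.comp continuous_fst
      have h2 := fun q => (hcr q).comp (continuous_snd : Continuous fun z : ℝ × ℂ => z.2)
      simp only [Function.comp_def] at h2
      have h3 := h2 r
      have h4 := h2 h
      have h5 := h2 r.derivative
      have h6 := h2 h.derivative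
      fun_prop) (by
      rintro ⟨t, x⟩ ⟨ht, hx⟩
      by_cases h0 : aeval x (f t) = 0
      · have := norm_pos_iff.mpr (hsep t ht.1 x h0)
        positivity
      · have := norm_pos_iff.mpr h0
        positivity)
  obtain ⟨B, hB⟩ := (((isCompact_Icc (a := T₁) (b := T₂)).prod (isCompact_Icc (a := T₁) (b := T₂))).prod
      (isCompact_closedBall (0 : ℂ) (M₀ + 1))).exists_bound_of_continuousOn
    (f := fun z : (ℝ × ℝ) × ℂ => z.2 ^ ρ * ∑ i ∈ Finset.range m,
      ((z.1.1 : ℂ) + aeval z.2 r) ^ i * ((z.1.2 : ℂ) + aeval z.2 r) ^ (m - 1 - i)) (by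
      apply Continuous.continuousOn
      have h3 := (hcr r).comp (continuous_snd : Continuous fun z : (ℝ × ℝ) × ℂ => z.2)
      simp only [Function.comp_def] at h3
      have h1 : Continuous fun z : (ℝ × ℝ) × ℂ => ((z.1.1 : ℝ) : ℂ) :=
        Complex.continuous_ofReal.comp (by fun_prop)
      have h2 : Continuous fun z : (ℝ × ℝ) × ℂ => ((z.1.2 : ℝ) : ℂ) :=
        Complex.continuous_ofReal.comp (by fun_prop)
      fun_prop)
  have hlip : ∀ t ∈ Set.Icc T₁ T₂, ∀ t' ∈ Set.Icc T₁ T₂, ∀ x : ℂ, ‖x‖ ≤ M₀ + 1 →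
      ‖aeval x (f t) - aeval x (f t')‖ ≤ (|B| + 1) * |t - t'| := by
    intro t ht t' ht' x hx
    have h1 := hB ((t, t'), x) ⟨⟨ht, ht'⟩, by simpa using hx⟩
    have h2 : aeval x (f t) - aeval x (f t') = (x ^ ρ * ∑ i ∈ Finset.range m,
      ((t : ℂ) + aeval x r) ^ i * ((t' : ℂ) + aeval x r) ^ (m - 1 - i)) * ((t - t' : ℝ) : ℂ) := by
      rw [hev, hev, mul_assoc]
      have h3 := geom_sum₂_mul ((t : ℂ) + aeval x r) ((t' : ℂ) + aeval x r) m
      rw [show ((t - t' : ℝ) : ℂ) = ((t : ℂ) + aeval x r) - ((t' : ℂ) + aeval x r) by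
        push_cast; ring, h3]
      ring
    rw [h2, norm_mul, Complex.norm_real, Real.norm_eq_abs]
    gcongr
    exact h1.trans ((le_abs_self B).trans (by linarith))
  set L₀ := |B| + 1 with hL₀
  have hL₀0 : 0 < L₀ := by positivity
  refine ⟨M₀ + 1, c / 2 / L₀, (d + 1) * (L₀ / (c / 2)), by linarith, by positivity, by positivity,
    fun t ht => ⟨fun i => (hcM t ht i).trans (by linarith), hroot t ht, ?_⟩⟩
  intro t' ht' htt x' hx'
  have hx'M := hroot t' ht' x' hx'
  have h1 : ‖aeval x' (f t)‖ ≤ L₀ * |t - t'| := by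
    have := hlip t ht t' ht' x' hx'M
    rwa [hx', sub_zero] at this
  have h2 : ‖aeval x' (f t)‖ ≤ c / 2 := by
    refine h1.trans ?_
    rw [le_div_iff₀ hL₀0] at htt
    linarith
  have h3 : c / 2 ≤ ‖aeval x' (f t).derivative‖ := by
    have := hc (t, x') ⟨ht, by simpa using hx'M⟩
    simp only at this
    linarith
  have hder : ((f t).map (algebraMap ℝ ℂ)).derivative.eval x' = aeval x' (f t).derivative := by
    rw [derivative_map, eval_map_algebraMap]
  obtain ⟨x, hx, hxx⟩ := exists_root_near ((f t).map (algebraMap ℝ ℂ)) (z := x') (by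
    rw [hder, ← norm_pos_iff]; linarith)
  refine ⟨x, ?_, hxx.trans ?_⟩
  · have := (mem_roots'.mp hx).2
    rwa [IsRoot, eval_map_algebraMap] at this
  · rw [hder, eval_map_algebraMap, natDegree_map, (hdeg t ht).1]
    calc (d : ℝ) * (‖aeval x' (f t)‖ / ‖aeval x' (f t).derivative‖)
        ≤ (d + 1) * ((L₀ * |t - t'|) / (c / 2)) := by
          gcongr
          linarith
      _ = _ := by ring

open Polynomial in
/-- For a large parameter the roots of the family are simple, are either large or small, and few
of them are real. -/
theorem Polynomial.exists_family_roots {m g ρ : ℕ} (hm : 2 ≤ m) (hg : 0 < g) {r h : ℝ[X]}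
    (hr : r.Monic) (hrg : r.natDegree = g) (hh : h.Monic) (hhd : h.natDegree = m * g + ρ)
    (happ : (X ^ ρ * r ^ m - h).natDegree < ρ + (m - 1) * g)
    (hroots : ∀ x : ℂ, aeval x h = 0 → 1 ≤ ‖x‖) {c : ℝ} (hc : h.eval c = 0)
    (hc' : h.derivative.eval c ≠ 0) (R₀ ε₀ : ℝ) (hε₀ : 0 < ε₀) :
    ∃ T : ℝ, 1 ≤ T ∧ ∀ t, T ≤ t →
      (∀ x : ℂ, aeval x (X ^ ρ * (C t + r) ^ m - h) = 0 → R₀ < ‖x‖ ∨ (‖x‖ < ε₀ ∧ 0 < ρ)) ∧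
      (∀ x : ℂ, aeval x (X ^ ρ * (C t + r) ^ m - h) = 0 →
        aeval x (X ^ ρ * (C t + r) ^ m - h).derivative ≠ 0) ∧
      ∀ S : Finset ℝ, (∀ x ∈ S, (X ^ ρ * (C t + r) ^ m - h).eval x = 0) →
        S.card ≤ 3 ∧ (ρ = 0 → S.card ≤ 1) ∧ (Odd m → S.card ≤ 2) := by
  have hev : ∀ x : ℝ, aeval (x : ℂ) h = ((h.eval x : ℝ) : ℂ) := fun x => by
    rw [← Complex.coe_algebraMap, aeval_algebraMap_apply]; simp
  have h0 : h.eval 0 ≠ 0 := by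
    intro h0
    have := hroots ((0 : ℝ) : ℂ) (by rw [hev, h0]; simp)
    norm_num at this
  have hc0 : c ≠ 0 := by rintro rfl; exact h0 hc
  obtain ⟨R₁, ε₁, T₁, hε₁, hcard⟩ := exists_card_real_roots_le hm hg hr hrg hh hhd happ h0
  obtain ⟨S, hS⟩ := exists_double_root_avoid (ρ := ρ) hm r h hc0 hc hc'
  set U : Finset ℂ := S ∪ (h.map (algebraMap ℝ ℂ)).roots.toFinset with hU
  set R : ℝ := max (max R₀ R₁) 0 + ∑ x ∈ U, ‖x‖ with hR
  have hsum : ∀ x ∈ U, ‖x‖ ≤ ∑ x ∈ U, ‖x‖ := fun x hx =>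
    Finset.single_le_sum (f := fun x : ℂ => ‖x‖) (fun _ _ => norm_nonneg _) hx
  have hsum0 : 0 ≤ ∑ x ∈ U, ‖x‖ := Finset.sum_nonneg fun _ _ => norm_nonneg _
  obtain ⟨ε₂, hε₂, hε₂S⟩ : ∃ ε₂ : ℝ, 0 < ε₂ ∧ ∀ x ∈ S, x ≠ 0 → ε₂ ≤ ‖x‖ := by
    clear_value U
    clear hsum hsum0 hS hR hU
    induction S using Finset.induction_on with
    | empty => exact ⟨1, one_pos, by simp⟩
    | insert a S ha ih =>
      obtain ⟨ε, hε, h⟩ := ih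
      by_cases h0 : a = 0
      · refine ⟨ε, hε, fun x hx hx0 => ?_⟩
        rcases Finset.mem_insert.mp hx with rfl | hx
        · exact absurd h0 hx0
        · exact h x hx hx0
      · refine ⟨min ε ‖a‖, lt_min hε (norm_pos_iff.mpr h0), fun x hx hx0 => ?_⟩
        rcases Finset.mem_insert.mp hx with rfl | hx
        · exact min_le_right _ _
        · exact (min_le_left _ _).trans (h x hx hx0)
  set ε : ℝ := min (min ε₀ ε₁) (min ε₂ 1) with hε
  have hε0 : 0 < ε := lt_min (lt_min hε₀ hε₁) (lt_min hε₂ one_pos)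
  obtain ⟨T, hT⟩ := exists_root_location (m := m) (ρ := ρ) (by omega) r h R ε hε0
  refine ⟨max (max T T₁) 1, le_max_right _ _, fun t ht => ?_⟩
  have htT : T ≤ t := (le_max_left _ _).trans ((le_max_left _ _).trans ht)
  have htT₁ : T₁ ≤ t := (le_max_right _ _).trans ((le_max_left _ _).trans ht)
  have hloc := hT t htT
  refine ⟨fun x hx => ?_, fun x hx hx' => ?_, fun A hA => hcard t htT₁ A hA fun x hx => ?_⟩
  · rcases hloc x hx with h1 | ⟨h1, h2⟩
    · exact .inl (lt_of_le_of_lt (by linarith [le_max_left R₀ R₁, le_max_left (max R₀ R₁) 0]) h1)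
    · exact .inr ⟨h1.trans_le ((min_le_left _ _).trans (min_le_left _ _)), h2⟩
  · have hxh : aeval x h ≠ 0 := by
      intro hxh
      have hxU : x ∈ U := by
        rw [hU, Finset.mem_union, Multiset.mem_toFinset, mem_roots (hh.map _).ne_zero, IsRoot,
          eval_map_algebraMap]
        exact .inr hxh
      rcases hloc x hx with h1 | ⟨h1, -⟩
      · have := hsum x hxU
        linarith [le_max_right (max R₀ R₁) 0]
      · linarith [hroots x hxh, min_le_right ε₂ 1, min_le_right (min ε₀ ε₁) (min ε₂ 1)]
    have hxS := hS t x hx hxh hx'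
    rcases hloc x hx with h1 | ⟨h1, h2⟩
    · have := hsum x (Finset.mem_union_left _ hxS)
      linarith [le_max_right (max R₀ R₁) 0]
    · have hx0 : x ≠ 0 := by
        rintro rfl
        apply hxh
        simpa [h2.ne'] using hx
      linarith [hε₂S x hxS hx0, min_le_left ε₂ 1, min_le_right (min ε₀ ε₁) (min ε₂ 1)]
  · have hx' : aeval (x : ℂ) (X ^ ρ * (C t + r) ^ m - h) = 0 := by
      rw [← Complex.coe_algebraMap, aeval_algebraMap_apply, coe_aeval_eq_eval, hA x hx, map_zero]
    have := hloc x hx'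
    rw [Complex.norm_real, Real.norm_eq_abs] at this
    rcases this with h1 | ⟨h1, h2⟩
    · exact .inl (lt_of_le_of_lt (by linarith [le_max_right R₀ R₁, le_max_left (max R₀ R₁) 0]) h1)
    · exact .inr ⟨h1.trans_le ((min_le_left _ _).trans (min_le_right _ _)), h2⟩

theorem Multiset.pow_card_le_norm_prod (t : Multiset ℂ) {a : ℝ} (ha : 0 ≤ a)
    (h : ∀ x ∈ t, a ≤ ‖x‖) : a ^ t.card ≤ ‖t.prod‖ := by
  induction t using Multiset.induction_on with
  | empty => simp
  | cons x t ih =>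
    rw [Multiset.card_cons, Multiset.prod_cons, norm_mul, pow_succ']
    exact mul_le_mul (h x (Multiset.mem_cons_self x t))
      (ih fun y hy => h y (Multiset.mem_cons_of_mem hy)) (by positivity) (norm_nonneg _)

theorem Multiset.norm_prod_le_of_mem {t : Multiset ℂ} {x : ℂ} (hx : x ∈ t)
    (h : ∀ x ∈ t, ‖x‖ ≤ 1) : ‖t.prod‖ ≤ ‖x‖ := by
  obtain ⟨u, rfl⟩ := Multiset.exists_cons_of_mem hx
  rw [Multiset.prod_cons, norm_mul]
  refine mul_le_of_le_one_right (norm_nonneg _) ?_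
  have hu : ∀ y ∈ u, ‖y‖ ≤ 1 := fun y hy => h y (Multiset.mem_cons_of_mem hy)
  clear h hx
  induction u using Multiset.induction_on with
  | empty => simp
  | cons y u ih =>
    rw [Multiset.prod_cons, norm_mul]
    exact mul_le_one₀ (hu y (Multiset.mem_cons_self y u)) (norm_nonneg _)
      (ih fun z hz => hu z (Multiset.mem_cons_of_mem hz))

open Polynomial in
theorem Polynomial.eval_zero_eq_zero_of_abs_eval_one_le {f : ℤ[X]} (hd : 0 < f.natDegree) {D A : ℕ}
    (hD : f.natDegree ≤ D) (hA : 0 < A) (h1 : |f.eval 1| ≤ A)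
    (hroots : ∀ x : ℂ, aeval x f = 0 → 2 ^ D * A + 1 < ‖x‖ ∨ ‖x‖ * (2 ^ D * A) < 1) :
    f.eval 0 = 0 := by
  set p : ℂ[X] := f.map (Int.castRingHom ℂ) with hp
  have hf0 : f ≠ 0 := by rintro rfl; simp at hd
  have hinj : Function.Injective (Int.castRingHom ℂ) := Int.cast_injective
  have hp0 : p ≠ 0 := (Polynomial.map_ne_zero_iff hinj).mpr hf0
  have hpd : p.natDegree = f.natDegree := natDegree_map_eq_of_injective hinj f
  have hcard : p.roots.card = f.natDegree :=
    (IsAlgClosed.splits p).natDegree_eq_card_roots.symm.trans hpd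
  have hlc : p.leadingCoeff = f.leadingCoeff := by
    rw [hp, leadingCoeff_map_of_injective hinj]; simp
  have hlc1 : (1 : ℝ) ≤ ‖(f.leadingCoeff : ℂ)‖ := by
    rw [Complex.norm_intCast]
    exact_mod_cast Int.one_le_abs (leadingCoeff_ne_zero.mpr hf0)
  have hev : ∀ a : ℤ, ((f.eval a : ℤ) : ℂ) =
      f.leadingCoeff * (p.roots.map fun x => (a : ℂ) - x).prod := by
    intro a
    rw [← hlc, ← (IsAlgClosed.splits p).eval_eq_prod_roots, hp, eval_intCast_map]
    simp
  have hA1 : (1 : ℝ) ≤ A := by exact_mod_cast hA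
  have hD1 : 1 ≤ D := by omega
  have hDA : (2 : ℝ) ≤ 2 ^ D * A := by
    have : (2 : ℝ) ^ 1 ≤ 2 ^ D := pow_le_pow_right₀ (by norm_num) hD1
    nlinarith
  have hr : ∀ x ∈ p.roots, 2 ^ D * A + 1 < ‖x‖ ∨ ‖x‖ * (2 ^ D * A) < 1 := by
    intro x hx
    apply hroots
    have := (mem_roots'.mp hx).2
    rwa [IsRoot, hp, eval_map] at this
  have hhalf : ∀ y ∈ p.roots.map fun x => (1 : ℂ) - x, (1 / 2 : ℝ) ≤ ‖y‖ := by
    intro y hy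
    obtain ⟨x, hx, rfl⟩ := Multiset.mem_map.mp hy
    rcases hr x hx with h | h
    · have := norm_sub_norm_le x 1
      rw [norm_sub_rev, norm_one] at this
      linarith
    · have := norm_sub_norm_le 1 x
      rw [norm_one] at this
      have h2 : ‖x‖ * 2 ≤ ‖x‖ * (2 ^ D * A) := by gcongr
      linarith
  have h1' : ‖(f.leadingCoeff : ℂ)‖ * ‖(p.roots.map fun x => (1 : ℂ) - x).prod‖ ≤ A := by
    rw [← norm_mul, ← Int.cast_one, ← hev, Complex.norm_intCast]
    exact_mod_cast h1
  have hpow : ∀ k ≤ D, (1 / 2 : ℝ) ^ D ≤ (1 / 2) ^ k := fun k hk =>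
    pow_le_pow_of_le_one (by norm_num) (by norm_num) hk
  have hsmall : ∀ x ∈ p.roots, ‖x‖ * (2 ^ D * A) < 1 := by
    intro x hx
    refine (hr x hx).resolve_left fun hlarge => ?_
    obtain ⟨u, hu⟩ := Multiset.exists_cons_of_mem hx
    have hux := hhalf
    rw [hu, Multiset.map_cons] at h1' hux
    rw [Multiset.prod_cons, norm_mul] at h1'
    have h2 := Multiset.pow_card_le_norm_prod (u.map fun x => (1 : ℂ) - x) (a := 1 / 2) (by norm_num)
      fun y hy => hux y (Multiset.mem_cons_of_mem hy)
    have h3 : u.card ≤ D := by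
      have : p.roots.card = u.card + 1 := by rw [hu, Multiset.card_cons]
      omega
    rw [Multiset.card_map] at h2
    have h4 := (hpow _ h3).trans h2
    have h5 : 2 ^ D * (A : ℝ) < ‖1 - x‖ := by
      have := norm_sub_norm_le x 1
      rw [norm_sub_rev, norm_one] at this
      linarith
    have h6 : (2 ^ D * (A : ℝ)) * (1 / 2) ^ D = A := by
      rw [one_div, inv_pow]; field_simp
    have h7 : (2 ^ D * (A : ℝ)) * (1 / 2) ^ D < ‖1 - x‖ * ‖(u.map fun x => (1 : ℂ) - x).prod‖ :=
      mul_lt_mul h5 h4 (by positivity) (by positivity)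
    nlinarith [norm_nonneg (1 - x), norm_nonneg (u.map fun x => (1 : ℂ) - x).prod]
  have hlcA : ‖(f.leadingCoeff : ℂ)‖ ≤ 2 ^ D * A := by
    have h2 := Multiset.pow_card_le_norm_prod _ (by norm_num) hhalf
    rw [Multiset.card_map, hcard] at h2
    have h4 := (hpow _ hD).trans h2
    have h5 : ‖(f.leadingCoeff : ℂ)‖ * (1 / 2) ^ D ≤ A := (by gcongr : _ ≤ _).trans h1'
    rw [one_div, inv_pow, ← div_eq_mul_inv, div_le_iff₀ (by positivity)] at h5
    linarith
  obtain ⟨x, hx⟩ : ∃ x, x ∈ p.roots := Multiset.card_pos_iff_exists_mem.mp (by omega)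
  have h8 : ‖(p.roots.map fun x => ((0 : ℤ) : ℂ) - x).prod‖ ≤ ‖x‖ := by
    have := Multiset.norm_prod_le_of_mem (t := p.roots.map fun x => ((0 : ℤ) : ℂ) - x)
      (x := ((0 : ℤ) : ℂ) - x) (Multiset.mem_map_of_mem _ hx) (by
        intro y hy
        obtain ⟨z, hz, rfl⟩ := Multiset.mem_map.mp hy
        have := hsmall z hz
        simp only [Int.cast_zero, zero_sub, norm_neg]
        nlinarith [norm_nonneg z])
    simpa using this
  have h9 : ‖((f.eval 0 : ℤ) : ℂ)‖ < 1 := by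
    rw [hev, norm_mul]
    calc _ ≤ (2 ^ D * (A : ℝ)) * ‖x‖ := by gcongr
      _ < 1 := by linarith [hsmall x hx]
  rw [Complex.norm_intCast] at h9
  exact Int.abs_lt_one_iff.mp (by exact_mod_cast h9)

open Polynomial in
theorem Polynomial.irreducible_map_of_roots {F : ℤ[X]} (hd : 0 < F.natDegree) {p k A : ℕ}
    (hp : p.Prime) (hA : 0 < A) (h1 : F.eval 1 = (p : ℤ) ^ k * A)
    (h2 : ¬ (p : ℤ) ∣ F.derivative.eval 1) (h0 : F.eval 0 ≠ 0)
    (hroots : ∀ x : ℂ, aeval x F = 0 →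
      2 ^ F.natDegree * A + 1 < ‖x‖ ∨ ‖x‖ * (2 ^ F.natDegree * A) < 1) :
    Irreducible (F.map (Int.castRingHom ℚ)) := by
  have hF0 : F ≠ 0 := by rintro rfl; simp at hd
  have hpZ : Prime (p : ℤ) := Nat.prime_iff_prime_int.mp hp
  have key : ∀ f f' : ℤ[X], F = f * f' → 0 < f.natDegree → ¬ (p : ℤ) ∣ f.eval 1 → False := by
    intro f f' hff hfd hpf
    have hdvd : f.eval 1 ∣ (p : ℤ) ^ k * A := ⟨f'.eval 1, by rw [← h1, hff, eval_mul]⟩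
    have hcop : IsCoprime (f.eval 1) ((p : ℤ) ^ k) :=
      ((hpZ.coprime_iff_not_dvd.mpr hpf).symm).pow_right
    have hA' := hcop.dvd_of_dvd_mul_left hdvd
    have hf'0 : f' ≠ 0 := by rintro rfl; simp [hff] at hF0
    have hf0 : f ≠ 0 := by rintro rfl; simp [hff] at hF0
    have hdeg : f.natDegree ≤ F.natDegree := by
      rw [hff, natDegree_mul hf0 hf'0]; omega
    have := eval_zero_eq_zero_of_abs_eval_one_le hfd hdeg hA
      (by have := Int.le_of_dvd (by exact_mod_cast hA) ((abs_dvd _ _).mpr hA'); exact this)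
      (fun x hx => hroots x (by rw [hff, map_mul, hx, zero_mul]))
    exact h0 (by rw [hff, eval_mul, this, zero_mul])
  have hc0 : F.content ≠ 0 := content_eq_zero_iff.not.mpr hF0
  have hG : Irreducible F.primPart := by
    refine ⟨fun hu => ?_, fun {a b} hab => ?_⟩
    · have := natDegree_eq_zero_of_isUnit hu
      rw [natDegree_primPart] at this
      omega
    have hG0 : F.primPart ≠ 0 := F.primPart_ne_zero
    have hFab : F = (C F.content * a) * b := by
      rw [mul_assoc, ← hab]; exact F.eq_C_content_mul_primPart
    have hprim := F.isPrimitive_primPart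
    by_contra! hcon
    have hunit : ∀ q : ℤ[X], q ∣ F.primPart → ¬ IsUnit q → 0 < q.natDegree := by
      intro q hq hqu
      by_contra! h
      obtain ⟨c, rfl⟩ := natDegree_eq_zero.mp (Nat.le_zero.mp h)
      exact hqu (isUnit_C.mpr (hprim c hq))
    have ha := hunit a ⟨b, hab⟩ hcon.1
    have hb := hunit b ⟨a, by rw [hab, mul_comm]⟩ hcon.2
    by_cases hpb : (p : ℤ) ∣ b.eval 1
    · by_cases hpa : (p : ℤ) ∣ (C F.content * a).eval 1
      · apply h2
        rw [hFab, derivative_mul, eval_add, eval_mul, eval_mul]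
        exact dvd_add (hpb.mul_left _) (hpa.mul_right _)
      · exact key _ _ hFab (by rw [natDegree_C_mul hc0]; exact ha) hpa
    · exact key b (C F.content * a) (by rw [mul_comm]; exact hFab) hb hpb
  have hG' := (IsPrimitive.Int.irreducible_iff_irreducible_map_cast F.isPrimitive_primPart).mp hG
  have hu : IsUnit (C (F.content : ℚ) : ℚ[X]) := isUnit_C.mpr (by simpa using hc0)
  rw [F.eq_C_content_mul_primPart, Polynomial.map_mul, map_C]
  exact (irreducible_isUnit_mul hu).mpr hG'

open Polynomial in
/-- The integral data from which a family of number fields whose class groups have large `m`-rank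
is built. -/
structure RankDesign (m g ρ : ℕ) where
  b : ℕ → ℕ
  Q : ℕ
  Z : ℕ
  E : ℕ
  B : ℕ
  r : ℤ[X]
  one_lt : 1 < m
  one_lt_g : 1 < g
  b_zero : b 0 = 1
  b_pos : ∀ i, 0 < b i
  one_lt_Q : 1 < Q
  coprime_Q_Z : IsCoprime (Q : ℤ) Z
  pow_ne : ∀ i < m * g + ρ, ∀ j < m * g + ρ, i ≠ j → b i ^ m ≠ b j ^ m
  exists_prime : ∀ k : Fin (m * g + ρ - 2), ∀ l : ℕ, l.Prime → l ∣ m → ∃ q : ℕ, q ∣ Q ∧ q.Prime ∧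
    m ∣ q - 1 ∧ (∀ j : Fin (m * g + ρ - 2), j ≠ k → ∃ y : ZMod q,
      (1 - (b (j + 2) : ZMod q) ^ m) = y ^ m * (1 - (b 1 : ZMod q) ^ m)) ∧
    ∀ y : ZMod q, (1 - (b (k + 2) : ZMod q) ^ m) ≠ y ^ l * (1 - (b 1 : ZMod q) ^ m)
  Z_pos : 0 < Z
  E_dvd : E ∣ Z
  m_dvd : m ∣ Z
  b_dvd : ∀ i < m * g + ρ, b i ^ m ∣ Z
  sub_dvd : ∀ i < m * g + ρ, ∀ j < m * g + ρ, i ≠ j → ((b i : ℤ) ^ m - (b j : ℤ) ^ m) ∣ Z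
  E_mul_B : E * B = Z ^ (ρ + 2)
  r_natDegree : r.natDegree = g
  r_leadingCoeff : r.leadingCoeff = E
  r_approx : (X ^ ρ * r ^ m - C ((E : ℤ) ^ m) *
    ∏ i ∈ Finset.range (m * g + ρ), (X - C ((b i : ℤ) ^ m))).natDegree < ρ + (m - 1) * g

theorem IsCoprime.natAbs_right {a b : ℤ} (h : IsCoprime a b) : IsCoprime a (b.natAbs : ℤ) := by
  rcases Int.natAbs_eq b with hb | hb
  · rwa [← hb]
  · rw [hb] at h
    simpa using h.neg_right

open Polynomial in
theorem RankDesign.nonempty {m g ρ : ℕ} (hm : 1 < m) (hg : 1 < g) :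
    Nonempty (RankDesign m g ρ) := by
  have hmg : 4 ≤ m * g := Nat.mul_le_mul hm hg
  obtain ⟨b, Q, hQ, hb0, hbpos, hQm, hQb, hQs, hne, hloc⟩ :=
    exists_pow_family_of_modulus (T := m * g + ρ - 2) hm (by omega)
  set n := m * g + ρ with hn
  have hle : ∀ i < n, i ≤ n - 2 + 1 := fun i hi => by omega
  set h : ℤ[X] := ∏ i ∈ Finset.range n, (X - C ((b i : ℤ) ^ m)) with hh
  have hmon : h.Monic := monic_prod_of_monic _ _ fun i _ => monic_X_sub_C _
  have hhd : h.natDegree = m * g + ρ := by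
    rw [hh, natDegree_prod_of_monic _ _ fun i _ => monic_X_sub_C _]
    simp only [natDegree_X_sub_C, Finset.sum_const, Finset.card_range, smul_eq_mul, mul_one, hn]
  obtain ⟨k, r, hrd, hrlc, happ⟩ := exists_int_approx_root (by omega) h hmon hhd
  set P : ℤ := ∏ i ∈ Finset.range n, ∏ j ∈ (Finset.range n).erase i,
    ((b i : ℤ) ^ m - (b j : ℤ) ^ m) with hP
  set P₁ : ℤ := ∏ i ∈ Finset.range n, (b i : ℤ) ^ m with hP₁
  set W : ℤ := (m : ℤ) ^ k * m * P₁ * P with hW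
  have hPQ : IsCoprime (Q : ℤ) P := by
    refine IsCoprime.prod_right fun i hi => IsCoprime.prod_right fun j hj => ?_
    rw [Finset.mem_erase, Finset.mem_range] at hj
    exact hQs i (hle i (Finset.mem_range.mp hi)) j (hle j hj.2) (Ne.symm hj.1)
  have hP₁Q : IsCoprime (Q : ℤ) P₁ :=
    IsCoprime.prod_right fun i _ => (Nat.isCoprime_iff_coprime.mpr (hQb i)).pow_right
  have hQm' : IsCoprime (Q : ℤ) m := Nat.isCoprime_iff_coprime.mpr hQm
  have hWQ : IsCoprime (Q : ℤ) W := ((hQm'.pow_right.mul_right hQm').mul_right hP₁Q).mul_right hPQ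
  have hP0 : P ≠ 0 := by
    refine Finset.prod_ne_zero_iff.mpr fun i hi => Finset.prod_ne_zero_iff.mpr fun j hj => ?_
    rw [Finset.mem_erase, Finset.mem_range] at hj
    have := hne i (hle i (Finset.mem_range.mp hi)) j (hle j hj.2) (Ne.symm hj.1)
    exact sub_ne_zero.mpr (by exact_mod_cast this)
  have hP₁0 : P₁ ≠ 0 := by
    refine Finset.prod_ne_zero_iff.mpr fun i _ => pow_ne_zero _ ?_
    exact_mod_cast (hbpos i).ne'
  have hm0 : (m : ℤ) ≠ 0 := by positivity
  have hW0 : W ≠ 0 := mul_ne_zero (mul_ne_zero (mul_ne_zero (pow_ne_zero _ hm0) hm0) hP₁0) hP0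
  have hdvd : ∀ x : ℤ, x ∣ W → x ∣ (W.natAbs : ℤ) := fun x hx => Int.dvd_natAbs.mpr hx
  have hE : m ^ k ∣ W.natAbs := by
    have := hdvd ((m : ℤ) ^ k) ⟨m * P₁ * P, by rw [hW]; ring⟩
    exact_mod_cast this
  refine ⟨⟨b, Q, W.natAbs, m ^ k, W.natAbs ^ (ρ + 1) * (W.natAbs / m ^ k), r, hm, hg, hb0, hbpos,
    hQ, hWQ.natAbs_right, fun i hi j hj hij => hne i (hle i hi) j (hle j hj) hij, hloc,
    Int.natAbs_pos.mpr hW0, hE, ?_, fun i hi => ?_, fun i hi j hj hij => ?_, ?_, hrd, ?_, ?_⟩⟩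
  · have := hdvd (m : ℤ) ⟨m ^ k * P₁ * P, by rw [hW]; ring⟩
    exact_mod_cast this
  · have h1 : (b i : ℤ) ^ m ∣ P₁ :=
      Finset.dvd_prod_of_mem (fun i => (b i : ℤ) ^ m) (Finset.mem_range.mpr hi)
    have := hdvd _ ((h1.mul_left ((m : ℤ) ^ k * m)).mul_right P)
    exact_mod_cast this
  · have h1 : (b i : ℤ) ^ m - (b j : ℤ) ^ m ∣ ∏ j ∈ (Finset.range n).erase i,
        ((b i : ℤ) ^ m - (b j : ℤ) ^ m) :=
      Finset.dvd_prod_of_mem (fun j => (b i : ℤ) ^ m - (b j : ℤ) ^ m)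
        (Finset.mem_erase.mpr ⟨Ne.symm hij, Finset.mem_range.mpr hj⟩)
    have h2 : ∏ j ∈ (Finset.range n).erase i, ((b i : ℤ) ^ m - (b j : ℤ) ^ m) ∣ P :=
      Finset.dvd_prod_of_mem (fun i => ∏ j ∈ (Finset.range n).erase i,
        ((b i : ℤ) ^ m - (b j : ℤ) ^ m)) (Finset.mem_range.mpr hi)
    exact hdvd _ ((h1.trans h2).mul_left _)
  · rw [mul_left_comm, Nat.mul_div_cancel' hE, ← pow_succ]
  · rw [hrlc]; push_cast; rfl
  · push_cast
    have hpos : 0 < (m - 1) * g := Nat.mul_pos (by omega) (by omega)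
    rcases eq_or_ne (X ^ ρ * r ^ m - C (((m : ℤ) ^ k) ^ m) * h) 0 with h0 | h0
    · rw [h0, natDegree_zero]; omega
    · exact (natDegree_lt_iff_degree_lt h0).mpr happ

namespace RankDesign

open Polynomial

variable {m g ρ : ℕ} (D : RankDesign m g ρ)

/-- The split polynomial with roots the chosen `m`-th powers. -/
noncomputable def h : ℤ[X] := ∏ i ∈ Finset.range (m * g + ρ), (X - C ((D.b i : ℤ) ^ m))

/-- The defining polynomial of the number field with parameters `s` and `l`. -/
noncomputable def F (s l : ℤ) : ℤ[X] :=
  X ^ ρ * (C s + C (l * D.B) * (D.r - C (D.r.eval 1))) ^ m - C ((l * (D.E * D.B)) ^ m) * D.h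

/-- The monic real polynomial proportional to the design polynomial. -/
noncomputable def realR : ℝ[X] := C (D.E : ℝ)⁻¹ * D.r.map (Int.castRingHom ℝ)

/-- The real split polynomial. -/
noncomputable def realH : ℝ[X] := D.h.map (Int.castRingHom ℝ)

/-- The real one-parameter family of polynomials underlying `RankDesign.F`. -/
noncomputable def family (t : ℝ) : ℝ[X] := X ^ ρ * (C t + D.realR) ^ m - D.realH

/-- The real parameter corresponding to the integral parameters `s` and `l`. -/
noncomputable def param (s l : ℤ) : ℝ :=
  ((s - l * D.B * D.r.eval 1 : ℤ) : ℝ) / (l * (D.E * D.B))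

theorem four_le {m g ρ : ℕ} (D : RankDesign m g ρ) : 4 ≤ m * g :=
  Nat.mul_le_mul D.one_lt D.one_lt_g

theorem E_pos : 0 < D.E := Nat.pos_of_dvd_of_pos D.E_dvd D.Z_pos

theorem B_pos : 0 < D.B := by
  rcases Nat.eq_zero_or_pos D.B with h | h
  · have := D.E_mul_B
    rw [h, mul_zero] at this
    exact absurd this.symm (pow_pos D.Z_pos _).ne'
  · exact h

theorem h_monic : D.h.Monic := monic_prod_of_monic _ _ fun _ _ => monic_X_sub_C _

theorem h_natDegree : D.h.natDegree = m * g + ρ := by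
  rw [h, natDegree_prod_of_monic _ _ fun i _ => monic_X_sub_C _]
  simp only [natDegree_X_sub_C, Finset.sum_const, Finset.card_range, smul_eq_mul, mul_one]

theorem h_eval_one : D.h.eval 1 = 0 := by
  rw [h, eval_prod]
  refine Finset.prod_eq_zero (i := 0) (Finset.mem_range.mpr (by have := D.four_le; omega)) ?_
  simp [D.b_zero]

theorem h_derivative_eval_one : D.h.derivative.eval 1 =
    ∏ i ∈ (Finset.range (m * g + ρ)).erase 0, (1 - (D.b i : ℤ) ^ m) := by
  have h0 : 0 ∈ Finset.range (m * g + ρ) := Finset.mem_range.mpr (by have := D.four_le; omega)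
  have h1 : D.h = (X - C 1) * ∏ i ∈ (Finset.range (m * g + ρ)).erase 0, (X - C ((D.b i : ℤ) ^ m)) := by
    rw [h, ← Finset.mul_prod_erase _ _ h0]
    simp [D.b_zero]
  rw [h1, derivative_mul]
  simp only [eval_add, eval_mul, derivative_sub, derivative_X, derivative_C, sub_zero,
    one_mul, eval_sub, eval_X, eval_C, sub_self, zero_mul, add_zero, eval_prod]

theorem aeval_h {A : Type*} [CommRing A] (x : A) :
    aeval x D.h = ∏ i ∈ Finset.range (m * g + ρ), (x - (D.b i : A) ^ m) := by
  simp [h, map_prod]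

theorem one_sub_dvd {i : ℕ} (hi : i < m * g + ρ) (hi0 : i ≠ 0) : (1 - (D.b i : ℤ) ^ m) ∣ D.Z := by
  have := D.sub_dvd 0 (by have := D.four_le; omega) i hi (Ne.symm hi0)
  simpa [D.b_zero] using this

theorem not_dvd_h_derivative {q : ℕ} (hq : q.Prime) (hqZ : ¬ q ∣ D.Z) :
    ¬ (q : ℤ) ∣ D.h.derivative.eval 1 := by
  rw [h_derivative_eval_one, (Nat.prime_iff_prime_int.mp hq).dvd_finsetProd_iff]
  rintro ⟨i, hi, hqi⟩
  rw [Finset.mem_erase, Finset.mem_range] at hi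
  exact hqZ (by exact_mod_cast hqi.trans (D.one_sub_dvd hi.2 hi.1))

theorem h_derivative_ne_zero : D.h.derivative.eval 1 ≠ 0 := by
  rw [h_derivative_eval_one, Finset.prod_ne_zero_iff]
  intro i hi h0
  rw [Finset.mem_erase, Finset.mem_range] at hi
  have := D.one_sub_dvd hi.2 hi.1
  rw [h0, zero_dvd_iff] at this
  have h1 := D.Z_pos
  omega

theorem F_eval_one (s l : ℤ) : (D.F s l).eval 1 = s ^ m := by
  simp [F, D.h_eval_one]

theorem dvd_F_derivative (s l : ℤ) :
    s ∣ (D.F s l).derivative.eval 1 + (l * (D.E * D.B)) ^ m * D.h.derivative.eval 1 := by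
  have : (D.F s l).derivative.eval 1 + (l * (D.E * D.B)) ^ m * D.h.derivative.eval 1 =
      ρ * s ^ m + m * s ^ (m - 1) * (l * D.B * D.r.derivative.eval 1) := by
    simp [F, derivative_pow]
  rw [this]
  have hm := D.one_lt
  exact dvd_add ((dvd_pow_self s (by omega)).mul_left _)
    (((dvd_pow_self s (by omega)).mul_left _).mul_right _)

theorem not_dvd_F_derivative {q : ℕ} (hq : q.Prime) {s l : ℤ} (hqs : (q : ℤ) ∣ s) (hqZ : ¬ q ∣ D.Z)
    (hql : ¬ (q : ℤ) ∣ l) : ¬ (q : ℤ) ∣ (D.F s l).derivative.eval 1 := by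
  intro hd
  have hqp := Nat.prime_iff_prime_int.mp hq
  have h1 := (dvd_add_right hd).mp (hqs.trans (D.dvd_F_derivative s l))
  rcases hqp.dvd_or_dvd h1 with h2 | h2
  · rcases hqp.dvd_or_dvd (hqp.dvd_of_dvd_pow h2) with h3 | h3
    · exact hql h3
    · have h4 : q ∣ D.E * D.B := by exact_mod_cast h3
      rw [D.E_mul_B] at h4
      exact hqZ (hq.dvd_of_dvd_pow h4)
  · exact D.not_dvd_h_derivative hq hqZ h2

theorem realR_monic : D.realR.Monic := by
  have : (D.E : ℝ) ≠ 0 := by exact_mod_cast D.E_pos.ne'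
  rw [Monic, realR, leadingCoeff_mul, leadingCoeff_C, leadingCoeff_map_of_injective Int.cast_injective,
    D.r_leadingCoeff]
  simp [this]

theorem realR_natDegree : D.realR.natDegree = g := by
  have : (D.E : ℝ) ≠ 0 := by exact_mod_cast D.E_pos.ne'
  rw [realR, natDegree_C_mul (inv_ne_zero this), natDegree_map_eq_of_injective Int.cast_injective,
    D.r_natDegree]

theorem realH_monic : D.realH.Monic := D.h_monic.map _

theorem realH_natDegree : D.realH.natDegree = m * g + ρ := by
  rw [realH, natDegree_map_eq_of_injective Int.cast_injective, h_natDegree]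

theorem realR_approx : (X ^ ρ * D.realR ^ m - D.realH).natDegree < ρ + (m - 1) * g := by
  have hE : (D.E : ℝ) ≠ 0 := by exact_mod_cast D.E_pos.ne'
  have h1 := natDegree_map_eq_of_injective (f := Int.castRingHom ℝ) Int.cast_injective
    (X ^ ρ * D.r ^ m - C ((D.E : ℤ) ^ m) * D.h)
  have h2 : X ^ ρ * D.realR ^ m - D.realH = C ((D.E : ℝ)⁻¹ ^ m) *
      (X ^ ρ * D.r ^ m - C ((D.E : ℤ) ^ m) * D.h).map (Int.castRingHom ℝ) := by
    have h3 : C ((D.E : ℝ)⁻¹ ^ m) * C ((D.E : ℝ) ^ m) = 1 := by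
      rw [← C_mul, ← mul_pow, inv_mul_cancel₀ hE, one_pow, C_1]
    rw [realR, realH]
    simp only [Polynomial.map_sub, Polynomial.map_mul, Polynomial.map_pow, map_X, map_C]
    rw [mul_sub, ← mul_assoc (C ((D.E : ℝ)⁻¹ ^ m)) (C _)]
    have : (Int.castRingHom ℝ) ((D.E : ℤ) ^ m) = (D.E : ℝ) ^ m := by simp
    rw [this, h3, mul_pow, C_pow]
    ring
  rw [h2, natDegree_C_mul (pow_ne_zero _ (inv_ne_zero hE)), h1]
  exact D.r_approx

theorem map_F {s l : ℤ} (hl : l ≠ 0) : (D.F s l).map (Int.castRingHom ℝ) =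
    C (((l : ℝ) * (D.E * D.B)) ^ m) * D.family (D.param s l) := by
  have hE : (D.E : ℝ) ≠ 0 := by exact_mod_cast D.E_pos.ne'
  have hB : (D.B : ℝ) ≠ 0 := by exact_mod_cast D.B_pos.ne'
  have hl' : (l : ℝ) ≠ 0 := by exact_mod_cast hl
  have h1 : C ((l : ℝ) * (D.E * D.B)) * (C (D.param s l) + D.realR) =
      (C s + C (l * D.B) * (D.r - C (D.r.eval 1))).map (Int.castRingHom ℝ) := by
    have h2 : (l : ℝ) * (D.E * D.B) * D.param s l = s - l * D.B * D.r.eval 1 := by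
      rw [param]; push_cast; field_simp
    have h3 : (l : ℝ) * (D.E * D.B) * (D.E : ℝ)⁻¹ = l * D.B := by field_simp
    rw [mul_add, ← C_mul, h2, realR, ← mul_assoc, ← C_mul, h3]
    simp [mul_sub]
    ring
  rw [family, mul_sub, C_pow, mul_left_comm, ← mul_pow, h1, F, realH]
  simp

theorem family_natDegree {t : ℝ} (ht : t ≠ 0) : (D.family t).natDegree = ρ + (m - 1) * g ∧
    (D.family t).leadingCoeff = m * t :=
  natDegree_X_pow_mul_add_pow_sub (by have := D.one_lt; omega) (by have := D.one_lt_g; omega)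
    D.realR_monic D.realR_natDegree D.realR_approx ht

theorem F_natDegree {s l : ℤ} (hl : l ≠ 0) (hs : D.param s l ≠ 0) :
    (D.F s l).natDegree = ρ + (m - 1) * g := by
  have hE : (D.E : ℝ) ≠ 0 := by exact_mod_cast D.E_pos.ne'
  have hB : (D.B : ℝ) ≠ 0 := by exact_mod_cast D.B_pos.ne'
  have hl' : (l : ℝ) ≠ 0 := by exact_mod_cast hl
  rw [← natDegree_map_eq_of_injective (f := Int.castRingHom ℝ) Int.cast_injective, D.map_F hl,
    natDegree_C_mul (by positivity), (D.family_natDegree hs).1]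

theorem F_leadingCoeff {s l : ℤ} (hl : l ≠ 0) (hs : D.param s l ≠ 0) :
    (D.F s l).leadingCoeff = m * (s - l * D.B * D.r.eval 1) * (l * (D.E * D.B)) ^ (m - 1) := by
  have hE : (D.E : ℝ) ≠ 0 := by exact_mod_cast D.E_pos.ne'
  have hB : (D.B : ℝ) ≠ 0 := by exact_mod_cast D.B_pos.ne'
  have hl' : (l : ℝ) ≠ 0 := by exact_mod_cast hl
  have h1 : (((D.F s l).leadingCoeff : ℤ) : ℝ) =
      ((m * (s - l * D.B * D.r.eval 1) * (l * (D.E * D.B)) ^ (m - 1) : ℤ) : ℝ) := by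
    have h2 := leadingCoeff_map_of_injective (f := Int.castRingHom ℝ) Int.cast_injective (D.F s l)
    rw [eq_intCast] at h2
    rw [← h2, D.map_F hl, leadingCoeff_mul, leadingCoeff_C, (D.family_natDegree hs).2, param]
    obtain ⟨k, hk⟩ : ∃ k, m = k + 1 := ⟨m - 1, by have := D.one_lt; omega⟩
    have h3 : ((l : ℝ) * (D.E * D.B)) ^ m = (l * (D.E * D.B)) ^ (m - 1) * (l * (D.E * D.B)) := by
      rw [← pow_succ]; congr 1; omega
    rw [h3]
    push_cast
    field_simp
  exact_mod_cast h1

theorem dvd_F_coeff_sub (s l : ℤ) (i : ℕ) :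
    l ∣ (D.F s l).coeff i - (if i = ρ then s ^ m else 0) := by
  have h1 : C l ∣ D.F s l - C (s ^ m) * X ^ ρ := by
    have h2 : C l ∣ (C s + C (l * D.B) * (D.r - C (D.r.eval 1))) ^ m - C s ^ m := by
      refine Dvd.dvd.trans ?_ (sub_dvd_pow_sub_pow _ _ m)
      rw [add_sub_cancel_left, C_mul, mul_assoc]
      exact dvd_mul_right _ _
    have h3 : C l ∣ C ((l * (D.E * D.B)) ^ m) * D.h := by
      rw [C_pow, C_mul]
      exact ((dvd_mul_right _ _).pow (by have := D.one_lt; omega)).mul_right _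
    have h4 : D.F s l - C (s ^ m) * X ^ ρ = X ^ ρ *
        ((C s + C (l * D.B) * (D.r - C (D.r.eval 1))) ^ m - C s ^ m) -
          C ((l * (D.E * D.B)) ^ m) * D.h := by
      simp only [F, C_pow]; ring
    rw [h4]
    exact dvd_sub (h2.mul_left _) h3
  have := C_dvd_iff_dvd_coeff l _ |>.mp h1 i
  rwa [coeff_sub, coeff_C_mul, coeff_X_pow, mul_ite, mul_one, mul_zero] at this

end RankDesign

namespace RankDesign

open Polynomial

variable {m g ρ : ℕ} (D : RankDesign m g ρ)

/-- The parameter `t` is so large that the roots of the family are well separated. -/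
def IsLarge (t : ℝ) : Prop :=
  1 ≤ t ∧
  (∀ x : ℂ, aeval x (D.family t) = 0 →
    ((2 : ℝ) ^ (ρ + (m - 1) * g) * (D.Q ^ m : ℕ) + 1 < ‖x‖ ∧
      ∀ i < m * g + ρ, (D.b i : ℝ) ^ m < ‖x‖) ∨
    (‖x‖ * ((2 : ℝ) ^ (ρ + (m - 1) * g) * (D.Q ^ m : ℕ)) < 1 ∧ 0 < ρ)) ∧
  (∀ x : ℂ, aeval x (D.family t) = 0 → aeval x (D.family t).derivative ≠ 0) ∧
  ∀ S : Finset ℝ, (∀ x ∈ S, (D.family t).eval x = 0) →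
    S.card ≤ 3 ∧ (ρ = 0 → S.card ≤ 1) ∧ (Odd m → S.card ≤ 2)

theorem aeval_realH (x : ℂ) :
    aeval x D.realH = ∏ i ∈ Finset.range (m * g + ρ), (x - (D.b i : ℂ) ^ m) := by
  have : (algebraMap ℝ ℂ).comp (Int.castRingHom ℝ) = Int.castRingHom ℂ := RingHom.ext_int _ _
  rw [← D.aeval_h x, realH, aeval_def, eval₂_map, this]
  rfl

theorem exists_isLarge : ∃ T : ℝ, ∀ t, T ≤ t → D.IsLarge t := by
  have h1 : ∀ x : ℂ, aeval x D.realH = 0 → 1 ≤ ‖x‖ := by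
    intro x hx
    rw [aeval_realH, Finset.prod_eq_zero_iff] at hx
    obtain ⟨i, -, hi⟩ := hx
    rw [sub_eq_zero.mp hi, norm_pow, Complex.norm_natCast]
    exact one_le_pow₀ (by exact_mod_cast D.b_pos i)
  have h2 : D.realH.eval 1 = 0 := by
    have := eval_intCast_map (Int.castRingHom ℝ) D.h 1
    rw [Int.cast_one, Int.cast_one, D.h_eval_one] at this
    simpa [realH] using this
  have h3 : D.realH.derivative.eval 1 ≠ 0 := by
    have := eval_intCast_map (Int.castRingHom ℝ) D.h.derivative 1
    rw [Int.cast_one] at this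
    rw [realH, derivative_map, this, eq_intCast, Int.cast_one]
    exact_mod_cast D.h_derivative_ne_zero
  have hA : (0 : ℝ) < (2 : ℝ) ^ (ρ + (m - 1) * g) * (D.Q ^ m : ℕ) := by
    have := D.one_lt_Q
    positivity
  obtain ⟨T, hT1, hT⟩ := exists_family_roots (m := m) (g := g) (ρ := ρ) D.one_lt
    (by have := D.one_lt_g; omega) D.realR_monic D.realR_natDegree D.realH_monic D.realH_natDegree
    D.realR_approx h1 h2 h3 ((2 : ℝ) ^ (ρ + (m - 1) * g) * (D.Q ^ m : ℕ) + 1 +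
      ∑ i ∈ Finset.range (m * g + ρ), (D.b i : ℝ) ^ m)
    (1 / ((2 : ℝ) ^ (ρ + (m - 1) * g) * (D.Q ^ m : ℕ))) (by positivity)
  refine ⟨T, fun t ht => ⟨hT1.trans ht, fun x hx => ?_, (hT t ht).2.1, (hT t ht).2.2⟩⟩
  rcases (hT t ht).1 x hx with h | ⟨h, hρ⟩
  · refine .inl ⟨?_, fun i hi => ?_⟩
    · have : 0 ≤ ∑ i ∈ Finset.range (m * g + ρ), (D.b i : ℝ) ^ m :=
        Finset.sum_nonneg fun _ _ => by positivity
      linarith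
    · have : (D.b i : ℝ) ^ m ≤ ∑ i ∈ Finset.range (m * g + ρ), (D.b i : ℝ) ^ m :=
        Finset.single_le_sum (f := fun i => (D.b i : ℝ) ^ m) (fun _ _ => by positivity)
          (Finset.mem_range.mpr hi)
      linarith
  · exact .inr ⟨by rwa [lt_div_iff₀ hA] at h, hρ⟩

theorem aeval_family_eq_zero {s l : ℤ} (hl : l ≠ 0) {A : Type*} [Field A] [Algebra ℝ A] {x : A}
    (hx : aeval x (D.F s l) = 0) : aeval x (D.family (D.param s l)) = 0 := by
  have hE : (D.E : ℝ) ≠ 0 := by exact_mod_cast D.E_pos.ne'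
  have hB : (D.B : ℝ) ≠ 0 := by exact_mod_cast D.B_pos.ne'
  have hl' : (l : ℝ) ≠ 0 := by exact_mod_cast hl
  have h1 : aeval x ((D.F s l).map (Int.castRingHom ℝ)) = 0 := by
    have : (algebraMap ℝ A).comp (Int.castRingHom ℝ) = algebraMap ℤ A := RingHom.ext_int _ _
    rw [aeval_def, eval₂_map, this]
    exact hx
  rw [D.map_F hl, map_mul, aeval_C] at h1
  refine (mul_eq_zero.mp h1).resolve_left ?_
  exact (_root_.map_ne_zero _).mpr (by positivity)

theorem degree_pos {m g ρ : ℕ} (D : RankDesign m g ρ) : 1 < ρ + (m - 1) * g := by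
  have h1 := D.one_lt
  have h2 := D.one_lt_g
  have : 1 * g ≤ (m - 1) * g := Nat.mul_le_mul_right g (by omega)
  omega

theorem F_eval_zero_ne_zero {s l : ℤ} (hl : l ≠ 0) (ht : D.IsLarge (D.param s l)) :
    (D.F s l).eval 0 ≠ 0 := by
  intro h0
  have h1 : aeval (0 : ℂ) (D.F s l) = 0 := by
    have : aeval (0 : ℂ) (D.F s l) = ((D.F s l).eval 0 : ℤ) := by
      rw [← map_zero (algebraMap ℤ ℂ), aeval_algebraMap_apply]
      simp
    rw [this, h0, Int.cast_zero]
  have h2 := D.aeval_family_eq_zero hl h1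
  rcases ht.2.1 0 h2 with ⟨h, -⟩ | ⟨-, hρ⟩
  · rw [norm_zero] at h
    have : (0 : ℝ) ≤ (2 : ℝ) ^ (ρ + (m - 1) * g) * (D.Q ^ m : ℕ) := by positivity
    linarith
  · have hF : (D.F s l).eval 0 = -((l * (D.E * D.B)) ^ m * D.h.eval 0) := by
      simp [F, hρ.ne']
    have hh : D.h.eval 0 ≠ 0 := by
      rw [h, eval_prod, Finset.prod_ne_zero_iff]
      intro i _
      have := (D.b_pos i).ne'
      simp [this]
    have hE : (D.E : ℤ) ≠ 0 := by exact_mod_cast D.E_pos.ne'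
    have hB : (D.B : ℤ) ≠ 0 := by exact_mod_cast D.B_pos.ne'
    rw [hF] at h0
    exact neg_ne_zero.mpr (mul_ne_zero (pow_ne_zero _ (mul_ne_zero hl (mul_ne_zero hE hB))) hh) h0

theorem irreducible_F {p l : ℕ} (hp : p.Prime) (hl : l.Prime) (hpl : p ≠ l) (hpZ : ¬ p ∣ D.Z)
    (ht : D.IsLarge (D.param (p * D.Q) l)) :
    Irreducible ((D.F (p * D.Q) l).map (Int.castRingHom ℚ)) := by
  have hl0 : (l : ℤ) ≠ 0 := by exact_mod_cast hl.ne_zero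
  have hd := D.F_natDegree (s := p * D.Q) hl0 (by linarith [ht.1])
  have hQ := D.one_lt_Q
  refine irreducible_map_of_roots (p := p) (k := m) (A := D.Q ^ m) ?_ hp (by positivity) ?_
    (D.not_dvd_F_derivative hp (dvd_mul_right _ _) hpZ ?_) (D.F_eval_zero_ne_zero hl0 ht)
    fun x hx => ?_
  · rw [hd]; exact lt_trans one_pos D.degree_pos
  · rw [F_eval_one, mul_pow]; push_cast; rfl
  · exact_mod_cast (Nat.prime_dvd_prime_iff_eq hp hl).not.mpr hpl
  · rw [hd]
    rcases ht.2.1 x (D.aeval_family_eq_zero hl0 hx) with ⟨h, -⟩ | ⟨h, -⟩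
    · exact .inl h
    · exact .inr h

end RankDesign

namespace RankDesign

open Polynomial

variable {m g ρ : ℕ} (D : RankDesign m g ρ)

section Field

variable {K : Type*} [Field K] {s l : ℤ} {α : K}

theorem complex_embedding_root (hl : l ≠ 0) (hα : aeval α (D.F s l) = 0) (φ : K →+* ℂ) :
    aeval (φ α) (D.family (D.param s l)) = 0 := by
  refine D.aeval_family_eq_zero hl ?_
  have := hom_eval₂ (D.F s l) (algebraMap ℤ K) φ α
  rw [RingHom.ext_int (φ.comp (algebraMap ℤ K)) (algebraMap ℤ ℂ)] at this
  rw [aeval_def, ← this, ← aeval_def, hα, map_zero]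

theorem real_embedding_root (hl : l ≠ 0) (hα : aeval α (D.F s l) = 0) (φ : K →+* ℝ) :
    (D.family (D.param s l)).eval (φ α) = 0 := by
  have h1 : aeval (φ α) (D.F s l) = 0 := by
    have := hom_eval₂ (D.F s l) (algebraMap ℤ K) φ α
    rw [RingHom.ext_int (φ.comp (algebraMap ℤ K)) (algebraMap ℤ ℝ)] at this
    rw [aeval_def, ← this, ← aeval_def, hα, map_zero]
  have := D.aeval_family_eq_zero hl h1
  rwa [coe_aeval_eq_eval] at this

variable [NumberField K]

theorem sub_ne_zero_of_root (hl : l ≠ 0) (ht : D.IsLarge (D.param s l))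
    (hα : aeval α (D.F s l) = 0) {i : ℕ} (hi : i < m * g + ρ) : α - (D.b i : K) ^ m ≠ 0 := by
  intro h0
  obtain ⟨φ⟩ := (inferInstance : Nonempty (K →+* ℂ))
  have h1 : φ α = (D.b i : ℂ) ^ m := by
    rw [sub_eq_zero.mp h0]; simp
  have h2 : (1 : ℝ) ≤ (D.b i : ℝ) ^ m := one_le_pow₀ (by exact_mod_cast D.b_pos i)
  have hn : ‖φ α‖ = (D.b i : ℝ) ^ m := by rw [h1, norm_pow, Complex.norm_natCast]
  rcases ht.2.1 _ (D.complex_embedding_root hl hα φ) with ⟨-, h⟩ | ⟨h, -⟩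
  · linarith [h i hi]
  · have h3 : (1 : ℝ) ≤ (2 : ℝ) ^ (ρ + (m - 1) * g) * (D.Q ^ m : ℕ) := by
      have : (1 : ℝ) ≤ (D.Q ^ m : ℕ) := by
        exact_mod_cast Nat.one_le_pow _ _ (by have := D.one_lt_Q; omega)
      have h4 : (1 : ℝ) ≤ (2 : ℝ) ^ (ρ + (m - 1) * g) := one_le_pow₀ (by norm_num)
      nlinarith
    rw [hn] at h
    nlinarith

theorem nrRealPlaces_bounds (hl : l ≠ 0) (ht : D.IsLarge (D.param s l))
    (hα : aeval α (D.F s l) = 0) (hgen : IntermediateField.adjoin ℚ {α} = ⊤) :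
    NumberField.InfinitePlace.nrRealPlaces K ≤ 3 ∧
      (ρ = 0 → NumberField.InfinitePlace.nrRealPlaces K ≤ 1) ∧
      (Odd m → NumberField.InfinitePlace.nrRealPlaces K ≤ 2) := by
  classical
  set f : {w : NumberField.InfinitePlace K // w.IsReal} → ℝ :=
    fun w => NumberField.InfinitePlace.embedding_of_isReal w.2 α with hf
  have hinj : Function.Injective f := by
    intro w w' hww
    have h1 : (NumberField.InfinitePlace.embedding_of_isReal w.2).toRatAlgHom =
        (NumberField.InfinitePlace.embedding_of_isReal w'.2).toRatAlgHom := by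
      refine AlgHom.ext_of_adjoin_eq_top (s := {α}) ?_ ?_
      · rw [← IntermediateField.adjoin_simple_toSubalgebra_of_isAlgebraic
          (Algebra.IsAlgebraic.isAlgebraic α), hgen, IntermediateField.top_toSubalgebra]
      · intro x hx
        rw [Set.mem_singleton_iff.mp hx]
        exact hww
    apply Subtype.ext
    apply NumberField.InfinitePlace.ext
    intro x
    rw [← NumberField.InfinitePlace.norm_embedding_of_isReal w.2,
      ← NumberField.InfinitePlace.norm_embedding_of_isReal w'.2]
    exact congrArg norm (DFunLike.congr_fun h1 x)
  have hcard : (Finset.univ.image f).card = NumberField.InfinitePlace.nrRealPlaces K := by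
    rw [Finset.card_image_of_injective _ hinj, Finset.card_univ]
  rw [← hcard]
  refine ht.2.2.2 _ fun x hx => ?_
  obtain ⟨w, -, rfl⟩ := Finset.mem_image.mp hx
  exact D.real_embedding_root hl hα _

theorem quotient_pos (hl : l ≠ 0) (ht : D.IsLarge (D.param s l))
    (hα : aeval α (D.F s l) = 0) (σ : K →+* ℝ) {i j : ℕ} (hi : i < m * g + ρ)
    (hj : j < m * g + ρ) : 0 < σ ((α - (D.b i : K) ^ m) / (α - (D.b j : K) ^ m)) := by
  have h2 : ∀ i, (1 : ℝ) ≤ (D.b i : ℝ) ^ m := fun i => one_le_pow₀ (by exact_mod_cast D.b_pos i)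
  have h0 : σ ((α - (D.b i : K) ^ m) / (α - (D.b j : K) ^ m)) =
      (σ α - (D.b i : ℝ) ^ m) / (σ α - (D.b j : ℝ) ^ m) := by simp
  rw [h0]
  have hx := D.complex_embedding_root hl hα (Complex.ofRealHom.comp σ)
  have hn : ‖(Complex.ofRealHom.comp σ) α‖ = |σ α| := by simp
  rcases ht.2.1 _ hx with ⟨-, h⟩ | ⟨h, -⟩
  · rw [hn] at h
    rcases le_total 0 (σ α) with hs | hs
    · rw [abs_of_nonneg hs] at h
      exact div_pos (by linarith [h i hi]) (by linarith [h j hj])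
    · exact div_pos_of_neg_of_neg (by linarith [h2 i]) (by linarith [h2 j])
  · have h3 : (1 : ℝ) ≤ (2 : ℝ) ^ (ρ + (m - 1) * g) * (D.Q ^ m : ℕ) := by
      have : (1 : ℝ) ≤ (D.Q ^ m : ℕ) := by
        exact_mod_cast Nat.one_le_pow _ _ (by have := D.one_lt_Q; omega)
      have h4 : (1 : ℝ) ≤ (2 : ℝ) ^ (ρ + (m - 1) * g) := one_le_pow₀ (by norm_num)
      nlinarith
    rw [hn] at h
    have h5 : |σ α| < 1 := by nlinarith [abs_nonneg (σ α)]
    have h6 := (abs_lt.mp h5).2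
    exact div_pos_of_neg_of_neg (by linarith [h2 i]) (by linarith [h2 j])

theorem root_equation (hl : l ≠ 0) (hα : aeval α (D.F s l) = 0) :
    α ^ ρ * ((s : K) / ((D.Z : ℤ) ^ (ρ + 2) * l) + aeval α (D.r - C (D.r.eval 1)) / (D.E : ℤ)) ^ m =
      ∏ i : Fin (m * g + ρ), (α - (((D.b i : ℕ) : ℤ) : K) ^ m) := by
  have hE : (D.E : K) ≠ 0 := by exact_mod_cast D.E_pos.ne'
  have hB : (D.B : K) ≠ 0 := by exact_mod_cast D.B_pos.ne'
  have hl' : (l : K) ≠ 0 := by exact_mod_cast hl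
  have hZ : ((D.Z : ℤ) : K) ^ (ρ + 2) = D.E * D.B := by
    have := D.E_mul_B
    exact_mod_cast this.symm
  have hF : aeval α (D.F s l) = α ^ ρ * ((s : K) + l * D.B * aeval α (D.r - C (D.r.eval 1))) ^ m -
      (l * (D.E * D.B)) ^ m * aeval α D.h := by
    simp [F]
  have h1 : (∏ i : Fin (m * g + ρ), (α - (((D.b i : ℕ) : ℤ) : K) ^ m)) = aeval α D.h := by
    rw [aeval_h, Finset.prod_range]
    simp
  rw [h1, hZ]
  rw [hF, sub_eq_zero] at hα
  have hne : ((l : K) * (D.E * D.B)) ^ m ≠ 0 := by positivity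
  refine mul_left_cancel₀ hne ?_
  rw [← hα, mul_left_comm, ← mul_pow]
  congr 2
  push_cast
  field_simp

theorem finrank_eq (hl : l ≠ 0) (hs : D.param s l ≠ 0)
    (hirr : Irreducible ((D.F s l).map (Int.castRingHom ℚ)))
    (hα : aeval α (D.F s l) = 0) (hgen : IntermediateField.adjoin ℚ {α} = ⊤) :
    Module.finrank ℚ K = ρ + (m - 1) * g := by
  have h0 : aeval α ((D.F s l).map (Int.castRingHom ℚ)) = 0 := by
    have := aeval_map_algebraMap ℚ α (D.F s l)
    rw [hα] at this
    exact this
  have hmin := minpoly.eq_of_irreducible hirr h0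
  rw [← IntermediateField.finrank_top', ← hgen,
    IntermediateField.adjoin.finrank (Algebra.IsIntegral.isIntegral α), ← hmin,
    natDegree_mul_C (inv_ne_zero (leadingCoeff_ne_zero.mpr hirr.ne_zero)),
    natDegree_map_eq_of_injective Int.cast_injective, D.F_natDegree hl hs]

theorem exists_injective_classGroup {p l : ℕ} {α : K} (hp : p.Prime) (hl : l.Prime) (hpl : p ≠ l)
    (hpZ : ¬ p ∣ D.Z) (hlQ : ¬ l ∣ D.Q) (ht : D.IsLarge (D.param (p * D.Q) l))
    (hα : aeval α (D.F (p * D.Q) l) = 0) (hgen : IntermediateField.adjoin ℚ {α} = ⊤)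
    (hρ : ρ + 2 ≤ m) {r : ℕ} (hr : r = 0 ∨
      r + m ≤ (ρ + (m - 1) * g + 1) / 2 + g + (if ρ = 0 then 0 else 1)) :
    ∃ f : (Fin r → ZMod m) →+ Additive (ClassGroup (NumberField.RingOfIntegers K)),
      Function.Injective f := by
  have hl0 : (l : ℤ) ≠ 0 := by exact_mod_cast hl.ne_zero
  have hm := D.one_lt
  have hg := D.one_lt_g
  have h4 := D.four_le
  set T := m * g + ρ - 2 with hT
  have hTn : T + 2 = m * g + ρ := by omega
  have hirr := D.irreducible_F hp hl hpl hpZ ht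
  have hne : ∀ i < m * g + ρ, α - (D.b i : K) ^ m ≠ 0 := fun i hi =>
    D.sub_ne_zero_of_root hl0 ht hα hi
  have h1lt : 1 < m * g + ρ := by omega
  have hklt : ∀ k : Fin T, (k : ℕ) + 2 < m * g + ρ := fun k => by have := k.2; omega
  set u : Fin T → Kˣ := fun k => Units.mk0 ((α - (D.b (k + 2) : K) ^ m) / (α - (D.b 1 : K) ^ m))
    (div_ne_zero (hne _ (hklt k)) (hne 1 h1lt)) with hu
  have huval : ∀ k, (u k : K) = (α - (D.b (k + 2) : K) ^ m) / (α - (D.b 1 : K) ^ m) := fun k => rfl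
  have hd := D.finrank_eq hl0 (by linarith [ht.1]) hirr hα hgen
  refine exists_injective_zmod_classGroup_numberField (m := m) (T := T) (r := r) hm u ?_ ?_ ?_
  · obtain ⟨hr3, hr1, hr2⟩ := D.nrRealPlaces_bounds hl0 ht hα hgen
    have hsum := NumberField.InfinitePlace.card_add_two_mul_card_eq_rank K
    have hrank : NumberField.Units.rank K = NumberField.InfinitePlace.nrRealPlaces K +
        NumberField.InfinitePlace.nrComplexPlaces K - 1 := by
      rw [NumberField.Units.rank, NumberField.InfinitePlace.card_eq_nrRealPlaces_add_nrComplexPlaces]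
    rw [hd] at hsum
    have hmg : m * g = (m - 1) * g + g := by
      conv_lhs => rw [show m = (m - 1) + 1 by omega]
      ring
    have hmg1 : g ≤ (m - 1) * g := Nat.le_mul_of_pos_left g (by omega)
    rcases Nat.eq_zero_or_pos (NumberField.InfinitePlace.nrRealPlaces K) with h0 | h0
    · left
      rcases Nat.eq_zero_or_pos ρ with hρ0 | hρ0
      · rw [if_pos hρ0] at hr; omega
      · rw [if_neg hρ0.ne'] at hr; omega
    · right
      refine ⟨?_, ?_⟩
      · rcases Nat.eq_zero_or_pos ρ with hρ0 | hρ0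
        · rw [if_pos hρ0] at hr
          have := hr1 hρ0
          omega
        · rw [if_neg hρ0.ne'] at hr
          rcases Nat.lt_or_ge m 4 with hm4 | hm4
          · have hm3 : m = 3 := by omega
            have := hr2 (by rw [hm3]; decide)
            have hmg2 : (m - 1) * g = 2 * g := by rw [hm3]
            omega
          · omega
      · classical
        unfold NumberField.InfinitePlace.nrRealPlaces at h0
        obtain ⟨w⟩ := Fintype.card_pos_iff.mp h0
        refine ⟨NumberField.InfinitePlace.embedding_of_isReal w.2, fun k => ?_⟩
        rw [huval]
        exact D.quotient_pos hl0 ht hα _ (hklt k) h1lt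
  · intro k v
    have heq := D.root_equation hl0 hα
    have hcop : IsCoprime ((p * D.Q : ℕ) : ℤ) (D.Z * l) := by
      rw [Nat.cast_mul]
      have hpp : ∀ q : ℕ, ¬ p ∣ q → IsCoprime (p : ℤ) q := fun q hq =>
        Nat.isCoprime_iff_coprime.mpr ((Nat.Prime.coprime_iff_not_dvd hp).mpr hq)
      refine IsCoprime.mul_left ((hpp _ hpZ).mul_right (hpp _ ?_)) (D.coprime_Q_Z.mul_right ?_)
      · exact (Nat.prime_dvd_prime_iff_eq hp hl).not.mpr hpl
      · exact (Nat.isCoprime_iff_coprime.mpr ((Nat.Prime.coprime_iff_not_dvd hl).mpr hlQ)).symm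
    obtain ⟨z, hz⟩ := Valuation.exists_pow_eq_div (v.valuation K) (ρ := ρ) (m := m)
      (n := m * g + ρ) (by omega) (fun i => (D.b i : ℤ)) (D.r - C (D.r.eval 1)) (D := D.E)
      (Z := D.Z) (l := l) (s := (p * D.Q : ℕ)) (by exact_mod_cast D.Z_pos.ne') hl0
      (by exact_mod_cast D.E_dvd) (fun i => by exact_mod_cast D.b_dvd i i.2)
      (fun i j hij => D.sub_dvd i i.2 j j.2 (fun h => hij (Fin.ext h))) hcop (α := α)
      (by rw [← heq]; push_cast; rfl) ⟨k + 2, hklt k⟩ ⟨1, h1lt⟩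
    refine ⟨z, ?_⟩
    rw [huval, ← hz]
    simp
  · intro e β h k
    refine dvd_of_prod_zpow_eq_pow (by omega) α (fun j => (D.b j : ℤ) ^ m) u ?_ ?_ e β h k
    · intro k
      rw [huval]
      simp
    · intro k l' hl' hlm
      obtain ⟨q, hqQ, hq, hmq, hy, hny⟩ := D.exists_prime k l' hl' hlm
      have hqf : Fact q.Prime := ⟨hq⟩
      have hqp := Nat.prime_iff_prime_int.mp hq
      have hqZ : ¬ q ∣ D.Z := by
        intro hqZ
        have := D.coprime_Q_Z.isUnit_of_dvd' (Int.natCast_dvd_natCast.mpr hqQ)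
          (Int.natCast_dvd_natCast.mpr hqZ)
        exact hqp.not_isUnit this
      have hql : ¬ (q : ℤ) ∣ l := by
        intro hql
        have : q = l := (Nat.prime_dvd_prime_iff_eq hq hl).mp (by exact_mod_cast hql)
        exact hlQ (this ▸ hqQ)
      have hqs : (q : ℤ) ∣ p * D.Q := (Int.natCast_dvd_natCast.mpr hqQ).mul_left _
      refine ⟨q, hqf, hmq, ?_, ?_, ?_, ?_⟩
      · refine exists_ringHom_padic (D.F (p * D.Q) l) hirr α hα hgen ?_
          (D.not_dvd_F_derivative hq hqs hqZ hql)
        rw [F_eval_one]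
        exact dvd_pow hqs (by omega)
      · intro j hj hj0 h0
        have h1 := D.one_sub_dvd (i := j) (by omega) hj0
        have h2 : (q : ℤ) ∣ 1 - (D.b j : ℤ) ^ m := by
          rw [← ZMod.intCast_zmod_eq_zero_iff_dvd _ q]
          push_cast at h0 ⊢
          exact h0
        exact hqZ (by exact_mod_cast h2.trans h1)
      · intro j hj
        obtain ⟨y, hy⟩ := hy j hj
        exact ⟨y, by push_cast; exact hy⟩
      · intro y hy'
        exact hny y (by push_cast at hy'; exact hy')

end Field

end RankDesign

namespace RankDesign

open Polynomial

variable {m g ρ : ℕ} (D : RankDesign m g ρ)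

theorem exists_rescaled {s l : ℤ} {lam : ℂ} (hlam : lam ^ g = l) :
    ∃ P : (integralClosure ℤ ℂ)[X], (P.map (algebraMap (integralClosure ℤ ℂ) ℂ)).comp (C lam * X) =
      C (lam ^ ρ) * (D.F s l).map (Int.castRingHom ℂ) := by
  have hg := D.one_lt_g
  have hint : IsIntegral ℤ lam := by
    refine IsIntegral.of_pow (n := g) (by omega) ?_
    rw [hlam]
    exact isIntegral_algebraMap (x := l)
  set L : integralClosure ℤ ℂ := ⟨lam, hint⟩ with hL
  have hLl : algebraMap (integralClosure ℤ ℂ) ℂ L = lam := rfl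
  set R : ℤ[X] := C (D.B : ℤ) * (D.r - C (D.r.eval 1)) with hR
  have hRd : R.natDegree < g + 1 := by
    have h1 : R.natDegree ≤ (D.r - C (D.r.eval 1)).natDegree := natDegree_C_mul_le _ _
    have h2 := natDegree_sub_C (p := D.r) (a := D.r.eval 1)
    rw [D.r_natDegree] at h2
    omega
  refine ⟨X ^ ρ * (C (s : integralClosure ℤ ℂ) +
    ∑ k ∈ Finset.range (g + 1), C ((R.coeff k : integralClosure ℤ ℂ) * L ^ (g - k)) * X ^ k) ^ m -
      C (((D.E * D.B : ℕ) : integralClosure ℤ ℂ) ^ m) *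
        ∏ i ∈ Finset.range (m * g + ρ), (X - C (L * (D.b i : integralClosure ℤ ℂ) ^ m)), ?_⟩
  refine Polynomial.funext fun x => ?_
  have h1 : ∑ k ∈ Finset.range (g + 1), (R.coeff k : ℂ) * lam ^ (g - k) * (lam * x) ^ k =
      (l : ℂ) * aeval x R := by
    rw [← hlam, aeval_eq_sum_range' hRd, Finset.mul_sum]
    refine Finset.sum_congr rfl fun k hk => ?_
    have hk' : k ≤ g := by have := Finset.mem_range.mp hk; omega
    have : lam ^ g = lam ^ (g - k) * lam ^ k := by rw [← pow_add]; congr 1; omega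
    rw [this, mul_pow, zsmul_eq_mul]
    ring
  have h2 : ∏ i ∈ Finset.range (m * g + ρ), (lam * x - lam * (D.b i : ℂ) ^ m) =
      lam ^ (m * g + ρ) * aeval x D.h := by
    simp only [← mul_sub, Finset.prod_mul_distrib, Finset.prod_const, Finset.card_range, aeval_h]
  have h3 : lam ^ (m * g + ρ) = lam ^ ρ * (l : ℂ) ^ m := by
    rw [← hlam, ← pow_mul, ← pow_add]; congr 1; ring
  have h4 : ((D.F s l).map (Int.castRingHom ℂ)).eval x =
      x ^ ρ * (s + l * aeval x R) ^ m - ((l : ℂ) * (D.E * D.B)) ^ m * aeval x D.h := by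
    rw [eval_map]
    change aeval x (D.F s l) = _
    rw [hR]
    simp only [F, map_sub, map_mul, map_add, map_pow, aeval_X, eq_intCast, map_natCast,
      map_intCast]
    ring
  have h5 : ∀ n : ℤ, eval₂ (algebraMap (integralClosure ℤ ℂ) ℂ) (lam * x)
      (n : (integralClosure ℤ ℂ)[X]) = n := fun n => by
    rw [← C_eq_intCast, eval₂_C, map_intCast]
  rw [eval_mul, eval_C, h4, eval_comp, eval_mul, eval_C, eval_X, eval_map]
  simp only [eval₂_sub, eval₂_mul, eval₂_pow, eval₂_add, eval₂_X, eval₂_C, eval₂_finsetSum,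
    eval₂_finsetProd, h5, eval₂_natCast, map_mul, map_pow, map_intCast, map_natCast, hLl]
  rw [h1, h2, h3, Nat.cast_mul]
  ring

theorem dvd_discr {K : Type*} [Field K] [NumberField K] {p l : ℕ} {α : K} (hp : p.Prime)
    (hl : l.Prime) (hpl : p ≠ l) (hpZ : ¬ p ∣ D.Z) (hlQ : ¬ l ∣ D.Q) (hlZ : ¬ l ∣ D.Z)
    (ht : D.IsLarge (D.param (p * D.Q) l)) (hα : aeval α (D.F (p * D.Q) l) = 0) :
    (l : ℤ) ∣ NumberField.discr K := by
  have hl0 : (l : ℤ) ≠ 0 := by exact_mod_cast hl.ne_zero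
  have hlp := Nat.prime_iff_prime_int.mp hl
  have hm := D.one_lt
  have hirr := D.irreducible_F hp hl hpl hpZ ht
  have hls : ¬ (l : ℤ) ∣ p * D.Q := by
    intro h
    rcases hlp.dvd_or_dvd h with h | h
    · exact hpl ((Nat.prime_dvd_prime_iff_eq hl hp).mp (by exact_mod_cast h)).symm
    · exact hlQ (by exact_mod_cast h)
  obtain ⟨v, hv, hvα⟩ := NumberField.exists_one_lt_valuation hl _ hirr α hα (i := ρ)
    (by
      rw [D.F_leadingCoeff hl0 (by linarith [ht.1])]
      exact Dvd.dvd.mul_left (dvd_pow (dvd_mul_right _ _) (by omega)) _)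
    (by
      intro h
      have h1 := (dvd_sub_right h).mp (D.dvd_F_coeff_sub (p * D.Q) l ρ)
      rw [if_pos rfl] at h1
      exact hls (hlp.dvd_of_dvd_pow h1))
  have hvle : ∀ n : ℤ, v.valuation K (n : K) ≤ 1 := fun n => by
    have := v.valuation_le_one (K := K) (n : NumberField.RingOfIntegers K)
    simpa using this
  have hvone : ∀ n : ℤ, ¬ (l : ℤ) ∣ n → v.valuation K (n : K) = 1 := by
    intro n hn
    refine le_antisymm (hvle n) ?_
    obtain ⟨a, b, hab⟩ := (hlp.coprime_iff_not_dvd).mpr hn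
    have h1 : (1 : K) = a * l + b * n := by exact_mod_cast hab.symm
    have h2 : v.valuation K (a * l : K) < 1 := by
      rw [map_mul]
      exact (mul_le_of_le_one_left' (hvle a)).trans_lt hv
    by_contra! h3
    have h4 : v.valuation K (b * n : K) < 1 := by
      rw [map_mul]
      exact (mul_le_of_le_one_left' (hvle b)).trans_lt h3
    have h5 := (v.valuation K).map_add_lt h2 h4
    rw [← h1, map_one] at h5
    exact lt_irrefl _ h5
  have hZ : ∀ n : ℕ, n ∣ D.Z ^ (ρ + 2) → v.valuation K ((n : ℤ) : K) = 1 := fun n hn =>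
    hvone _ fun h => hlZ (hl.dvd_of_dvd_pow ((Int.natCast_dvd_natCast.mp h).trans hn))
  have hE := hZ D.E (D.E_mul_B ▸ dvd_mul_right _ _)
  have hB := hZ D.B (D.E_mul_B ▸ dvd_mul_left _ _)
  have key := (v.valuation K).mul_pow_eq_one_of_aeval_eq hvle (m := m) (g := g) (ρ := ρ) (by omega)
    D.h D.r (s := p * D.Q - l * D.B * D.r.eval 1) (ℓ := l) (B := D.B) (E := D.E) D.h_monic
    D.h_natDegree D.r_natDegree (by rw [D.r_leadingCoeff]; exact hE) D.r_approx
    (hvone _ fun h => hls ((dvd_sub_left ((dvd_mul_right _ _).mul_right _)).mp h)) hB hE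
    (hZ m (D.m_dvd.trans (dvd_pow_self _ (by omega)))) (by exact_mod_cast hv) hl0 hvα
    (by
      simp only [F, map_sub, map_mul, map_add, map_pow, aeval_X, eq_intCast, map_natCast,
        map_intCast] at hα
      rw [sub_eq_zero] at hα
      push_cast at hα ⊢
      rw [show (l : K) * D.B * D.E = l * (D.E * D.B) by ring, ← hα]
      ring)
  refine NumberField.dvd_discr_of_valuation_eq_pow hl v α⁻¹ D.one_lt_g hv ?_
  rw [map_inv₀, inv_pow]
  exact eq_inv_of_mul_eq_one_left (by exact_mod_cast key)

theorem exists_rescaled_coeff {s l : ℤ} {lam : ℂ} (hlam : lam ^ g = l) :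
    ∃ P : (integralClosure ℤ ℂ)[X], ∀ i, lam ^ i * (P.coeff i : ℂ) = lam ^ ρ * (D.F s l).coeff i := by
  obtain ⟨P, hP⟩ := D.exists_rescaled (s := s) hlam
  refine ⟨P, fun i => ?_⟩
  have := congrArg (fun q => coeff q i) hP
  simp only [comp_C_mul_X_coeff, coeff_map, coeff_C_mul] at this
  rw [mul_comm]
  exact this

theorem abs_discr_le {K : Type*} [Field K] [NumberField K] {s : ℤ} {l : ℕ} {α : K} (hl : 0 < l)
    (hs : D.param s l ≠ 0) (hd : Module.finrank ℚ K = ρ + (m - 1) * g)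
    (hα : aeval α (D.F s l) = 0) (hgen : IntermediateField.adjoin ℚ {α} = ⊤) {M : ℝ} (hM : 1 ≤ M)
    (hc : ∀ i, |(D.family (D.param s l)).coeff i| ≤ M)
    (hr : ∀ x : ℂ, aeval x (D.family (D.param s l)) = 0 → ‖x‖ ≤ M) :
    |((NumberField.discr K : ℤ) : ℝ)| ≤ ((ρ + (m - 1) * g).factorial *
      ((ρ + (m - 1) * g : ℕ) * (M * (D.E * D.B) ^ m) ^ (ρ + (m - 1) * g + 1)) ^
        (ρ + (m - 1) * g)) ^ 2 *
      (l : ℝ) ^ (∑ j ∈ Finset.range (ρ + (m - 1) * g - 1), 2 * (m - ((j + 1) - ρ) / g)) := by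
  have hg := D.one_lt_g
  have hl0 : (l : ℤ) ≠ 0 := by exact_mod_cast hl.ne'
  obtain ⟨lam, hlam⟩ := IsAlgClosed.exists_pow_nat_eq (l : ℂ) (n := g) (by omega)
  obtain ⟨P, hP⟩ := D.exists_rescaled_coeff (s := s) (l := l) (lam := lam) (by simpa using hlam)
  have hl1 : (1 : ℝ) ≤ l := by exact_mod_cast hl
  have hEB : (1 : ℝ) ≤ (D.E * D.B) ^ m := by
    have : 0 < D.E * D.B := Nat.mul_pos D.E_pos D.B_pos
    exact one_le_pow₀ (by exact_mod_cast this)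
  have hMM : M ≤ M * (D.E * D.B) ^ m := le_mul_of_one_le_right (by linarith) hEB
  refine NumberField.abs_discr_le_of_rescaled_root hd (D.F s l) α hgen (D.F_natDegree hl0 hs) hα hl
    lam hlam P hP (m := m) (hM.trans hMM) (fun i => ?_) (fun τ => ?_) hl1 le_rfl ?_
  · have h1 := congrArg (fun q => coeff q i) (D.map_F (s := s) hl0)
    simp only [coeff_map, coeff_C_mul, eq_intCast] at h1
    rw [h1, abs_mul, abs_of_nonneg (by positivity), Int.cast_natCast, mul_pow]
    calc _ ≤ (l : ℝ) ^ m * (D.E * D.B) ^ m * M := by gcongr; exact hc i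
      _ = _ := by ring
  · exact (hr _ (D.complex_embedding_root hl0 hα τ)).trans hMM
  · have : ρ + (m - 1) * g - 1 - ρ ≤ m * g := by
      have : (m - 1) * g ≤ m * g := Nat.mul_le_mul_right g (by omega)
      omega
    exact Nat.div_le_of_le_mul (this.trans_eq (mul_comm _ _))

end RankDesign

open Polynomial in
theorem NumberField.map_eq_C_mul_prod_embeddings {K : Type*} [Field K] [NumberField K] (F : ℤ[X])
    {α : K} (hd : Module.finrank ℚ K = F.natDegree) (hgen : IntermediateField.adjoin ℚ {α} = ⊤)
    (hα : aeval α F = 0) : F.map (Int.castRingHom ℂ) =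
      C (F.leadingCoeff : ℂ) * ∏ σ : K →ₐ[ℚ] ℂ, (X - C (σ α)) := by
  have hdeg : (F.map (Int.castRingHom ℂ)).natDegree = F.natDegree :=
    natDegree_map_eq_of_injective Int.cast_injective _
  have hF : F.map (Int.castRingHom ℂ) ≠ 0 := by
    intro h
    rw [h, natDegree_zero] at hdeg
    have := Module.finrank_pos (R := ℚ) (M := K)
    omega
  have hinj : Function.Injective fun σ : K →ₐ[ℚ] ℂ => σ α := by
    intro σ τ h
    refine AlgHom.ext_of_adjoin_eq_top (s := {α}) ?_ ?_
    · rw [← IntermediateField.adjoin_simple_toSubalgebra_of_isAlgebraic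
        (Algebra.IsAlgebraic.isAlgebraic α), hgen, IntermediateField.top_toSubalgebra]
    · intro x hx
      rw [Set.mem_singleton_iff.mp hx]
      exact h
  set S : Multiset ℂ := (Finset.univ : Finset (K →ₐ[ℚ] ℂ)).val.map fun σ => σ α with hS
  have hnodup : S.Nodup := Multiset.Nodup.map hinj Finset.univ.nodup
  have hle : S ≤ (F.map (Int.castRingHom ℂ)).roots := by
    refine (Multiset.le_iff_subset hnodup).mpr fun x hx => ?_
    obtain ⟨σ, -, rfl⟩ := Multiset.mem_map.mp hx
    rw [mem_roots hF, IsRoot.def, eval_map]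
    have := hom_eval₂ F (algebraMap ℤ K) (σ : K →+* ℂ) α
    rw [← aeval_def, hα, map_zero, RingHom.ext_int ((σ : K →+* ℂ).comp (algebraMap ℤ K))
      (Int.castRingHom ℂ)] at this
    exact this.symm
  have hcard : Multiset.card S = F.natDegree := by
    rw [hS, Multiset.card_map, Finset.card_val, Finset.card_univ, AlgHom.card, hd]
  have heq : S = (F.map (Int.castRingHom ℂ)).roots := by
    refine Multiset.eq_of_le_of_card_le hle ?_
    rw [hcard, ← hdeg]
    exact card_roots' _
  have h1 := C_leadingCoeff_mul_prod_multiset_X_sub_C (p := F.map (Int.castRingHom ℂ))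
    (by rw [← heq, hcard, hdeg])
  rw [leadingCoeff_map_of_injective Int.cast_injective, ← heq, hS, Multiset.map_map] at h1
  exact h1.symm

open Polynomial in
theorem NumberField.map_eq_C_mul_prod_of_rescaled {K : Type*} [Field K] [NumberField K] (F : ℤ[X])
    {α : K} (hd : Module.finrank ℚ K = F.natDegree) (hgen : IntermediateField.adjoin ℚ {α} = ⊤)
    (hα : aeval α F = 0) {lam : ℂ} (hlam : lam ≠ 0) {ρ : ℕ} (P : (integralClosure ℤ ℂ)[X])
    (hP : ∀ i, lam ^ i * (P.coeff i : ℂ) = lam ^ ρ * F.coeff i) :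
    P.map (algebraMap (integralClosure ℤ ℂ) ℂ) =
      C (P.coeff F.natDegree : ℂ) * ∏ σ : K →ₐ[ℚ] ℂ, (X - C (lam * σ α)) := by
  have hF := map_eq_C_mul_prod_embeddings F hd hgen hα
  have hcomp : (P.map (algebraMap (integralClosure ℤ ℂ) ℂ)).comp (C lam * X) =
      C (lam ^ ρ) * F.map (Int.castRingHom ℂ) := by
    ext i
    simp only [comp_C_mul_X_coeff, coeff_map, coeff_C_mul]
    rw [mul_comm]
    exact hP i
  refine Polynomial.funext fun y => ?_
  obtain ⟨x, rfl⟩ : ∃ x, y = lam * x := ⟨lam⁻¹ * y, (mul_inv_cancel_left₀ hlam y).symm⟩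
  have h1 := congrArg (eval x) hcomp
  rw [eval_comp, eval_mul, eval_C, eval_X, hF] at h1
  rw [h1]
  simp only [eval_mul, eval_C, eval_prod, eval_sub, eval_X]
  simp only [← mul_sub, Finset.prod_mul_distrib, Finset.prod_const]
  rw [Finset.card_univ, AlgHom.card, hd, ← mul_assoc, ← mul_assoc, mul_comm (P.coeff _ : ℂ), hP]
  rfl

open Polynomial in
theorem NumberField.one_le_abs_norm_sub_of_rescaled {K : Type*} [Field K] [NumberField K]
    (F F' : ℤ[X]) {α α' : K} (hd : Module.finrank ℚ K = F.natDegree)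
    (hd' : Module.finrank ℚ K = F'.natDegree) (hgen : IntermediateField.adjoin ℚ {α} = ⊤)
    (hgen' : IntermediateField.adjoin ℚ {α'} = ⊤) (hα : aeval α F = 0) (hα' : aeval α' F' = 0)
    (hne : α ≠ α') {g ρ k l : ℕ} (hl : 0 < l) (hg : 0 < g) (hk : F.natDegree = ρ + k * g) {lam : ℂ}
    (hlam : lam ^ g = l) (P P' : (integralClosure ℤ ℂ)[X])
    (hP : ∀ i, lam ^ i * (P.coeff i : ℂ) = lam ^ ρ * F.coeff i)
    (hP' : ∀ i, lam ^ i * (P'.coeff i : ℂ) = lam ^ ρ * F'.coeff i) :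
    1 ≤ |((F.leadingCoeff : ℚ) / l ^ k) ^ g * ((F'.leadingCoeff : ℚ) / l ^ k) ^ g *
      (l : ℚ) ^ F.natDegree * Algebra.norm ℚ (α - α') ^ g| := by
  have hl0 : (l : ℂ) ≠ 0 := by exact_mod_cast hl.ne'
  have hlam0 : lam ≠ 0 := by
    rintro rfl
    rw [zero_pow hg.ne'] at hlam
    exact hl0 hlam.symm
  have hlead : ∀ (G : ℤ[X]) (R : (integralClosure ℤ ℂ)[X]), G.natDegree = F.natDegree →
      (∀ i, lam ^ i * (R.coeff i : ℂ) = lam ^ ρ * G.coeff i) →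
      (R.coeff G.natDegree : ℂ) = G.leadingCoeff / l ^ k := by
    intro G R hG hR
    have h1 := hR G.natDegree
    have h2 : lam ^ G.natDegree = lam ^ ρ * (l : ℂ) ^ k := by
      rw [hG, hk, pow_add, mul_comm k, pow_mul, hlam]
    rw [h2, mul_assoc] at h1
    rw [eq_div_iff (pow_ne_zero _ hl0), mul_comm]
    exact mul_left_cancel₀ (pow_ne_zero _ hlam0) h1
  have hFF : F'.natDegree = F.natDegree := hd'.symm.trans hd
  have hint : ∀ (G : ℤ[X]) (R : (integralClosure ℤ ℂ)[X]) (β : K), G.natDegree = F.natDegree →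
      IntermediateField.adjoin ℚ {β} = ⊤ → aeval β G = 0 →
      (∀ i, lam ^ i * (R.coeff i : ℂ) = lam ^ ρ * G.coeff i) → ∀ t : Finset (K →ₐ[ℚ] ℂ),
      IsIntegral ℤ ((G.leadingCoeff : ℂ) / l ^ k * ∏ σ ∈ t, lam * σ β) := by
    classical
    intro G R β hG hβ hβ0 hR t
    have h1 := map_eq_C_mul_prod_of_rescaled G (hd.trans hG.symm) hβ hβ0 hlam0 R hR
    rw [hlead G R hG hR, ← Finset.prod_compl_mul_prod t] at h1
    obtain ⟨y, hy⟩ := exists_algebraMap_eq_mul_prod (tᶜ.val.map fun σ => lam * σ β)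
      (t.val.map fun σ => lam * σ β) R _ (by
        rw [Multiset.map_add, Multiset.prod_add, Multiset.map_map, Multiset.map_map]
        exact h1)
    have h2 : (G.leadingCoeff : ℂ) / l ^ k * ∏ σ ∈ t, lam * σ β =
      algebraMap (integralClosure ℤ ℂ) ℂ y := hy.symm
    rw [h2]
    exact y.2
  have hprod : IsIntegral ℤ ((F.leadingCoeff : ℂ) / l ^ k * ((F'.leadingCoeff : ℂ) / l ^ k) *
      ∏ σ : K →ₐ[ℚ] ℂ, (lam * σ α + -(lam * σ α'))) := by
    classical
    rw [Finset.prod_add, Finset.mul_sum]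
    refine IsIntegral.sum _ fun t _ => ?_
    have h1 := (hint F P α rfl hgen hα hP t).mul
      (hint F' P' α' hFF hgen' hα' hP' (Finset.univ \ t))
    have h2 : IsIntegral ℤ ((-1 : ℂ) ^ (Finset.univ \ t).card) :=
      (isIntegral_one.neg).pow _
    convert h1.mul h2 using 1
    rw [Finset.prod_neg]
    ring
  have hnorm : ∏ σ : K →ₐ[ℚ] ℂ, (lam * σ α + -(lam * σ α')) =
      lam ^ F.natDegree * algebraMap ℚ ℂ (Algebra.norm ℚ (α - α')) := by
    rw [Algebra.norm_eq_prod_embeddings]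
    simp only [map_sub, ← sub_eq_add_neg, ← mul_sub, Finset.prod_mul_distrib, Finset.prod_const]
    rw [Finset.card_univ, AlgHom.card, hd]
  rw [hnorm] at hprod
  set q : ℚ := ((F.leadingCoeff : ℚ) / l ^ k) ^ g * ((F'.leadingCoeff : ℚ) / l ^ k) ^ g *
      (l : ℚ) ^ F.natDegree * Algebra.norm ℚ (α - α') ^ g with hq
  have hqint : IsIntegral ℤ (algebraMap ℚ ℂ q) := by
    convert hprod.pow g using 1
    rw [hq]
    simp only [map_mul, map_pow, map_div₀, map_intCast, map_natCast]
    rw [← hlam]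
    ring
  have hq1 : IsIntegral ℤ q := (isIntegral_algebraMap_iff (algebraMap ℚ ℂ).injective).mp hqint
  obtain ⟨z, hz⟩ := IsIntegrallyClosed.isIntegral_iff.mp hq1
  have hq0 : q ≠ 0 := by
    have h1 : ∀ G : ℤ[X], G.natDegree = F.natDegree → G.leadingCoeff ≠ 0 := by
      intro G hG
      refine leadingCoeff_ne_zero.mpr ?_
      rintro rfl
      rw [natDegree_zero] at hG
      have := Module.finrank_pos (R := ℚ) (M := K)
      omega
    have h2 : Algebra.norm ℚ (α - α') ≠ 0 := Algebra.norm_ne_zero_iff.mpr (sub_ne_zero.mpr hne)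
    have h3 : (F.leadingCoeff : ℚ) ≠ 0 := by exact_mod_cast h1 F rfl
    have h4 : (F'.leadingCoeff : ℚ) ≠ 0 := by exact_mod_cast h1 F' hFF
    have h5 : (l : ℚ) ≠ 0 := by exact_mod_cast hl.ne'
    positivity
  rw [← hz] at hq0 ⊢
  rw [eq_intCast, ← Int.cast_abs]
  have : z ≠ 0 := by rintro rfl; simp at hq0
  exact_mod_cast Int.one_le_abs this

namespace RankDesign

open Polynomial

variable {m g ρ : ℕ} (D : RankDesign m g ρ)

theorem ne_of_aeval_eq_zero {K : Type*} [Field K] [NumberField K] {p q l : ℕ} {α β : K}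
    (hp : p.Prime) (hq : q.Prime) (hl : l.Prime) (hpq : p ≠ q) (hpl : p ≠ l) (hql : q ≠ l)
    (hpZ : ¬ p ∣ D.Z) (hqZ : ¬ q ∣ D.Z) (hpr : (D.r.eval 1).natAbs < p)
    (htp : D.IsLarge (D.param (p * D.Q) l)) (htq : D.IsLarge (D.param (q * D.Q) l))
    (hα : aeval α (D.F (p * D.Q) l) = 0) (hβ : aeval β (D.F (q * D.Q) l) = 0) : α ≠ β := by
  rintro rfl
  have hl0 : (l : ℤ) ≠ 0 := by exact_mod_cast hl.ne_zero
  have hm := D.one_lt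
  have hQ := D.one_lt_Q
  have hpp := Nat.prime_iff_prime_int.mp hp
  have key : ∀ r : ℕ, r.Prime → r ≠ l → ¬ r ∣ D.Z → D.IsLarge (D.param (r * D.Q) l) →
      aeval α (D.F (r * D.Q) l) = 0 → (((D.F (r * D.Q) l).leadingCoeff : ℤ) : ℚ) ≠ 0 ∧
      (minpoly ℚ α).eval 1 * (((D.F (r * D.Q) l).leadingCoeff : ℤ) : ℚ) = ((r * D.Q : ℤ) : ℚ) ^ m := by
    intro r hr hrl hrZ ht h0
    have hirr := D.irreducible_F hr hl hrl hrZ ht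
    have h1 : aeval α ((D.F (r * D.Q) l).map (Int.castRingHom ℚ)) = 0 := by
      have := aeval_map_algebraMap ℚ α (D.F (r * D.Q) l)
      rw [h0] at this
      exact this
    have hlc : (((D.F (r * D.Q) l).leadingCoeff : ℤ) : ℚ) =
        ((D.F (r * D.Q) l).map (Int.castRingHom ℚ)).leadingCoeff :=
      (leadingCoeff_map_of_injective (f := Int.castRingHom ℚ) Int.cast_injective _).symm
    have hne : ((D.F (r * D.Q) l).map (Int.castRingHom ℚ)).leadingCoeff ≠ 0 :=
      leadingCoeff_ne_zero.mpr hirr.ne_zero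
    refine ⟨hlc ▸ hne, ?_⟩
    rw [← minpoly.eq_of_irreducible hirr h1, hlc, eval_mul, eval_C, mul_assoc, inv_mul_cancel₀ hne,
      mul_one]
    have := eval_intCast_map (Int.castRingHom ℚ) (D.F (r * D.Q) l) 1
    rw [Int.cast_one, Int.cast_one, F_eval_one] at this
    rw [this]
    simp
  obtain ⟨hne1, h1⟩ := key p hp hpl hpZ htp hα
  obtain ⟨hne2, h2⟩ := key q hq hql hqZ htq hβ
  have h3 : ((p * D.Q : ℤ) ^ m) * (D.F (q * D.Q) l).leadingCoeff =
      ((q * D.Q : ℤ) ^ m) * (D.F (p * D.Q) l).leadingCoeff := by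
    have : ((p * D.Q : ℤ) : ℚ) ^ m * ((D.F (q * D.Q) l).leadingCoeff : ℤ) =
      ((q * D.Q : ℤ) : ℚ) ^ m * ((D.F (p * D.Q) l).leadingCoeff : ℤ) := by
      rw [← h1, ← h2]; ring
    exact_mod_cast this
  rw [D.F_leadingCoeff hl0 (by linarith [htq.1]), D.F_leadingCoeff hl0 (by linarith [htp.1])] at h3
  have hZ0 : (l : ℤ) * (D.E * D.B) ≠ 0 :=
    mul_ne_zero hl0 (by exact_mod_cast (Nat.mul_pos D.E_pos D.B_pos).ne')
  have hQ0 : (D.Q : ℤ) ≠ 0 := by exact_mod_cast (by omega : D.Q ≠ 0)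
  have hm0 : (m : ℤ) ≠ 0 := by exact_mod_cast (by omega : m ≠ 0)
  have h4 : (p : ℤ) ^ m * (q * D.Q - l * D.B * D.r.eval 1) =
      (q : ℤ) ^ m * (p * D.Q - l * D.B * D.r.eval 1) := by
    refine mul_left_cancel₀ (mul_ne_zero (mul_ne_zero (pow_ne_zero m hQ0) hm0)
      (pow_ne_zero (m - 1) hZ0)) ?_
    rw [mul_pow, mul_pow] at h3
    linear_combination h3
  have hpq' : ¬ (p : ℤ) ∣ q ^ m := fun h =>
    hpq ((Nat.prime_dvd_prime_iff_eq hp hq).mp (by exact_mod_cast hpp.dvd_of_dvd_pow h))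
  have h5 : (p : ℤ) ∣ p * D.Q - l * D.B * D.r.eval 1 :=
    (hpp.dvd_or_dvd (h4 ▸ (dvd_pow_self (p : ℤ) (by omega)).mul_right _)).resolve_left hpq'
  have h6 : (p : ℤ) ∣ l * D.B * D.r.eval 1 := (dvd_sub_right (dvd_mul_right _ _)).mp h5
  have h7 : D.r.eval 1 = 0 := by
    rcases hpp.dvd_or_dvd h6 with h | h
    · rcases hpp.dvd_or_dvd h with h | h
      · exact absurd ((Nat.prime_dvd_prime_iff_eq hp hl).mp (by exact_mod_cast h)) hpl
      · exfalso
        have h8 : p ∣ D.Z ^ (ρ + 2) := by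
          rw [← D.E_mul_B]
          exact (Int.natCast_dvd_natCast.mp h).mul_left _
        exact hpZ (hp.dvd_of_dvd_pow h8)
    · by_contra hne
      have := Nat.le_of_dvd (Int.natAbs_pos.mpr hne) (Int.natCast_dvd.mp h)
      omega
  rw [h7, mul_zero, sub_zero, sub_zero] at h4
  have h8 : (p : ℤ) ^ (m - 1) = q ^ (m - 1) := by
    have e : ∀ x : ℤ, x ^ m = x * x ^ (m - 1) := fun x => by
      rw [← pow_succ']; congr 1; omega
    rw [e, e] at h4
    have hp0 : (p : ℤ) ≠ 0 := by exact_mod_cast hp.ne_zero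
    have hq0 : (q : ℤ) ≠ 0 := by exact_mod_cast hq.ne_zero
    refine mul_left_cancel₀ (mul_ne_zero (mul_ne_zero hp0 hq0) hQ0) ?_
    linear_combination h4
  have h9 : p ^ (m - 1) = q ^ (m - 1) := by exact_mod_cast h8
  exact hpq (Nat.pow_left_injective (by omega) h9)

theorem param_sub (s s' l : ℤ) :
    D.param s l - D.param s' l = ((s - s' : ℤ) : ℝ) / (l * (D.E * D.B)) := by
  rw [param, param, ← sub_div]
  push_cast
  ring

theorem exists_card_le {T₁ T₂ : ℝ} (hT : ∀ t, T₁ ≤ t → D.IsLarge t) : ∃ C : ℝ, 1 ≤ C ∧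
    ∀ (l W : ℕ) (P : Finset ℕ), l.Prime → (∀ p ∈ P, p.Prime ∧ p ≠ l ∧ ¬ p ∣ D.Z ∧
      (D.r.eval 1).natAbs < p ∧ D.param (p * D.Q) l ∈ Set.Icc T₁ T₂) →
    (∀ p ∈ P, ∀ q ∈ P, q ≤ p + W) → C * W ≤ l →
    C * (W : ℝ) ^ ((ρ + (m - 1) * g) * g) * (l : ℝ) ^ (2 * g + (ρ + (m - 1) * g)) <
      (l : ℝ) ^ ((ρ + (m - 1) * g) * g) →
    ∀ (K : Type) [Field K] [NumberField K],
      (∀ p ∈ P, ∃ β : K, aeval β (D.F (p * D.Q) l) = 0 ∧ IntermediateField.adjoin ℚ {β} = ⊤) →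
      P.card ≤ (ρ + (m - 1) * g) ^ (ρ + (m - 1) * g) := by
  classical
  obtain ⟨M, η, L, hM, hη, hL, hbd⟩ := exists_family_bounds (m := m) (g := g) (ρ := ρ)
    (by have := D.one_lt; omega) (by have := D.one_lt_g; omega) D.realR_monic D.realR_natDegree
    D.realR_approx (T₁ := T₁) (T₂ := T₂) (hT T₁ le_rfl).1 (fun t ht => (hT t ht).2.2.1)
  have hT1 := (hT T₁ le_rfl).1
  set d := ρ + (m - 1) * g with hd
  have hg := D.one_lt_g
  have hm := D.one_lt
  have hEB : (1 : ℝ) ≤ D.E * D.B := by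
    exact_mod_cast Nat.mul_pos D.E_pos D.B_pos
  have hQ : (1 : ℝ) ≤ D.Q := by exact_mod_cast (by have := D.one_lt_Q; omega : 1 ≤ D.Q)
  set C₀ : ℝ := m * |T₂| * (D.E * D.B) ^ m with hC₀
  set C₁ : ℝ := C₀ ^ g * C₀ ^ g * (2 * L * D.Q) ^ (d * g) with hC₁
  refine ⟨1 + C₁ + D.Q / η, ?_, ?_⟩
  · have : 0 ≤ D.Q / η := by positivity
    have : 0 ≤ C₁ := by positivity
    linarith
  intro l W P hl hP hW hWl hlt K _ _ hK
  by_contra! hcard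
  have hl0 : (l : ℤ) ≠ 0 := by exact_mod_cast hl.ne_zero
  have hlR : (0 : ℝ) < l := by exact_mod_cast hl.pos
  have hPne : P.Nonempty := Finset.card_pos.mp (by omega)
  obtain ⟨p₀, hp₀⟩ := hPne
  choose! β hβ hgen using hK
  have hpar : ∀ p ∈ P, ∀ q ∈ P, |D.param (p * D.Q) l - D.param (q * D.Q) l| ≤ D.Q * W / l := by
    intro p hp q hq
    have h1 : |((p : ℝ) - q)| ≤ W := by
      have h2 : (q : ℝ) ≤ p + W := by exact_mod_cast hW p hp q hq
      have h3 : (p : ℝ) ≤ q + W := by exact_mod_cast hW q hq p hp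
      rw [abs_le]; constructor <;> linarith
    rw [D.param_sub]
    have h4 : (((p * D.Q - q * D.Q : ℤ)) : ℝ) / ((l : ℤ) * (D.E * D.B)) =
        (D.Q * (p - q) / l) / (D.E * D.B) := by
      push_cast
      field_simp
    rw [h4, abs_div, abs_of_nonneg (by positivity : (0 : ℝ) ≤ D.E * D.B)]
    refine (div_le_self (abs_nonneg _) hEB).trans ?_
    rw [abs_div, abs_mul, abs_of_nonneg (by positivity : (0 : ℝ) ≤ D.Q), abs_of_pos hlR]
    gcongr
  have hηle : D.Q * W / l ≤ η := by
    rw [div_le_iff₀ hlR]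
    have h1 : (1 + C₁ + D.Q / η) * W ≥ D.Q / η * W := by
      have : 0 ≤ C₁ := by positivity
      gcongr
      linarith
    have h2 : D.Q / η * W ≤ l := h1.trans hWl
    rw [div_mul_eq_mul_div, div_le_iff₀ hη] at h2
    linarith
  set f₀ := D.family (D.param (p₀ * D.Q) l) with hf₀
  have hp₀' := hP p₀ hp₀
  have ht₀ : D.param (p₀ * D.Q) l ≠ 0 := by
    have := hp₀'.2.2.2.2.1
    linarith
  have hf₀d : f₀.natDegree = d := (D.family_natDegree ht₀).1
  have hf₀0 : f₀ ≠ 0 := by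
    intro h
    rw [h, natDegree_zero] at hf₀d
    have := D.degree_pos
    omega
  set R : Finset ℂ := (f₀.aroots ℂ).toFinset with hR
  have hRcard : R.card ≤ d := by
    refine (Multiset.toFinset_card_le _).trans ?_
    rw [← hf₀d, aroots_def]
    refine (card_roots' _).trans natDegree_map_le
  have hlabel : ∀ p ∈ P, ∀ σ : K →ₐ[ℚ] ℂ, ∃ x : ℂ, x ∈ R ∧ ‖σ (β p) - x‖ ≤ L * (D.Q * W / l) := by
    intro p hp σ
    have h1 := hpar p₀ hp₀ p hp
    obtain ⟨x, hx, hxx⟩ := (hbd _ hp₀'.2.2.2.2).2.2 _ (hP p hp).2.2.2.2 (h1.trans hηle) (σ (β p))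
      (D.complex_embedding_root hl0 (hβ p hp) (σ : K →+* ℂ))
    refine ⟨x, ?_, hxx.trans (by gcongr)⟩
    rw [hR, Multiset.mem_toFinset, mem_aroots]
    exact ⟨hf₀0, hx⟩
  choose! lab hlabR hlab using hlabel
  have hfin : Fintype.card (K →ₐ[ℚ] ℂ) ≤ d := by
    have h := D.finrank_eq hl0 ht₀ (D.irreducible_F hp₀'.1 hl hp₀'.2.1 hp₀'.2.2.1
      (hT _ hp₀'.2.2.2.2.1)) (hβ p₀ hp₀) (hgen p₀ hp₀)
    rw [AlgHom.card, h]
  have hd0 : 0 < d := lt_trans one_pos D.degree_pos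
  obtain ⟨p, hp, q, hq, hpq, hlabpq⟩ := Finset.exists_ne_map_eq_of_card_lt_of_maps_to
    (s := P) (t := Fintype.piFinset fun _ : K →ₐ[ℚ] ℂ => R) (f := lab) (by
      refine lt_of_le_of_lt ?_ hcard
      rw [Fintype.card_piFinset, Finset.prod_const, Finset.card_univ]
      calc R.card ^ _ ≤ d ^ Fintype.card (K →ₐ[ℚ] ℂ) := Nat.pow_le_pow_left hRcard _
        _ ≤ d ^ d := Nat.pow_le_pow_right hd0 hfin)
    (fun p hp => by
      rw [Finset.mem_coe] at hp
      simpa using hlabR p hp)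
  obtain ⟨hpp, hpl, hpZ, hpr, hpT⟩ := hP p hp
  obtain ⟨hqp, hql, hqZ, hqr, hqT⟩ := hP q hq
  have htp := hT _ hpT.1
  have htq := hT _ hqT.1
  have hne := D.ne_of_aeval_eq_zero hpp hqp hl hpq hpl hql hpZ hqZ hpr htp htq (hβ p hp) (hβ q hq)
  obtain ⟨lam, hlam⟩ := IsAlgClosed.exists_pow_nat_eq (l : ℂ) (n := g) (by omega)
  obtain ⟨A, hA⟩ := D.exists_rescaled_coeff (s := p * D.Q) (l := l) (lam := lam) (by simpa using hlam)
  obtain ⟨A', hA'⟩ := D.exists_rescaled_coeff (s := q * D.Q) (l := l) (lam := lam) (by simpa using hlam)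
  have hparne : ∀ {s : ℤ}, D.IsLarge (D.param s l) → D.param s l ≠ 0 := fun h => by linarith [h.1]
  have hdp := D.F_natDegree (s := p * D.Q) hl0 (hparne htp)
  have hdq := D.F_natDegree (s := q * D.Q) hl0 (hparne htq)
  have hfr : Module.finrank ℚ K = ρ + (m - 1) * g :=
    D.finrank_eq hl0 (hparne htp) (D.irreducible_F hpp hl hpl hpZ htp) (hβ p hp) (hgen p hp)
  have hmain := NumberField.one_le_abs_norm_sub_of_rescaled (D.F (p * D.Q) l) (D.F (q * D.Q) l)
    (hfr.trans hdp.symm) (hfr.trans hdq.symm) (hgen p hp) (hgen q hq) (hβ p hp) (hβ q hq) hne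
    hl.pos (by omega) hdp hlam A A' hA hA'
  rw [hdp, ← hd] at hmain
  have hmainR : (1 : ℝ) ≤ |(((D.F (p * D.Q) l).leadingCoeff : ℝ) / l ^ (m - 1))| ^ g *
      |(((D.F (q * D.Q) l).leadingCoeff : ℝ) / l ^ (m - 1))| ^ g * (l : ℝ) ^ d *
      |((Algebra.norm ℚ (β p - β q) : ℚ) : ℝ)| ^ g := by
    have h1 : ((1 : ℚ) : ℝ) ≤ _ := Rat.cast_le.mpr hmain
    rw [Rat.cast_abs] at h1
    push_cast at h1
    rw [abs_mul, abs_mul, abs_mul, abs_pow, abs_pow, abs_pow, abs_pow, Nat.abs_cast] at h1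
    exact h1
  have hlc : ∀ s : ℤ, D.param s l ∈ Set.Icc T₁ T₂ →
      |(((D.F s l).leadingCoeff : ℝ) / l ^ (m - 1))| ≤ C₀ * l := by
    intro s hs
    have hs0 : D.param s l ≠ 0 := by linarith [hs.1]
    have h1 : (((D.F s l).leadingCoeff : ℝ) / l ^ (m - 1)) =
        m * D.param s l * (D.E * D.B) ^ m * l := by
      rw [D.F_leadingCoeff hl0 hs0, param, div_eq_iff (by positivity)]
      have hmm : ((D.E : ℝ) * D.B) ^ m = (D.E * D.B) ^ (m - 1) * (D.E * D.B) := by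
        rw [← pow_succ]; congr 1; omega
      rw [hmm]
      push_cast
      have hE : (D.E : ℝ) ≠ 0 := by exact_mod_cast D.E_pos.ne'
      have hB : (D.B : ℝ) ≠ 0 := by exact_mod_cast D.B_pos.ne'
      field_simp
      ring
    have h2 : |D.param s l| ≤ |T₂| := by
      rw [abs_of_nonneg (by linarith [hs.1])]
      exact hs.2.trans (le_abs_self _)
    rw [h1, abs_mul, abs_mul, abs_mul, Nat.abs_cast, Nat.abs_cast, abs_of_nonneg
      (by positivity : (0 : ℝ) ≤ (D.E * D.B) ^ m), hC₀]
    gcongr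
  have hnorm : |((Algebra.norm ℚ (β p - β q) : ℚ) : ℝ)| ≤ (2 * L * D.Q * (W / l)) ^ d := by
    have h1 : |((Algebra.norm ℚ (β p - β q) : ℚ) : ℝ)| =
        ‖algebraMap ℚ ℂ (Algebra.norm ℚ (β p - β q))‖ := by
      rw [eq_ratCast, Complex.norm_ratCast]
    rw [h1, Algebra.norm_eq_prod_embeddings, norm_prod]
    have h2 : d = (Finset.univ : Finset (K →ₐ[ℚ] ℂ)).card := by
      rw [Finset.card_univ, AlgHom.card, hfr]
    rw [h2, ← Finset.prod_const]
    refine Finset.prod_le_prod (fun σ _ => norm_nonneg _) fun σ _ => ?_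
    have h3 := hlab p hp σ
    have h4 := hlab q hq σ
    rw [hlabpq] at h3
    calc ‖σ (β p - β q)‖ = ‖(σ (β p) - lab q σ) - (σ (β q) - lab q σ)‖ := by
          rw [map_sub]; congr 1; ring
      _ ≤ ‖σ (β p) - lab q σ‖ + ‖σ (β q) - lab q σ‖ := norm_sub_le _ _
      _ ≤ L * (D.Q * W / l) + L * (D.Q * W / l) := add_le_add h3 h4
      _ = 2 * L * D.Q * (W / l) := by ring
  have hfinal : (1 : ℝ) ≤ (C₀ * l) ^ g * (C₀ * l) ^ g * (l : ℝ) ^ d *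
      ((2 * L * D.Q * (W / l)) ^ d) ^ g := by
    refine hmainR.trans ?_
    gcongr
    · exact hlc _ hpT
    · exact hlc _ hqT
  have hexp : (C₀ * l) ^ g * (C₀ * l) ^ g * (l : ℝ) ^ d * ((2 * L * D.Q * (W / l)) ^ d) ^ g =
      C₁ * (W : ℝ) ^ (d * g) * (l : ℝ) ^ (2 * g + d) / (l : ℝ) ^ (d * g) := by
    rw [hC₁, ← pow_mul, mul_pow (2 * L * D.Q) (W / l : ℝ), div_pow]
    ring
  rw [hexp, le_div_iff₀ (by positivity), one_mul] at hfinal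
  have hC1le : C₁ ≤ 1 + C₁ + D.Q / η := by
    have : 0 ≤ D.Q / η := by positivity
    linarith
  have : C₁ * (W : ℝ) ^ (d * g) * (l : ℝ) ^ (2 * g + d) ≤
      (1 + C₁ + D.Q / η) * (W : ℝ) ^ (d * g) * (l : ℝ) ^ (2 * g + d) := by gcongr
  linarith

end RankDesign

theorem exists_le_card_primes_Ioc : ∃ N₀ : ℕ, ∀ N : ℕ, N₀ ≤ N →
    (N : ℝ) / (2 * Real.log N) ≤ ((Finset.Ioc N (8 * N)).filter Nat.Prime).card := by
  have hlo : ∀ᶠ x : ℝ in Filter.atTop, Real.log x ≤ 1 / 64 * √x := by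
    filter_upwards [(isLittleO_log_rpow_atTop (r := 1 / 2) (by norm_num)).bound
      (show (0 : ℝ) < 1 / 64 by norm_num), Filter.eventually_ge_atTop 1] with x hx hx1
    rw [Real.sqrt_eq_rpow]
    refine (le_abs_self _).trans (hx.trans_eq ?_)
    rw [Real.norm_of_nonneg (by positivity)]
  obtain ⟨x₀, hx₀⟩ := Filter.eventually_atTop.mp hlo
  refine ⟨⌈x₀⌉₊ + 8, fun N hN => ?_⟩
  have hN8 : (8 : ℝ) ≤ N := by exact_mod_cast (show 8 ≤ N by omega)
  have hNx : x₀ ≤ N := (Nat.le_ceil x₀).trans (by exact_mod_cast (show ⌈x₀⌉₊ ≤ N by omega))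
  have hlogN : 0 < Real.log N := Real.log_pos (by linarith)
  have h8 : Real.log ((8 * N : ℕ) : ℝ) ≤ 2 * Real.log N := by
    rw [← Real.log_rpow (by linarith)]
    refine Real.log_le_log (by push_cast; linarith) ?_
    push_cast
    rw [show ((2 : ℝ)) = ((2 : ℕ) : ℝ) by norm_num, Real.rpow_natCast]
    nlinarith
  have hl8 := hx₀ ((8 * N : ℕ) : ℝ) (by push_cast; linarith)
  have hs : √((8 * N : ℕ) : ℝ) * √((8 * N : ℕ) : ℝ) = 8 * N := by
    rw [Real.mul_self_sqrt (by positivity)]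
    push_cast
    ring
  have hs1 : 1 ≤ √((8 * N : ℕ) : ℝ) := by
    rw [Real.one_le_sqrt]
    push_cast
    linarith
  have hl1 : Real.log (((8 * N : ℕ) : ℝ) + 1) ≤ 2 * Real.log ((8 * N : ℕ) : ℝ) := by
    rw [← Real.log_rpow (by push_cast; linarith)]
    refine Real.log_le_log (by positivity) ?_
    rw [show ((2 : ℝ)) = ((2 : ℕ) : ℝ) by norm_num, Real.rpow_natCast]
    push_cast
    nlinarith
  have hge := Chebyshev.theta_ge (8 * N)
  have hle := Chebyshev.theta_le_log4_mul_x (x := (N : ℝ)) (by linarith)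
  have hlog4 : Real.log 4 = 2 * Real.log 2 := by
    rw [show (4 : ℝ) = 2 ^ 2 by norm_num, Real.log_pow]
    norm_num
  have hlog2 := Real.log_two_gt_d9
  have hsub : Chebyshev.theta ((8 * N : ℕ) : ℝ) - Chebyshev.theta (N : ℝ) ≤
      ((Finset.Ioc N (8 * N)).filter Nat.Prime).card * (2 * Real.log N) := by
    have hunion : (Finset.Ioc 0 (8 * N)).filter Nat.Prime =
        (Finset.Ioc 0 N).filter Nat.Prime ∪ (Finset.Ioc N (8 * N)).filter Nat.Prime := by
      rw [← Finset.filter_union, Finset.Ioc_union_Ioc_eq_Ioc (Nat.zero_le _) (by omega)]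
    have hdisj : Disjoint ((Finset.Ioc 0 N).filter Nat.Prime)
        ((Finset.Ioc N (8 * N)).filter Nat.Prime) := by
      refine Finset.disjoint_filter_filter ?_
      rw [Finset.disjoint_left]
      intro x hx hx'
      rw [Finset.mem_Ioc] at hx hx'
      omega
    rw [Chebyshev.theta, Chebyshev.theta, Nat.floor_natCast, Nat.floor_natCast, hunion,
      Finset.sum_union hdisj, add_sub_cancel_left, ← nsmul_eq_mul]
    refine Finset.sum_le_card_nsmul _ _ _ fun p hp => ?_
    rw [Finset.mem_filter, Finset.mem_Ioc] at hp
    refine le_trans (Real.log_le_log (by exact_mod_cast hp.2.pos) ?_) h8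
    exact_mod_cast hp.1.2
  rw [div_le_iff₀ (by positivity)]
  refine le_trans ?_ hsub
  rw [hlog4] at hle
  have h3 : 2 * √((8 * N : ℕ) : ℝ) * Real.log ((8 * N : ℕ) : ℝ) ≤
      2 * √((8 * N : ℕ) : ℝ) * (1 / 64 * √((8 * N : ℕ) : ℝ)) :=
    mul_le_mul_of_nonneg_left hl8 (by positivity)
  have h4 : √((8 * N : ℕ) : ℝ) ≤ 8 * N := by nlinarith
  push_cast at *
  nlinarith

theorem exists_primes_window : ∃ N₀ : ℕ, ∀ M W : ℕ, N₀ ≤ M → 1 ≤ W → W ≤ M →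
    ∃ P : Finset ℕ, (∀ p ∈ P, p.Prime ∧ M < p ∧ p ≤ 8 * M) ∧ (∀ p ∈ P, ∀ q ∈ P, q ≤ p + W) ∧
      (W : ℝ) / (18 * Real.log M) ≤ P.card ∧ P.Nonempty := by
  obtain ⟨N₀, hN₀⟩ := exists_le_card_primes_Ioc
  refine ⟨N₀ + 2, fun M W hM hW hWM => ?_⟩
  have hlog : 0 < Real.log M := Real.log_pos (by exact_mod_cast (show 1 < M by omega))
  have hcard := hN₀ M (by omega)
  set A := (Finset.Ioc M (8 * M)).filter Nat.Prime with hA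
  have hW0 : (0 : ℝ) < W := by exact_mod_cast hW
  have hmaps : ∀ p ∈ A, p / W ∈ Finset.range (8 * M / W + 1) := by
    intro p hp
    rw [hA, Finset.mem_filter, Finset.mem_Ioc] at hp
    rw [Finset.mem_range, Nat.lt_succ_iff]
    exact Nat.div_le_div_right hp.1.2
  obtain ⟨k, -, hk⟩ := Finset.exists_le_card_fiber_of_nsmul_le_card_of_maps_to hmaps
    (b := (W : ℝ) / (18 * Real.log M)) (by simp) (by
      refine le_trans ?_ hcard
      rw [Finset.card_range, nsmul_eq_mul]
      have h1 : ((8 * M / W + 1 : ℕ) : ℝ) ≤ 9 * M / W := by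
        rw [le_div_iff₀ hW0]
        have h2 : 8 * M / W * W ≤ 8 * M := Nat.div_mul_le_self _ _
        have h3 : (8 * M / W + 1) * W ≤ 9 * M := by nlinarith
        exact_mod_cast h3
      refine (mul_le_mul_of_nonneg_right h1 (by positivity)).trans_eq ?_
      field_simp
      ring)
  refine ⟨A.filter fun p => p / W = k, ?_, ?_, hk, ?_⟩
  · intro p hp
    rw [Finset.mem_filter, hA, Finset.mem_filter, Finset.mem_Ioc] at hp
    exact ⟨hp.1.2, hp.1.1⟩
  · intro p hp q hq
    rw [Finset.mem_filter] at hp hq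
    have h1 := Nat.div_add_mod p W
    have h2 := Nat.div_add_mod q W
    have h3 := Nat.mod_lt q hW
    rw [hp.2] at h1
    rw [hq.2] at h2
    omega
  · rw [← Finset.card_pos]
    have : (0 : ℝ) < W / (18 * Real.log M) := by positivity
    exact_mod_cast this.trans_le hk

theorem Finset.exists_subset_pairwise_not_rel {α β : Type*} [DecidableEq β] (L P : Finset α)
    (k : α → α → β) (r : Setoid β) {a b : ℕ}
    (ha : ∀ y, ∀ A ⊆ L, (∀ l ∈ A, ∃ p ∈ P, r (k l p) y) → A.card ≤ a)
    (hb : ∀ y, ∀ l ∈ L, ∀ B ⊆ P, (∀ p ∈ B, r (k l p) y) → B.card ≤ b) :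
    ∃ S : Finset β, (∀ x ∈ S, ∃ l ∈ L, ∃ p ∈ P, k l p = x) ∧ (∀ x ∈ S, ∀ y ∈ S, r x y → x = y) ∧
      L.card * P.card ≤ a * b * S.card := by
  classical
  set A := (L ×ˢ P).image fun x => k x.1 x.2 with hA
  obtain ⟨S, hSA, hinj, him⟩ := Finset.exists_subset_injOn_image_eq_of_surjOn (s := (A : Set β))
    (f := fun x => (Quotient.mk r x)) (A.image fun x => Quotient.mk r x)
    (by intro y hy; simpa using hy)
  refine ⟨S, ?_, ?_, ?_⟩
  · intro x hx
    have := hSA hx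
    rw [Finset.mem_coe, hA, Finset.mem_image] at this
    obtain ⟨⟨l, p⟩, hlp, rfl⟩ := this
    rw [Finset.mem_product] at hlp
    exact ⟨l, hlp.1, p, hlp.2, rfl⟩
  · intro x hx y hy hxy
    exact hinj hx hy (Quotient.sound hxy)
  · have hScard : S.card = ((L ×ˢ P).image fun x => Quotient.mk r (k x.1 x.2)).card := by
      rw [← Finset.card_image_of_injOn hinj, him, hA, Finset.image_image]
      rfl
    rw [← Finset.card_product, hScard]
    refine Finset.card_le_mul_card_image _ _ fun c _ => ?_
    induction c using Quotient.inductionOn with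
    | _ y =>
      set G := (L ×ˢ P).filter fun x => Quotient.mk r (k x.1 x.2) = Quotient.mk r y with hG
      have hmem : ∀ x ∈ G, (x.1 ∈ L ∧ x.2 ∈ P) ∧ r (k x.1 x.2) y := by
        intro x hx
        rw [hG, Finset.mem_filter, Finset.mem_product] at hx
        exact ⟨hx.1, Quotient.exact hx.2⟩
      have h1 : G.card ≤ b * (G.image Prod.fst).card := by
        refine Finset.card_le_mul_card_image _ _ fun l hl => ?_
        rw [Finset.mem_image] at hl
        obtain ⟨x, hx, rfl⟩ := hl
        refine le_trans (Finset.card_le_card_of_injOn (t := P.filter fun p => r (k x.1 p) y)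
          Prod.snd ?_ ?_) (hb y x.1 (hmem x hx).1.1 _ (Finset.filter_subset _ _) ?_)
        · intro z hz
          rw [Finset.mem_coe, Finset.mem_filter] at hz ⊢
          obtain ⟨hz, h⟩ := hz
          have := hmem z hz
          rw [h] at this
          exact ⟨this.1.2, this.2⟩
        · intro z hz w hw h
          rw [Finset.mem_coe, Finset.mem_filter] at hz hw
          exact Prod.ext (hz.2.trans hw.2.symm) h
        · intro p hp
          exact (Finset.mem_filter.mp hp).2
      refine h1.trans ?_
      rw [mul_comm a b]
      refine Nat.mul_le_mul_left _ (ha y _ ?_ ?_)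
      · intro l hl
        obtain ⟨x, hx, rfl⟩ := Finset.mem_image.mp hl
        exact (hmem x hx).1.1
      · intro l hl
        obtain ⟨x, hx, rfl⟩ := Finset.mem_image.mp hl
        exact ⟨x.2, (hmem x hx).1.2, (hmem x hx).2⟩

open Polynomial in
theorem exists_root_and_adjoin_eq_top_of_ringEquiv {K L : Type*} [Field K] [CharZero K] [Field L]
    [CharZero L] (e : K ≃+* L) {f : ℤ[X]}
    (h : ∃ α : K, aeval α f = 0 ∧ IntermediateField.adjoin ℚ {α} = ⊤) :
    ∃ β : L, aeval β f = 0 ∧ IntermediateField.adjoin ℚ {β} = ⊤ := by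
  obtain ⟨α, h0, htop⟩ := h
  refine ⟨e α, ?_, ?_⟩
  · have := aeval_algHom_apply (e : K →+* L).toIntAlgHom α f
    rw [h0, map_zero] at this
    exact this
  · have h1 := IntermediateField.adjoin_map ℚ {α} (e : K →+* L).toRatAlgHom
    rw [htop, Set.image_singleton] at h1
    refine eq_top_iff.mpr fun x _ => ?_
    have h2 : x ∈ IntermediateField.map (e : K →+* L).toRatAlgHom ⊤ := by
      rw [IntermediateField.mem_map]
      exact ⟨e.symm x, IntermediateField.mem_top, e.apply_symm_apply x⟩
    rw [h1] at h2
    exact h2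

open Polynomial in
theorem exists_subfield_generated {f : ℤ[X]} (hf : 0 < f.natDegree) : ∃ K : Subfield ℂ,
    NumberField K ∧ ∃ α : K, aeval α f = 0 ∧ IntermediateField.adjoin ℚ {α} = ⊤ := by
  have hinj : Function.Injective (algebraMap ℤ ℂ) := Int.cast_injective
  have hinjQ : Function.Injective (algebraMap ℤ ℚ) := Int.cast_injective
  obtain ⟨α, hα⟩ := IsAlgClosed.exists_aeval_eq_zero ℂ f (by
    exact (natDegree_pos_iff_degree_pos.mp hf).ne')
  have hint : IsIntegral ℚ α := by
    rw [← isAlgebraic_iff_isIntegral]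
    refine ⟨f.map (algebraMap ℤ ℚ), ?_, ?_⟩
    · rw [Ne, Polynomial.map_eq_zero_iff hinjQ]
      rintro rfl
      simp at hf
    · rw [aeval_map_algebraMap, hα]
  set E := IntermediateField.adjoin ℚ {α} with hE
  have hfin : FiniteDimensional ℚ E := IntermediateField.adjoin.finiteDimensional hint
  have hnf : NumberField E := ⟨⟩
  let e : E ≃+* E.toSubfield :=
    { toFun := fun x => ⟨x.1, x.2⟩
      invFun := fun x => ⟨x.1, x.2⟩
      left_inv := fun _ => rfl
      right_inv := fun _ => rfl
      map_mul' := fun _ _ => rfl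
      map_add' := fun _ _ => rfl }
  refine ⟨E.toSubfield, NumberField.of_ringEquiv _ _ e, exists_root_and_adjoin_eq_top_of_ringEquiv e
    ⟨IntermediateField.AdjoinSimple.gen ℚ α, ?_, ?_⟩⟩
  · have hEinj : Function.Injective (algebraMap E ℂ) := (algebraMap E ℂ).injective
    refine hEinj ?_
    rw [map_zero, ← aeval_algebraMap_apply, IntermediateField.AdjoinSimple.algebraMap_gen, hα]
  · refine eq_top_iff.mpr fun x _ => ?_
    have h1 := IntermediateField.adjoin_map ℚ {IntermediateField.AdjoinSimple.gen ℚ α} E.val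
    rw [Set.image_singleton, show E.val (IntermediateField.AdjoinSimple.gen ℚ α) = α from rfl] at h1
    have hx := h1.ge x.2
    rw [IntermediateField.mem_map] at hx
    obtain ⟨y, hy, hyx⟩ := hx
    exact (Subtype.ext hyx : y = x) ▸ hy

namespace RankDesign

open Polynomial

variable {m g ρ : ℕ} (D : RankDesign m g ρ)

theorem exists_param_mem_Icc (T : ℝ) : ∃ (lam : ℕ) (T₂ : ℝ), 8 ≤ lam ∧ ∀ N l p : ℕ, 0 < N →
    N < l → l ≤ 8 * N → lam * N < p → p ≤ 8 * (lam * N) →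
    D.param (p * D.Q) l ∈ Set.Icc T T₂ := by
  have hEB : (1 : ℝ) ≤ D.E * D.B := by
    exact_mod_cast Nat.mul_pos D.E_pos D.B_pos
  have hQ : (1 : ℝ) ≤ D.Q := by exact_mod_cast (by have := D.one_lt_Q; omega : 1 ≤ D.Q)
  set a : ℝ := D.E * D.B with ha
  set c : ℝ := D.B * ((D.r.eval 1 : ℤ) : ℝ) with hc
  set lam := 8 + ⌈8 * (a * |T| + |c|)⌉₊ with hlam
  have hlam1 : 8 * (a * |T| + |c|) ≤ lam := by
    refine (Nat.le_ceil _).trans ?_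
    exact_mod_cast (by omega : ⌈8 * (a * |T| + |c|)⌉₊ ≤ lam)
  refine ⟨lam, 8 * lam * D.Q + |c|, by omega, fun N l p hN hNl hl hp hp' => ?_⟩
  have hl0 : (0 : ℝ) < l := by exact_mod_cast hN.trans hNl
  have h1 : (l : ℝ) ≤ 8 * N := by exact_mod_cast hl
  have h2 : (lam : ℝ) * N < p := by exact_mod_cast hp
  have h3 : (p : ℝ) ≤ 8 * (lam * N) := by exact_mod_cast hp'
  have h4 : (N : ℝ) < l := by exact_mod_cast hNl
  have hlam0 : (0 : ℝ) ≤ lam := by positivity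
  have hp0 : (0 : ℝ) ≤ p := by positivity
  have hcast : D.param (p * D.Q) l = (p * D.Q - l * c) / (l * a) := by
    rw [param, ha, hc]
    push_cast
    ring
  rw [hcast, Set.mem_Icc, le_div_iff₀ (by positivity), div_le_iff₀ (by positivity)]
  constructor
  · have h5 : 8 * (a * |T| + |c|) * l ≤ lam * l := mul_le_mul_of_nonneg_right hlam1 hl0.le
    have h6 : (lam : ℝ) * l ≤ lam * (8 * N) := mul_le_mul_of_nonneg_left h1 hlam0
    have h7 : (p : ℝ) ≤ p * D.Q := by nlinarith
    have h8 : T * (l * a) ≤ |T| * (l * a) :=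
      mul_le_mul_of_nonneg_right (le_abs_self T) (by positivity)
    have h9 : l * c ≤ l * |c| := mul_le_mul_of_nonneg_left (le_abs_self c) hl0.le
    linarith
  · have h5 : (p : ℝ) * D.Q ≤ 8 * (lam * l) * D.Q := by
      refine mul_le_mul_of_nonneg_right (h3.trans ?_) (by linarith)
      have := mul_le_mul_of_nonneg_left h4.le hlam0
      linarith
    have h9 : l * -|c| ≤ l * c := mul_le_mul_of_nonneg_left (neg_abs_le c) hl0.le
    have h10 : (8 * lam * D.Q + |c|) * (l * 1) ≤ (8 * lam * D.Q + |c|) * (l * a) := by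
      gcongr
    linarith

theorem exists_fields {m g ρ : ℕ} (D : RankDesign m g ρ) (hρ : ρ + 2 ≤ m) : ∃ (C : ℝ) (lam N₀ : ℕ), 1 ≤ C ∧ 8 ≤ lam ∧
    ∀ (N W : ℕ) (P : Finset ℕ), N₀ ≤ N →
    (∀ p ∈ P, p.Prime ∧ lam * N < p ∧ p ≤ 8 * (lam * N)) →
    (∀ p ∈ P, ∀ q ∈ P, q ≤ p + W) →
    (P.card ≤ 1 ∨ (C * W ≤ N ∧ 2 * g + (ρ + (m - 1) * g) ≤ (ρ + (m - 1) * g) * g ∧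
      C * (W : ℝ) ^ ((ρ + (m - 1) * g) * g) * (N : ℝ) ^ (2 * g + (ρ + (m - 1) * g)) <
        (N : ℝ) ^ ((ρ + (m - 1) * g) * g))) →
    ∃ S : Finset (Subfield ℂ), (∀ K ∈ S, ∀ L ∈ S, Nonempty (K ≃+* L) → K = L) ∧
      (∀ K ∈ S, Module.finrank ℚ K = ρ + (m - 1) * g ∧ NumberField K ∧ ∀ [NumberField K],
        |(NumberField.discr K : ℝ)| ≤
          C * (N : ℝ) ^ (∑ j ∈ Finset.range (ρ + (m - 1) * g - 1), 2 * (m - ((j + 1) - ρ) / g)) ∧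
        ∀ r : ℕ, (r = 0 ∨ r + m ≤ (ρ + (m - 1) * g + 1) / 2 + g + (if ρ = 0 then 0 else 1)) →
          ∃ f : (Fin r → ZMod m) →+ Additive (ClassGroup (NumberField.RingOfIntegers K)),
            Function.Injective f) ∧
      (((Finset.Ioc N (8 * N)).filter Nat.Prime).card : ℝ) * P.card ≤ C * S.card := by
  classical
  obtain ⟨T, hT⟩ := D.exists_isLarge
  obtain ⟨lam, T₂, hlam, hparam⟩ := D.exists_param_mem_Icc T
  have hg := D.one_lt_g
  have hm := D.one_lt
  obtain ⟨M, η, L₀, hM, hη, hL₀, hbd⟩ := exists_family_bounds (m := m) (g := g) (ρ := ρ)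
    (by omega) (by omega) D.realR_monic D.realR_natDegree
    D.realR_approx (T₁ := T) (T₂ := T₂) (hT T le_rfl).1 (fun t ht => (hT t ht).2.2.1)
  obtain ⟨C₂, hC₂, hcard⟩ := D.exists_card_le (T₂ := T₂) hT
  have hd1 := D.degree_pos
  set d := ρ + (m - 1) * g with hd
  set e := ∑ j ∈ Finset.range (d - 1), 2 * (m - ((j + 1) - ρ) / g) with he
  set C₁ : ℝ := (d.factorial * (d * (M * (D.E * D.B) ^ m) ^ (d + 1)) ^ d) ^ 2 with hC₁
  have hC₁0 : 0 ≤ C₁ := by positivity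
  set C : ℝ := C₁ * 8 ^ e + C₂ + e * d ^ d with hC
  have hC1 : C₁ * 8 ^ e ≤ C := by
    have : (0 : ℝ) ≤ e * d ^ d := by positivity
    linarith
  have hC2 : C₂ ≤ C := by
    have : (0 : ℝ) ≤ e * d ^ d := by positivity
    have : 0 ≤ C₁ * 8 ^ e := by positivity
    linarith
  have hC3 : e * (d : ℝ) ^ d ≤ C := by
    have : 0 ≤ C₁ * 8 ^ e := by positivity
    linarith
  refine ⟨C, lam, D.Z + D.Q + (D.r.eval 1).natAbs + ⌈C⌉₊ + 1, hC₂.trans hC2, hlam, ?_⟩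
  intro N W P hN hP hW hcases
  have hN0 : 0 < N := by omega
  have hNC : C < N := (Nat.le_ceil C).trans_lt (by exact_mod_cast (by omega : ⌈C⌉₊ < N))
  have hN1 : (1 : ℝ) ≤ N := by exact_mod_cast hN0
  set A := (Finset.Ioc N (8 * N)).filter Nat.Prime with hA
  have hAmem : ∀ l ∈ A, l.Prime ∧ N < l ∧ l ≤ 8 * N := by
    intro l hl
    rw [hA, Finset.mem_filter, Finset.mem_Ioc] at hl
    exact ⟨hl.2, hl.1⟩
  have hlZ : ∀ l ∈ A, ¬ l ∣ D.Z := fun l hl h => by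
    have := Nat.le_of_dvd D.Z_pos h
    have := hAmem l hl
    omega
  have hlQ : ∀ l ∈ A, ¬ l ∣ D.Q := fun l hl h => by
    have := Nat.le_of_dvd (by have := D.one_lt_Q; omega) h
    have := hAmem l hl
    omega
  have hp8 : ∀ p ∈ P, 8 * N < p := fun p hp => by
    have h1 := (hP p hp).2.1
    have h2 : 8 * N ≤ lam * N := Nat.mul_le_mul_right _ hlam
    omega
  have hpl : ∀ l ∈ A, ∀ p ∈ P, p ≠ l := fun l hl p hp => by
    have h1 := hp8 p hp
    have := hAmem l hl
    omega
  have hpZ : ∀ p ∈ P, ¬ p ∣ D.Z := fun p hp h => by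
    have := Nat.le_of_dvd D.Z_pos h
    have := hp8 p hp
    omega
  have hmem : ∀ l ∈ A, ∀ p ∈ P, D.param (p * D.Q) l ∈ Set.Icc T T₂ := fun l hl p hp =>
    hparam N l p hN0 (hAmem l hl).2.1 (hAmem l hl).2.2 (hP p hp).2.1 (hP p hp).2.2
  have hlarge : ∀ l ∈ A, ∀ p ∈ P, D.IsLarge (D.param (p * D.Q) l) := fun l hl p hp =>
    hT _ (hmem l hl p hp).1
  have hl0 : ∀ l ∈ A, (l : ℤ) ≠ 0 := fun l hl => by exact_mod_cast (hAmem l hl).1.ne_zero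
  have hs0 : ∀ l ∈ A, ∀ p ∈ P, D.param (p * D.Q) l ≠ 0 := fun l hl p hp =>
    (zero_lt_one.trans_le (hlarge l hl p hp).1).ne'
  have hk : ∀ l p : ℕ, ∃ K : Subfield ℂ, l ∈ A → p ∈ P → NumberField K ∧
      ∃ α : K, aeval α (D.F (p * D.Q) l) = 0 ∧ IntermediateField.adjoin ℚ {α} = ⊤ := by
    intro l p
    by_cases h : l ∈ A ∧ p ∈ P
    · obtain ⟨K, h1, h2⟩ := exists_subfield_generated (f := D.F (p * D.Q) l) (by
        rw [D.F_natDegree (hl0 l h.1) (hs0 l h.1 p h.2)]; omega)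
      exact ⟨K, fun _ _ => ⟨h1, h2⟩⟩
    · exact ⟨⊤, fun h1 h2 => (h ⟨h1, h2⟩).elim⟩
  choose k hk using hk
  have hkdeg : ∀ l ∈ A, ∀ p ∈ P, Module.finrank ℚ (k l p) = d := by
    intro l hl p hp
    obtain ⟨hnf, α, h0, htop⟩ := hk l p hl hp
    exact D.finrank_eq (K := k l p) (hl0 l hl) (hs0 l hl p hp) (D.irreducible_F (hP p hp).1 (hAmem l hl).1
      (hpl l hl p hp) (hpZ p hp) (hlarge l hl p hp)) h0 htop
  have hkdisc : ∀ l ∈ A, ∀ p ∈ P, ∀ [NumberField (k l p)],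
      |(NumberField.discr (k l p) : ℝ)| ≤ C * (N : ℝ) ^ e := by
    intro l hl p hp _
    obtain ⟨hnf, α, h0, htop⟩ := hk l p hl hp
    refine (D.abs_discr_le (K := k l p) (hAmem l hl).1.pos (hs0 l hl p hp) (hkdeg l hl p hp) h0 htop hM
      (hbd _ (hmem l hl p hp)).1 (hbd _ (hmem l hl p hp)).2.1).trans ?_
    have h1 : (l : ℝ) ^ e ≤ (8 * N) ^ e :=
      pow_le_pow_left₀ (by positivity) (by exact_mod_cast (hAmem l hl).2.2) _
    calc C₁ * (l : ℝ) ^ e ≤ C₁ * (8 * N) ^ e := mul_le_mul_of_nonneg_left h1 hC₁0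
      _ = C₁ * 8 ^ e * (N : ℝ) ^ e := by rw [mul_pow]; ring
      _ ≤ C * (N : ℝ) ^ e := mul_le_mul_of_nonneg_right hC1 (by positivity)
  let r : Setoid (Subfield ℂ) :=
    { r := fun K L => Nonempty (K ≃+* L)
      iseqv := ⟨fun _ => ⟨RingEquiv.refl _⟩, fun ⟨h⟩ => ⟨h.symm⟩, fun ⟨h⟩ ⟨h'⟩ => ⟨h.trans h'⟩⟩ }
  obtain ⟨S, hS, hSr, hScard⟩ := Finset.exists_subset_pairwise_not_rel A P k r (a := e)
    (b := d ^ d) (by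
      intro y A' hA' hy
      by_contra! hlt
      obtain ⟨l₀, hl₀⟩ := Finset.card_pos.mp (by omega : 0 < A'.card)
      obtain ⟨p₀, hp₀, ⟨i₀⟩⟩ := hy l₀ hl₀
      obtain ⟨hnf, -⟩ := hk l₀ p₀ (hA' hl₀) hp₀
      have hdvd : ∏ l ∈ A', l ∣ (NumberField.discr (k l₀ p₀)).natAbs := by
        refine Finset.prod_primes_dvd _ (fun l hl => (hAmem l (hA' hl)).1.prime) fun l hl => ?_
        obtain ⟨p, hp, ⟨i⟩⟩ := hy l hl
        obtain ⟨hnf', α, h0, htop⟩ := hk l p (hA' hl) hp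
        rw [← Int.natCast_dvd, ← NumberField.discr_eq_discr_of_ringEquiv _ (i.trans i₀.symm)]
        exact D.dvd_discr (hP p hp).1 (hAmem l (hA' hl)).1 (hpl l (hA' hl) p hp) (hpZ p hp)
          (hlQ l (hA' hl)) (hlZ l (hA' hl)) (hlarge l (hA' hl) p hp) h0
      have h1 : N ^ (e + 1) ≤ ∏ l ∈ A', l :=
        (Nat.pow_le_pow_right hN0 hlt).trans
          (Finset.pow_card_le_prod A' _ _ fun l hl => (hAmem l (hA' hl)).2.1.le)
      have h2 : ∏ l ∈ A', l ≤ (NumberField.discr (k l₀ p₀)).natAbs :=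
        Nat.le_of_dvd (Int.natAbs_pos.mpr (NumberField.discr_ne_zero _)) hdvd
      have h3 : (N : ℝ) ^ (e + 1) ≤ |(NumberField.discr (k l₀ p₀) : ℝ)| := by
        rw [← Int.cast_abs, Int.abs_eq_natAbs, Int.cast_natCast]
        exact_mod_cast h1.trans h2
      have h4 := h3.trans (hkdisc l₀ (hA' hl₀) p₀ hp₀)
      rw [pow_succ, mul_comm] at h4
      exact absurd (le_of_mul_le_mul_right h4 (by positivity)) (not_le.mpr hNC))
    (by
      intro y l hl B hB hy
      rcases hcases with h1 | ⟨h1, h2, h3⟩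
      · exact (Finset.card_le_card hB).trans (h1.trans (Nat.one_le_pow _ _ (by omega)))
      · rcases B.eq_empty_or_nonempty with rfl | ⟨p₀, hp₀⟩
        · simp
        obtain ⟨i₀⟩ := hy p₀ hp₀
        obtain ⟨hnf, -⟩ := hk l p₀ hl (hB hp₀)
        have hNl : (N : ℝ) ≤ l := by exact_mod_cast (hAmem l hl).2.1.le
        refine hcard l W B (hAmem l hl).1 (fun p hp => ⟨(hP p (hB hp)).1, hpl l hl p (hB hp),
          hpZ p (hB hp), ?_, hmem l hl p (hB hp)⟩) (fun p hp q hq => hW p (hB hp) q (hB hq)) ?_ ?_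
          (k l p₀) ?_
        · have := hp8 p (hB hp)
          omega
        · exact ((mul_le_mul_of_nonneg_right hC2 (by positivity)).trans h1).trans hNl
        · obtain ⟨n, hn⟩ := Nat.exists_eq_add_of_le h2
          have hl0' : (0 : ℝ) < l := by linarith
          have hpow : ∀ x : ℝ, x ^ (d * g) = x ^ n * x ^ (2 * g + d) := fun x => by
            rw [hn, pow_add, mul_comm]
          rw [hpow N] at h3
          rw [hpow l]
          have h5 := lt_of_mul_lt_mul_right h3 (by positivity)
          refine mul_lt_mul_of_pos_right ?_ (by positivity)
          refine (mul_le_mul_of_nonneg_right hC2 (by positivity)).trans_lt (h5.trans_le ?_)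
          exact pow_le_pow_left₀ (by positivity) hNl _
        · intro p hp
          obtain ⟨i⟩ := hy p hp
          obtain ⟨hnf', h4⟩ := hk l p hl (hB hp)
          exact exists_root_and_adjoin_eq_top_of_ringEquiv (i.trans i₀.symm) h4)
  refine ⟨S, fun K hK L hL h => hSr K hK L hL h, ?_, ?_⟩
  · intro K hK
    obtain ⟨l, hl, p, hp, rfl⟩ := hS K hK
    obtain ⟨hnf, α, h0, htop⟩ := hk l p hl hp
    refine ⟨hkdeg l hl p hp, hnf, ?_⟩
    intro _
    refine ⟨hkdisc l hl p hp, fun r hr => ?_⟩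
    exact D.exists_injective_classGroup (K := k l p) (hP p hp).1 (hAmem l hl).1 (hpl l hl p hp) (hpZ p hp) (hlQ l hl)
      (hlarge l hl p hp) h0 htop hρ hr
  · calc (A.card : ℝ) * P.card ≤ (e * d ^ d) * S.card := by exact_mod_cast hScard
      _ ≤ C * S.card := mul_le_mul_of_nonneg_right hC3 (by positivity)

end RankDesign

theorem sum_discr_exponent {m g ρ : ℕ} (hm : 1 < m) (hg : 0 < g) :
    ∑ j ∈ Finset.range (ρ + (m - 1) * g - 1), 2 * (m - ((j + 1) - ρ) / g) + 2 * m =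
      (m + 2) * (ρ + (m - 1) * g) + (m - 2) * ρ := by
  have hblock : ∀ n, n ≤ m → ∑ k ∈ Finset.range (n * g), 2 * (m - k / g) =
      g * n * (2 * m + 1 - n) := by
    intro n
    induction n with
    | zero => simp
    | succ n ih =>
      intro hn
      have h1 : ∀ x ∈ Finset.range g, 2 * (m - (n * g + x) / g) = 2 * (m - n) := by
        intro x hx
        rw [Nat.mul_comm n g, Nat.mul_add_div hg, Nat.div_eq_of_lt (Finset.mem_range.mp hx), add_zero]
      rw [add_mul, one_mul, Finset.sum_range_add, ih (by omega), Finset.sum_congr rfl h1,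
        Finset.sum_const, Finset.card_range, smul_eq_mul]
      obtain ⟨k, rfl⟩ := Nat.exists_eq_add_of_le hn
      rw [show 2 * (n + 1 + k) + 1 - n = n + 2 * k + 3 by omega,
        show 2 * (n + 1 + k) + 1 - (n + 1) = n + 2 * k + 2 by omega,
        show n + 1 + k - n = k + 1 by omega]
      ring
  obtain ⟨k, rfl⟩ := Nat.exists_eq_add_of_le hm
  have hd : 0 < (1 + 1 + k - 1) * g := Nat.mul_pos (by omega) hg
  have h0 := Finset.sum_range_succ' (fun i => 2 * (1 + 1 + k - (i - ρ) / g))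
    (ρ + (1 + 1 + k - 1) * g - 1)
  rw [Nat.sub_add_cancel (by omega), Finset.sum_range_add] at h0
  have h1 : ∀ x ∈ Finset.range ρ, 2 * (1 + 1 + k - (x - ρ) / g) = 2 * (k + 2) := by
    intro x hx
    rw [Nat.sub_eq_zero_of_le (Finset.mem_range.mp hx).le, Nat.zero_div, Nat.sub_zero]
    ring
  have h2 := hblock (1 + 1 + k - 1) (by omega)
  rw [Finset.sum_congr rfl h1, Finset.sum_const, Finset.card_range, smul_eq_mul] at h0
  simp only [Nat.add_sub_cancel_left, Nat.zero_sub, Nat.zero_div, Nat.sub_zero] at h0 h2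
  rw [h2, show 2 * (1 + 1 + k) + 1 - (1 + 1 + k - 1) = k + 4 by omega] at h0
  rw [show 1 + 1 + k - 1 = k + 1 by omega] at h0 ⊢
  rw [show 1 + 1 + k - 2 = k by omega, ← h0]
  ring

theorem exists_nat_scale {δ : ℕ} (hδ : 0 < δ) {κ e C c : ℝ} (hκ : 0 < κ) (he : δ / κ ≤ e)
    (hC : 1 ≤ C) (hc : 0 < c) (N₀ : ℕ) : ∃ c' : ℝ, 0 < c' ∧ ∃ X₀ : ℝ, ∀ X, X₀ ≤ X → ∃ N : ℕ,
      N₀ ≤ N ∧ C * (N : ℝ) ^ δ < X ∧ c' * X ^ (1 / κ) / Real.log X ≤ c * (N : ℝ) ^ e / Real.log N := by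
  have hδ0 : (0 : ℝ) < δ := by exact_mod_cast hδ
  refine ⟨c * (1 / 2 : ℝ) ^ (δ / κ) / (2 * C) ^ (1 / κ), by positivity,
    2 * C * (N₀ + 3 : ℝ) ^ δ, fun X hX => ?_⟩
  have hX0 : 0 < X := lt_of_lt_of_le (by positivity) hX
  set y : ℝ := (X / (2 * C)) ^ (1 / (δ : ℝ)) with hy
  have hy0 : 0 < y := by positivity
  have hypow : y ^ δ = X / (2 * C) := by
    rw [hy, ← Real.rpow_mul_natCast (by positivity), one_div_mul_cancel hδ0.ne', Real.rpow_one]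
  have hyN : (N₀ + 3 : ℝ) ≤ y := by
    refine le_of_pow_le_pow_left₀ hδ.ne' hy0.le ?_
    rw [hypow, le_div_iff₀ (by positivity), mul_comm]
    exact hX
  have hNle : (⌊y⌋₊ : ℝ) ≤ y := Nat.floor_le hy0.le
  have hNge : y - 1 < ⌊y⌋₊ := Nat.sub_one_lt_floor y
  have hN₀ : N₀ + 3 ≤ ⌊y⌋₊ := Nat.le_floor (by exact_mod_cast hyN)
  set N := ⌊y⌋₊ with hN
  have hN3 : (3 : ℝ) ≤ N := by exact_mod_cast (by omega : 3 ≤ N)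
  have hpow : C * (N : ℝ) ^ δ < X := by
    have h1 : (N : ℝ) ^ δ ≤ X / (2 * C) := hypow ▸ pow_le_pow_left₀ (by positivity) hNle δ
    calc C * (N : ℝ) ^ δ ≤ C * (X / (2 * C)) := mul_le_mul_of_nonneg_left h1 (by linarith)
      _ = X / 2 := by field_simp
      _ < X := by linarith
  refine ⟨N, by omega, hpow, ?_⟩
  have hlogN : 0 < Real.log N := Real.log_pos (by linarith)
  have hNX : (N : ℝ) ≤ X := by
    have h1 : (N : ℝ) ≤ (N : ℝ) ^ δ := le_self_pow₀ (by linarith) hδ.ne'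
    nlinarith
  have hlog : Real.log N ≤ Real.log X := Real.log_le_log (by linarith) hNX
  have hmain : (1 / 2 : ℝ) ^ (δ / κ) * (X ^ (1 / κ) / (2 * C) ^ (1 / κ)) ≤ (N : ℝ) ^ e := by
    have h1 : (N : ℝ) ^ (δ / κ) ≤ (N : ℝ) ^ e := Real.rpow_le_rpow_of_exponent_le (by linarith) he
    have h2 : (1 / 2 * y) ^ (δ / κ) ≤ (N : ℝ) ^ (δ / κ) :=
      Real.rpow_le_rpow (by positivity) (by linarith) (by positivity)
    refine le_trans (le_of_eq ?_) (h2.trans h1)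
    rw [Real.mul_rpow (by positivity) hy0.le, ← Real.div_rpow hX0.le (by positivity), hy,
      ← Real.rpow_mul (by positivity)]
    congr 2
    field_simp
  calc c * (1 / 2 : ℝ) ^ (δ / κ) / (2 * C) ^ (1 / κ) * X ^ (1 / κ) / Real.log X
      = c * ((1 / 2 : ℝ) ^ (δ / κ) * (X ^ (1 / κ) / (2 * C) ^ (1 / κ))) / Real.log X := by ring
    _ ≤ c * (N : ℝ) ^ e / Real.log X := by gcongr; exact hlogN.le.trans hlog
    _ ≤ c * (N : ℝ) ^ e / Real.log N := by gcongr

theorem exists_window_size {n b : ℕ} (hb : b < n) (hb0 : 0 < b) {e : ℝ}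
    (he : e < 1 + (1 - (b : ℝ) / n)) {C : ℝ} (hC : 1 ≤ C) (lam : ℕ) (hlam : 1 ≤ lam) :
    ∃ c : ℝ, 0 < c ∧ ∃ N₀ : ℕ, ∀ N : ℕ, N₀ ≤ N → ∃ W : ℕ, 1 ≤ W ∧ W ≤ lam * N ∧ C * W ≤ N ∧
      C * (W : ℝ) ^ n * (N : ℝ) ^ b < (N : ℝ) ^ n ∧
      c * (N : ℝ) ^ e / Real.log N ≤
        N / (2 * Real.log N) * (W / (18 * Real.log ((lam * N : ℕ) : ℝ))) := by
  have hn0 : (0 : ℝ) < n := by exact_mod_cast hb0.trans hb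
  have hbR : (b : ℝ) < n := by exact_mod_cast hb
  have hb0R : (0 : ℝ) < b := by exact_mod_cast hb0
  set w : ℝ := 1 - (b : ℝ) / n with hw
  have hw0 : 0 < w := by
    rw [hw, sub_pos, div_lt_one hn0]
    exact hbR
  have hw1 : w < 1 := by
    have : 0 < (b : ℝ) / n := by positivity
    linarith
  have hwn : w * n = (n - b : ℕ) := by
    rw [Nat.cast_sub hb.le, hw]
    field_simp
  set ε : ℝ := 1 + w - e with hε
  have hε0 : 0 < ε := by linarith
  obtain ⟨x₀, hx₀⟩ := Filter.eventually_atTop.mp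
    ((tendsto_rpow_atTop hw0).eventually_ge_atTop (2 * C))
  refine ⟨ε / (288 * C), by positivity, ⌈x₀⌉₊ + lam + 2, fun N hN => ?_⟩
  have hN2 : (2 : ℝ) ≤ N := by exact_mod_cast (by omega : 2 ≤ N)
  have hN0 : (0 : ℝ) < N := by linarith
  have hNx : x₀ ≤ N := (Nat.le_ceil x₀).trans (by exact_mod_cast (by omega : ⌈x₀⌉₊ ≤ N))
  have hNw := hx₀ N hNx
  have hNw1 : (N : ℝ) ^ w ≤ N := by
    calc (N : ℝ) ^ w ≤ (N : ℝ) ^ (1 : ℝ) :=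
          Real.rpow_le_rpow_of_exponent_le (by linarith) hw1.le
      _ = N := Real.rpow_one _
  set z : ℝ := (N : ℝ) ^ w / (2 * C) with hz
  have hz1 : 1 ≤ z := by rw [hz, one_le_div (by positivity)]; exact hNw
  have hzC : C * z = (N : ℝ) ^ w / 2 := by rw [hz]; field_simp
  have hW1 : (⌊z⌋₊ : ℝ) ≤ z := Nat.floor_le (by linarith)
  have hW2 : z - 1 < ⌊z⌋₊ := Nat.sub_one_lt_floor z
  have hW3 : 1 ≤ ⌊z⌋₊ := Nat.le_floor (by exact_mod_cast hz1)
  set W := ⌊z⌋₊ with hW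
  have hW3R : (1 : ℝ) ≤ W := by exact_mod_cast hW3
  have hCW : C * W ≤ N := by
    have := mul_le_mul_of_nonneg_left hW1 (by linarith : 0 ≤ C)
    linarith
  have hWN : W ≤ N := by
    have : (W : ℝ) ≤ N := by nlinarith
    exact_mod_cast this
  refine ⟨W, hW3, hWN.trans (Nat.le_mul_of_pos_left N hlam), hCW, ?_, ?_⟩
  · have h1 : (W : ℝ) ^ n ≤ z ^ n := pow_le_pow_left₀ (by positivity) hW1 n
    have h2 : z ^ n = (N : ℝ) ^ (n - b) / (2 * C) ^ n := by
      rw [hz, div_pow, ← Real.rpow_mul_natCast hN0.le, hwn, Real.rpow_natCast]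
    have h3 : 2 * C ≤ (2 * C) ^ n := le_self_pow₀ (by linarith) (by omega)
    have h4 : (N : ℝ) ^ (n - b) * (N : ℝ) ^ b = (N : ℝ) ^ n := by
      rw [← pow_add, Nat.sub_add_cancel hb.le]
    calc C * (W : ℝ) ^ n * (N : ℝ) ^ b
        ≤ C * ((N : ℝ) ^ (n - b) / (2 * C)) * (N : ℝ) ^ b := by
          gcongr
          rw [h2] at h1
          exact h1.trans (by gcongr)
      _ = (N : ℝ) ^ n / 2 := by rw [← h4]; field_simp
      _ < (N : ℝ) ^ n := by
          have : 0 < (N : ℝ) ^ n := by positivity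
          linarith
  · have hlogN : 0 < Real.log N := Real.log_pos (by linarith)
    have hlam0 : (1 : ℝ) ≤ lam := by exact_mod_cast hlam
    have hlog2 : Real.log ((lam * N : ℕ) : ℝ) ≤ 2 * Real.log N := by
      have h1 : Real.log lam ≤ Real.log N :=
        Real.log_le_log (by linarith) (by exact_mod_cast (by omega : lam ≤ N))
      rw [Nat.cast_mul, Real.log_mul (by linarith) hN0.ne']
      linarith
    have hlogpos : 0 < Real.log ((lam * N : ℕ) : ℝ) := by
      refine Real.log_pos ?_
      push_cast
      nlinarith
    have hlogle : Real.log N ≤ (N : ℝ) ^ ε / ε := Real.log_le_rpow_div hN0.le hε0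
    have hWz : z / 2 ≤ W := by linarith
    have hNe : (N : ℝ) * (N : ℝ) ^ w = (N : ℝ) ^ e * (N : ℝ) ^ ε := by
      rw [← Real.rpow_add hN0, hε, show e + (1 + w - e) = 1 + w by ring, Real.rpow_add hN0,
        Real.rpow_one]
    calc ε / (288 * C) * (N : ℝ) ^ e / Real.log N
        = (N : ℝ) ^ e * (N : ℝ) ^ ε / (2 * Real.log N * (4 * C) * (18 * (2 * ((N : ℝ) ^ ε / ε)))) := by
          field_simp
          norm_num
      _ ≤ (N : ℝ) ^ e * (N : ℝ) ^ ε / (2 * Real.log N * (4 * C) * (18 * (2 * Real.log N))) := by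
          gcongr
      _ ≤ (N : ℝ) ^ e * (N : ℝ) ^ ε /
            (2 * Real.log N * (4 * C) * (18 * Real.log ((lam * N : ℕ) : ℝ))) := by
          gcongr
      _ = N / (2 * Real.log N) * (z / 2 / (18 * Real.log ((lam * N : ℕ) : ℝ))) := by
          rw [← hNe, hz]
          field_simp
          norm_num
      _ ≤ _ := by gcongr

theorem RankDesign.exists_many_fields {m g ρ : ℕ} (D : RankDesign m g ρ) (hρ : ρ + 2 ≤ m) {e : ℝ}
    (he : e ≤ 1 ∨ (2 * g + (ρ + (m - 1) * g) < (ρ + (m - 1) * g) * g ∧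
      e < 1 + (1 - ((2 * g + (ρ + (m - 1) * g) : ℕ) : ℝ) / ((ρ + (m - 1) * g) * g : ℕ)))) :
    ∃ C c : ℝ, 1 ≤ C ∧ 0 < c ∧ ∃ N₀ : ℕ, ∀ N, N₀ ≤ N →
    ∃ S : Finset (Subfield ℂ), (∀ K ∈ S, ∀ L ∈ S, Nonempty (K ≃+* L) → K = L) ∧
      (∀ K ∈ S, Module.finrank ℚ K = ρ + (m - 1) * g ∧ NumberField K ∧ ∀ [NumberField K],
        |(NumberField.discr K : ℝ)| ≤
          C * (N : ℝ) ^ (∑ j ∈ Finset.range (ρ + (m - 1) * g - 1), 2 * (m - ((j + 1) - ρ) / g)) ∧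
        ∀ r : ℕ, (r = 0 ∨ r + m ≤ (ρ + (m - 1) * g + 1) / 2 + g + (if ρ = 0 then 0 else 1)) →
          ∃ f : (Fin r → ZMod m) →+ Additive (ClassGroup (NumberField.RingOfIntegers K)),
            Function.Injective f) ∧
      c * (N : ℝ) ^ e / Real.log N ≤ S.card := by
  obtain ⟨C, lam, N₁, hC, hlam, hfields⟩ := D.exists_fields hρ
  obtain ⟨N₂, hprimes⟩ := exists_le_card_primes_Ioc
  obtain ⟨N₃, hwindow⟩ := exists_primes_window
  have hC0 : 0 < C := by linarith
  rcases he with he | ⟨hlt, he⟩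
  · refine ⟨C, 1 / (2 * C), hC, by positivity, N₁ + N₂ + N₃ + 2, fun N hN => ?_⟩
    have hNlam : N ≤ lam * N := Nat.le_mul_of_pos_left N (by omega)
    obtain ⟨P, hP, -, -, ⟨p, hp⟩⟩ := hwindow (lam * N) 1 (by omega) le_rfl (by omega)
    obtain ⟨S, hS1, hS2, hS3⟩ := hfields N 1 {p} (by omega)
      (fun q hq => by rw [Finset.mem_singleton.mp hq]; exact hP p hp)
      (fun q hq q' hq' => by rw [Finset.mem_singleton.mp hq, Finset.mem_singleton.mp hq']; omega)
      (Or.inl (by simp))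
    refine ⟨S, hS1, hS2, ?_⟩
    have hN1 : (2 : ℝ) ≤ N := by exact_mod_cast (by omega : 2 ≤ N)
    have hlog : 0 < Real.log N := Real.log_pos (by linarith)
    have h1 : (N : ℝ) ^ e ≤ N := by
      calc (N : ℝ) ^ e ≤ (N : ℝ) ^ (1 : ℝ) := Real.rpow_le_rpow_of_exponent_le (by linarith) he
        _ = N := Real.rpow_one _
    rw [Finset.card_singleton, Nat.cast_one, mul_one] at hS3
    have h2 := (hprimes N (by omega)).trans hS3
    calc 1 / (2 * C) * (N : ℝ) ^ e / Real.log N ≤ 1 / (2 * C) * N / Real.log N := by gcongr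
      _ = N / (2 * Real.log N) / C := by field_simp
      _ ≤ S.card := by rw [div_le_iff₀ hC0, mul_comm (S.card : ℝ)]; exact h2
  · obtain ⟨c, hc, N₄, hsize⟩ := exists_window_size hlt (by have := D.degree_pos; omega) he hC lam
      (by omega)
    refine ⟨C, c / C, hC, by positivity, N₁ + N₂ + N₃ + N₄ + 2, fun N hN => ?_⟩
    have hNlam : N ≤ lam * N := Nat.le_mul_of_pos_left N (by omega)
    obtain ⟨W, hW1, hWN, hCW, hCWn, hcount⟩ := hsize N (by omega)
    obtain ⟨P, hP, hPW, hPcard, -⟩ := hwindow (lam * N) W (by omega) hW1 hWN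
    obtain ⟨S, hS1, hS2, hS3⟩ := hfields N W P (by omega) hP hPW (Or.inr ⟨hCW, hlt.le, hCWn⟩)
    refine ⟨S, hS1, hS2, ?_⟩
    have hN1 : (2 : ℝ) ≤ N := by exact_mod_cast (by omega : 2 ≤ N)
    have hlog : 0 < Real.log N := Real.log_pos (by linarith)
    have hlog' : 0 < Real.log ((lam * N : ℕ) : ℝ) :=
      Real.log_pos (by exact_mod_cast (by omega : 1 < lam * N))
    have h1 := mul_le_mul (hprimes N (by omega)) hPcard (by positivity) (by positivity)
    have h2 := (hcount.trans h1).trans hS3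
    calc c / C * (N : ℝ) ^ e / Real.log N = c * (N : ℝ) ^ e / Real.log N / C := by ring
      _ ≤ S.card := by rw [div_le_iff₀ hC0, mul_comm (S.card : ℝ)]; exact h2

theorem counting_exponent_bound {m g ρ : ℕ} (hm : 1 < m) (hg : 1 < g) (hmg : m - 1 ≤ g)
    (hρ : ρ + 2 ≤ m) (hd : (m - 1) ^ 2 < ρ + (m - 1) * g) {δ : ℕ}
    (hδ : δ + 2 * m = (m + 2) * (ρ + (m - 1) * g) + (m - 2) * ρ) :
    (δ : ℝ) / (((m : ℝ) + 1) * (ρ + (m - 1) * g : ℕ) - 1) ≤ 1 ∨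
    (2 * g + (ρ + (m - 1) * g) < (ρ + (m - 1) * g) * g ∧
      (δ : ℝ) / (((m : ℝ) + 1) * (ρ + (m - 1) * g : ℕ) - 1) <
        1 + (1 - ((2 * g + (ρ + (m - 1) * g) : ℕ) : ℝ) / ((ρ + (m - 1) * g) * g : ℕ))) := by
  obtain ⟨k, rfl⟩ := Nat.exists_eq_add_of_le' hm
  rw [show k + 2 - 2 = k by omega, show k + 2 - 1 = k + 1 by omega] at *
  simp only [Nat.succ_eq_add_one, Nat.reduceAdd] at *
  have hδR : (δ : ℝ) = (k + 4) * (ρ + (k + 1) * g) + k * ρ - 2 * (k + 2) := by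
    have : ((δ + 2 * (k + 2) : ℕ) : ℝ) = ((k + 2 + 2) * (ρ + (k + 1) * g) + k * ρ : ℕ) := by
      exact_mod_cast hδ
    push_cast at this
    linarith
  have hgR : (2 : ℝ) ≤ g := by exact_mod_cast hg
  have hkR : (0 : ℝ) ≤ k := by positivity
  have hρR : (0 : ℝ) ≤ ρ := by positivity
  have hmgR : (k : ℝ) + 1 ≤ g := by exact_mod_cast hmg
  have hdR : (2 : ℝ) ≤ ρ + (k + 1) * g := by nlinarith
  have hκ : (0 : ℝ) < ((k + 2 : ℕ) + 1) * (ρ + (k + 1) * g : ℕ) - 1 := by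
    push_cast
    nlinarith
  have hmain : 2 * g + (ρ + (k + 1) * g) < (ρ + (k + 1) * g) * g →
      0 ≤ (g : ℝ) * ((k + 2) * (k + 1) * g - (k + 2) ^ 2 - 3) + ρ * (2 * g - (k + 3)) + 1 →
      (2 * g + (ρ + (k + 1) * g) < (ρ + (k + 1) * g) * g ∧
      (δ : ℝ) / (((k + 2 : ℕ) + 1) * (ρ + (k + 1) * g : ℕ) - 1) <
        1 + (1 - ((2 * g + (ρ + (k + 1) * g) : ℕ) : ℝ) / ((ρ + (k + 1) * g) * g : ℕ))) := by
    intro h1 h2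
    refine ⟨h1, ?_⟩
    rw [div_lt_iff₀ hκ, hδR]
    push_cast
    set d : ℝ := ρ + (k + 1) * g with hdd
    have hd0 : 0 < d := by linarith
    have hg0 : (0 : ℝ) < g := by linarith
    have h3 : (1 + (1 - (2 * g + d) / (d * g))) * ((k + 2 + 1) * d - 1) -
        ((k + 4) * d + k * ρ - 2 * (k + 2)) =
        (d * ((g : ℝ) * ((k + 2) * (k + 1) * g - (k + 2) ^ 2 - 3) + ρ * (2 * g - (k + 3)) + 1)
          + 2 * g) / (d * g) := by
      rw [eq_div_iff (by positivity), show (1 + (1 - (2 * g + d) / (d * g))) =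
        (2 * (d * g) - (2 * g + d)) / (d * g) by field_simp; ring]
      field_simp
      rw [hdd]
      ring
    have h4 : 0 < (d * ((g : ℝ) * ((k + 2) * (k + 1) * g - (k + 2) ^ 2 - 3) +
        ρ * (2 * g - (k + 3)) + 1) + 2 * g) / (d * g) := by positivity
    linarith
  rcases Nat.lt_or_ge k 1 with hk | hk
  · obtain rfl : k = 0 := by omega
    obtain rfl : ρ = 0 := by omega
    rcases Nat.lt_or_ge g 4 with hg4 | hg4
    · left
      rw [div_le_one hκ, hδR]
      have : (g : ℝ) ≤ 3 := by exact_mod_cast (by omega : g ≤ 3)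
      push_cast
      linarith
    · right
      have : (4 : ℝ) ≤ g := by exact_mod_cast hg4
      refine hmain (by nlinarith) ?_
      push_cast
      nlinarith
  · right
    have hk1 : (1 : ℝ) ≤ k := by exact_mod_cast hk
    rcases Nat.lt_or_ge g 3 with hg3 | hg3
    · obtain rfl : g = 2 := by omega
      obtain rfl : k = 1 := by omega
      obtain rfl : ρ = 1 := by omega
      refine hmain (by norm_num) (by norm_num)
    · have hg3R : (3 : ℝ) ≤ g := by exact_mod_cast hg3
      refine hmain ?_ ?_
      · have h1 : (k + 1) * g ≥ 2 * g := Nat.mul_le_mul_right _ (by omega)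
        have h2 : (ρ + (k + 1) * g) * 3 ≤ (ρ + (k + 1) * g) * g := Nat.mul_le_mul_left _ hg3
        omega
      · have h1 : (0 : ℝ) ≤ 2 * g - (k + 3) := by linarith
        have h2 : (0 : ℝ) ≤ (k + 2) * (k + 1) * g - (k + 2) ^ 2 - 3 := by
          rcases Nat.lt_or_ge k 2 with hk2 | hk2
          · obtain rfl : k = 1 := by omega
            push_cast
            linarith
          · have hk2R : (2 : ℝ) ≤ k := by exact_mod_cast hk2
            have : (k + 2 : ℝ) * (k + 1) * (k + 1) ≤ (k + 2) * (k + 1) * g := by gcongr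
            nlinarith
        positivity

theorem toNat_ceil_rank_bound {m g ρ : ℕ} (hm : 1 < m) (hρ : ρ + 2 ≤ m) (a : ℕ) :
    ⌈((a : ℕ) : ℚ) + ((ρ + (m - 1) * g : ℕ) : ℚ) / ((m : ℚ) - 1) - (m : ℚ)⌉.toNat = 0 ∨
    ⌈((a : ℕ) : ℚ) + ((ρ + (m - 1) * g : ℕ) : ℚ) / ((m : ℚ) - 1) - (m : ℚ)⌉.toNat + m ≤
      a + g + (if ρ = 0 then 0 else 1) := by
  have hm0 : (0 : ℚ) < (m : ℚ) - 1 := by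
    have : (1 : ℚ) < m := by exact_mod_cast hm
    linarith
  set i : ℕ := if ρ = 0 then 0 else 1 with hi
  have hρi : ρ ≤ i * (m - 1) := by
    rw [hi]
    split_ifs with h
    · omega
    · omega
  have hdiv : ((ρ + (m - 1) * g : ℕ) : ℚ) / ((m : ℚ) - 1) ≤ g + i := by
    rw [div_le_iff₀ hm0]
    have h1 : ρ + (m - 1) * g ≤ (g + i) * (m - 1) := by linarith
    have h2 : ((ρ + (m - 1) * g : ℕ) : ℚ) ≤ ((g + i) * (m - 1) : ℕ) := by exact_mod_cast h1
    refine h2.trans_eq ?_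
    rw [Nat.cast_mul, Nat.cast_sub hm.le]
    push_cast
    ring
  have hceil : ⌈((a : ℕ) : ℚ) + ((ρ + (m - 1) * g : ℕ) : ℚ) / ((m : ℚ) - 1) - (m : ℚ)⌉ ≤
      ((a : ℤ) + g + i - m) := by
    rw [Int.ceil_le]
    push_cast
    push_cast at hdiv
    linarith
  omega

/-- Let `m, d > 1` with `d > (m−1)²`. There are
`≫ X^(1/((m+1)d−1))/log X` number fields `k` of degree `d` with `|Disc(k)| < X` and
`rank_m Cl(k) ≥ ⌈⌊(d+1)/2⌋ + d/(m−1) − m⌉`. -/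
theorem higher_degree_quantitative (m d : ℕ) (hm : 1 < m) (hd : 1 < d)
    (hdm : (m - 1 : ℕ) ^ 2 < d) :
    ∃ c : ℝ, 0 < c ∧ ∃ X₀ : ℝ, ∀ X : ℝ, X₀ ≤ X →
      ∃ S : Finset (Subfield ℂ),
        -- the fields in `S` are pairwise non-isomorphic
        (∀ K ∈ S, ∀ L ∈ S, Nonempty (↥K ≃+* ↥L) → K = L) ∧
        (∀ K ∈ S,
          -- `K` is a number field of degree `d`
          Module.finrank ℚ ↥K = d ∧
          NumberField ↥K ∧
          (∀ [NumberField ↥K],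
            -- `|Disc K| < X`
            |(NumberField.discr ↥K : ℝ)| < X ∧
            -- `rank_m Cl(K) ≥ ⌈⌊(d+1)/2⌋ + d/(m−1) − m⌉`
            ∃ f : (Fin (⌈(((d + 1) / 2 : ℕ) : ℚ) + (d : ℚ) / ((m : ℚ) - 1) - (m : ℚ)⌉.toNat) →
                ZMod m) →+ Additive (ClassGroup (𝓞 ↥K)),
              Function.Injective f)) ∧
        c * X ^ (1 / (((m : ℝ) + 1) * d - 1)) / Real.log X ≤ S.card := by
  obtain ⟨g, ρ, rfl, hρ⟩ : ∃ g ρ, ρ + (m - 1) * g = d ∧ ρ + 2 ≤ m :=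
    ⟨d / (m - 1), d % (m - 1), Nat.mod_add_div _ _, by
      have := Nat.mod_lt d (by omega : 0 < m - 1)
      omega⟩
  have hmg : m - 1 ≤ g := by
    by_contra! h
    have h1 : (m - 1) * (g + 1) ≤ (m - 1) * (m - 1) := Nat.mul_le_mul_left _ h
    rw [mul_add, mul_one] at h1
    rw [pow_two] at hdm
    omega
  have hg : 1 < g := by
    rcases Nat.lt_or_ge m 3 with h | h
    · obtain rfl : m = 2 := by omega
      omega
    · omega
  obtain ⟨D⟩ := RankDesign.nonempty (m := m) (g := g) (ρ := ρ) hm hg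
  have hsum := sum_discr_exponent (ρ := ρ) hm (by omega : 0 < g)
  set δ := ∑ j ∈ Finset.range (ρ + (m - 1) * g - 1), 2 * (m - ((j + 1) - ρ) / g) with hδ
  have hδ0 : 0 < δ := by nlinarith
  have hκ : (0 : ℝ) < ((m : ℝ) + 1) * (ρ + (m - 1) * g : ℕ) - 1 := by
    have h1 : (1 : ℝ) < m := by exact_mod_cast hm
    have h2 : (1 : ℝ) < (ρ + (m - 1) * g : ℕ) := by exact_mod_cast hd
    nlinarith
  obtain ⟨C, c, hC, hc, N₀, hN₀⟩ :=
    D.exists_many_fields hρ (counting_exponent_bound hm hg hmg hρ hdm hsum)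
  obtain ⟨c', hc', X₀, hX₀⟩ := exists_nat_scale hδ0 hκ le_rfl hC hc N₀
  refine ⟨c', hc', X₀, fun X hX => ?_⟩
  obtain ⟨N, hN, hNX, hcount⟩ := hX₀ X hX
  obtain ⟨S, hS1, hS2, hS3⟩ := hN₀ N hN
  refine ⟨S, hS1, fun K hK => ?_, hcount.trans hS3⟩
  obtain ⟨h1, h2, h3⟩ := hS2 K hK
  exact ⟨h1, h2, fun [_] => ⟨h3.1.trans_lt hNX, h3.2 _ (toNat_ceil_rank_bound hm hρ _)⟩⟩
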